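/- Convergence–divergence dichotomy: let c ∈ ℝ, let Ω ⊆ ℝ² be open, and let (u_n) be a monotone increasing sequence (u_n ≤ u_{n+1} pointwise) of smooth c-translator solutions on Ω. Define the convergence set 𝒞 = {p ∈ Ω : sup_n u_n(p) < ∞}. Then 𝒞 is open in Ω, the sequence (u_n) converges uniformly on every compact subset of 𝒞 to a smooth c-translator solution on 𝒞, and (u_n) diverges uniformly to +∞ on every compact subset of the divergence set 𝒟 = Ω \ 𝒞. In particular, if (u_n(p)) is bounded at some point p ∈ Ω, then 𝒞 is non-empty. -/

import Mathlib

open Real Set Filter Topology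

/-- The partial derivative in the first (x) direction. -/
noncomputable def pdx (u : ℝ × ℝ → ℝ) (p : ℝ × ℝ) : ℝ := fderiv ℝ u p (1, 0)

/-- The partial derivative in the second (t) direction. -/
noncomputable def pdt (u : ℝ × ℝ → ℝ) (p : ℝ × ℝ) : ℝ := fderiv ℝ u p (0, 1)

/-- `u` is a smooth c-translator solution on `Ω`: it is C^∞ on `Ω` and satisfies
`(1+u_t²)u_xx - 2u_x u_t u_xt + (1+u_x²)u_tt + c u_t (1+u_x²+u_t²) = 0` there. -/
def IsSmoothTranslator (c : ℝ) (Ω : Set (ℝ × ℝ)) (u : ℝ × ℝ → ℝ) : Prop :=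
  ContDiffOn ℝ (⊤ : ℕ∞) u Ω ∧ ∀ p ∈ Ω,
    (1 + pdt u p ^ 2) * pdx (pdx u) p - 2 * pdx u p * pdt u p * pdx (pdt u) p
      + (1 + pdx u p ^ 2) * pdt (pdt u) p
      + c * pdt u p * (1 + pdx u p ^ 2 + pdt u p ^ 2) = 0

/-- The convergence set of a sequence of functions on `Ω`: the points of `Ω` where the
sequence is bounded above. -/
def convSet (Ω : Set (ℝ × ℝ)) (u : ℕ → ℝ × ℝ → ℝ) : Set (ℝ × ℝ) :=
  {p ∈ Ω | ∃ M : ℝ, ∀ n, u n p ≤ M}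

/-- The derivative of `F` in the direction `e`. -/
noncomputable def dirD (e : ℝ × ℝ) (F : ℝ × ℝ → ℝ) (x : ℝ × ℝ) : ℝ := fderiv ℝ F x e

section Calculus

variable {Ω : Set (ℝ × ℝ)} {F G : ℝ × ℝ → ℝ} {x : ℝ × ℝ}

lemma differentiableAt_of_smooth (hΩ : IsOpen Ω) (hF : ContDiffOn ℝ (⊤ : ℕ∞) F Ω) (hx : x ∈ Ω) :
    DifferentiableAt ℝ F x :=
  (hF.differentiableOn (by simp)).differentiableAt (hΩ.mem_nhds hx)

lemma smooth_dirD (hΩ : IsOpen Ω) (hF : ContDiffOn ℝ (⊤ : ℕ∞) F Ω) (e : ℝ × ℝ) :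
    ContDiffOn ℝ (⊤ : ℕ∞) (dirD e F) Ω := by
  have h := hF.fderiv_of_isOpen (m := (⊤ : ℕ∞)) hΩ (by simp)
  exact h.clm_apply contDiffOn_const

lemma smooth_add (hF : ContDiffOn ℝ (⊤ : ℕ∞) F Ω) (hG : ContDiffOn ℝ (⊤ : ℕ∞) G Ω) :
    ContDiffOn ℝ (⊤ : ℕ∞) (F + G) Ω := hF.add hG

lemma smooth_mul (hF : ContDiffOn ℝ (⊤ : ℕ∞) F Ω) (hG : ContDiffOn ℝ (⊤ : ℕ∞) G Ω) :
    ContDiffOn ℝ (⊤ : ℕ∞) (F * G) Ω := hF.mul hG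

lemma dirD_congr (hΩ : IsOpen Ω) (h : EqOn F G Ω) (e : ℝ × ℝ) : EqOn (dirD e F) (dirD e G) Ω := by
  intro y hy
  have : F =ᶠ[𝓝 y] G := Filter.eventuallyEq_of_mem (hΩ.mem_nhds hy) h
  simp only [dirD, this.fderiv_eq]

lemma dirD_add (hF : DifferentiableAt ℝ F x) (hG : DifferentiableAt ℝ G x) (e : ℝ × ℝ) :
    dirD e (F + G) x = dirD e F x + dirD e G x := by
  simp [dirD, fderiv_add hF hG]

lemma dirD_mul (hF : DifferentiableAt ℝ F x) (hG : DifferentiableAt ℝ G x) (e : ℝ × ℝ) :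
    dirD e (F * G) x = F x * dirD e G x + G x * dirD e F x := by
  simp [dirD, fderiv_mul hF hG]

lemma dirD_const (k : ℝ) (e : ℝ × ℝ) : dirD e (fun _ => k) = fun _ => 0 := by
  funext y; simp [dirD]

lemma dirD_comp {φ : ℝ → ℝ} {φ' : ℝ} (hF : DifferentiableAt ℝ F x)
    (hφ : HasDerivAt φ φ' (F x)) (e : ℝ × ℝ) :
    dirD e (fun y => φ (F y)) x = φ' * dirD e F x := by
  have := (hφ.comp_hasFDerivAt x hF.hasFDerivAt).fderiv
  simp only [dirD]
  rw [show (fun y => φ (F y)) = φ ∘ F from rfl, this]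
  simp

lemma dirD_lin (a b : ℝ) (e f : ℝ × ℝ) (F : ℝ × ℝ → ℝ) (x : ℝ × ℝ) :
    dirD (a • e + b • f) F x = a * dirD e F x + b * dirD f F x := by
  simp [dirD]

lemma dirD_comm (hΩ : IsOpen Ω) (hF : ContDiffOn ℝ (⊤ : ℕ∞) F Ω) (hx : x ∈ Ω) (e f : ℝ × ℝ) :
    dirD e (dirD f F) x = dirD f (dirD e F) x := by
  have hc : ContDiffAt ℝ (⊤ : ℕ∞) F x := hF.contDiffAt (hΩ.mem_nhds hx)
  have hs : IsSymmSndFDerivAt ℝ F x := hc.isSymmSndFDerivAt (by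
    simp only [minSmoothness_of_isRCLikeNormedField]; exact ENat.LEInfty.out)
  have hd : DifferentiableAt ℝ (fderiv ℝ F) x :=
    ((hF.fderiv_of_isOpen (m := (⊤ : ℕ∞)) hΩ (by simp)).differentiableOn
      (by simp)).differentiableAt (hΩ.mem_nhds hx)
  have key : ∀ v w : ℝ × ℝ, dirD v (dirD w F) x = fderiv ℝ (fderiv ℝ F) x v w := by
    intro v w
    have : HasFDerivAt (dirD w F) ((fderiv ℝ (fderiv ℝ F) x).flip w) x := by
      have := hd.hasFDerivAt.clm_apply (hasFDerivAt_const w x)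
      simp only [ContinuousLinearMap.comp_zero, zero_add] at this
      exact this
    simp [dirD, this.fderiv]
  rw [key, key]
  exact hs e f

lemma dirD_dirD_mul (hΩ : IsOpen Ω) (hF : ContDiffOn ℝ (⊤ : ℕ∞) F Ω)
    (hG : ContDiffOn ℝ (⊤ : ℕ∞) G Ω) (hx : x ∈ Ω) (e f : ℝ × ℝ) :
    dirD e (dirD f (F * G)) x = F x * dirD e (dirD f G) x + G x * dirD e (dirD f F) x
      + dirD e F x * dirD f G x + dirD f F x * dirD e G x := by
  have h : EqOn (dirD f (F * G)) (F * dirD f G + G * dirD f F) Ω := by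
    intro y hy
    exact dirD_mul (differentiableAt_of_smooth hΩ hF hy) (differentiableAt_of_smooth hΩ hG hy) f
  have dF := differentiableAt_of_smooth hΩ hF hx
  have dG := differentiableAt_of_smooth hΩ hG hx
  have dF' := differentiableAt_of_smooth hΩ (smooth_dirD hΩ hF f) hx
  have dG' := differentiableAt_of_smooth hΩ (smooth_dirD hΩ hG f) hx
  rw [dirD_congr hΩ h e hx, dirD_add (dF.mul dG') (dG.mul dF'), dirD_mul dF dG', dirD_mul dG dF']
  ring

lemma dirD_dirD_add (hΩ : IsOpen Ω) (hF : ContDiffOn ℝ (⊤ : ℕ∞) F Ω)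
    (hG : ContDiffOn ℝ (⊤ : ℕ∞) G Ω) (hx : x ∈ Ω) (e f : ℝ × ℝ) :
    dirD e (dirD f (F + G)) x = dirD e (dirD f F) x + dirD e (dirD f G) x := by
  have h : EqOn (dirD f (F + G)) (dirD f F + dirD f G) Ω := by
    intro y hy
    exact dirD_add (differentiableAt_of_smooth hΩ hF hy) (differentiableAt_of_smooth hΩ hG hy) f
  have dF' := differentiableAt_of_smooth hΩ (smooth_dirD hΩ hF f) hx
  have dG' := differentiableAt_of_smooth hΩ (smooth_dirD hΩ hG f) hx
  rw [dirD_congr hΩ h e hx, dirD_add dF' dG']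

lemma dirD_dirD_const (k : ℝ) (e f : ℝ × ℝ) : dirD e (dirD f (fun _ => k)) = fun _ => 0 := by
  rw [dirD_const, dirD_const]

lemma dirD_dirD_comp {φ φ' φ'' : ℝ → ℝ} (hΩ : IsOpen Ω) (hF : ContDiffOn ℝ (⊤ : ℕ∞) F Ω)
    (hφ : ∀ y ∈ Ω, HasDerivAt φ (φ' (F y)) (F y))
    (hφ' : HasDerivAt φ' (φ'' (F x)) (F x)) (hx : x ∈ Ω) (e f : ℝ × ℝ) :
    dirD e (dirD f (fun y => φ (F y))) x
      = φ' (F x) * dirD e (dirD f F) x + φ'' (F x) * dirD e F x * dirD f F x := by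
  have h : EqOn (dirD f (fun y => φ (F y))) ((fun y => φ' (F y)) * dirD f F) Ω := by
    intro y hy
    exact dirD_comp (differentiableAt_of_smooth hΩ hF hy) (hφ y hy) f
  have dF := differentiableAt_of_smooth hΩ hF hx
  have dF' := differentiableAt_of_smooth hΩ (smooth_dirD hΩ hF f) hx
  have d1 : DifferentiableAt ℝ (fun y => φ' (F y)) x := hφ'.differentiableAt.comp x dF
  rw [dirD_congr hΩ h e hx, dirD_mul d1 dF', dirD_comp dF hφ']
  ring

lemma dirD_eq_zero_of_isLocalMax (h : IsLocalMax F x) (e : ℝ × ℝ) : dirD e F x = 0 := by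
  simp [dirD, h.fderiv_eq_zero]

lemma hasDerivAt_line {s : ℝ} {e : ℝ × ℝ} (hF : DifferentiableAt ℝ F (x + s • e)) :
    HasDerivAt (fun t : ℝ => F (x + t • e)) (dirD e F (x + s • e)) s := by
  have h1 : HasDerivAt (fun t : ℝ => x + t • e) e s := by
    simpa using ((hasDerivAt_id s).smul_const e).const_add x
  exact hF.hasFDerivAt.comp_hasDerivAt s h1

lemma dirD_dirD_nonpos_of_isLocalMax (hΩ : IsOpen Ω) (hF : ContDiffOn ℝ (⊤ : ℕ∞) F Ω)
    (hx : x ∈ Ω) (h : IsLocalMax F x) (e : ℝ × ℝ) : dirD e (dirD e F) x ≤ 0 := by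
  by_contra hpos
  push Not at hpos
  have hline : Continuous (fun t : ℝ => x + t • e) := by fun_prop
  have hev : ∀ᶠ t in 𝓝 (0 : ℝ), x + t • e ∈ Ω := by
    apply hline.continuousAt.eventually_mem
    simpa using hΩ.mem_nhds hx
  have hd : deriv (fun t : ℝ => F (x + t • e)) =ᶠ[𝓝 0] fun t => dirD e F (x + t • e) := by
    filter_upwards [hev] with t ht
    exact (hasDerivAt_line (differentiableAt_of_smooth hΩ hF ht)).deriv
  have hd0 : deriv (fun t : ℝ => F (x + t • e)) 0 = 0 := by
    rw [hd.eq_of_nhds]; simpa using dirD_eq_zero_of_isLocalMax h e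
  have hdd : deriv (deriv (fun t : ℝ => F (x + t • e))) 0 = dirD e (dirD e F) x := by
    rw [hd.deriv_eq]
    have := (hasDerivAt_line (x := x) (s := 0) (e := e) (F := dirD e F)
      (differentiableAt_of_smooth hΩ (smooth_dirD hΩ hF e) (by simpa using hx))).deriv
    simpa using this
  have hcont : ContinuousAt (fun t : ℝ => F (x + t • e)) 0 :=
    (hasDerivAt_line (x := x) (s := 0) (e := e)
      (differentiableAt_of_smooth hΩ hF (by simpa using hx))).continuousAt
  have hmin := isLocalMin_of_deriv_deriv_pos (f := fun t : ℝ => F (x + t • e)) (x₀ := 0)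
    (by rw [hdd]; exact hpos) hd0 hcont
  have hmax : IsLocalMax (fun t : ℝ => F (x + t • e)) 0 := by
    have : Tendsto (fun t : ℝ => x + t • e) (𝓝 0) (𝓝 x) := by
      simpa using hline.tendsto 0
    simpa [IsLocalMax, IsMaxFilter] using this.eventually h
  have hconst : (fun t : ℝ => F (x + t • e)) =ᶠ[𝓝 0] fun _ => F x := by
    filter_upwards [hmin, hmax] with t h1 h2
    simp at h1 h2
    exact le_antisymm h2 h1
  have : deriv (deriv (fun t : ℝ => F (x + t • e))) 0 = 0 := by
    rw [hconst.deriv.deriv_eq]; simp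
  linarith

end Calculus

/-- The second order operator with frozen coefficients attached to a frame `(e, f)` and to the
gradient components `P`, `Q` in that frame. -/
noncomputable def lin (e f : ℝ × ℝ) (P Q b₁ b₂ : ℝ) (F : ℝ × ℝ → ℝ) (x : ℝ × ℝ) : ℝ :=
  (1 + Q ^ 2) * dirD e (dirD e F) x - 2 * P * Q * dirD e (dirD f F) x
    + (1 + P ^ 2) * dirD f (dirD f F) x
    + (1 + P ^ 2 + Q ^ 2) * (b₁ * dirD e F x + b₂ * dirD f F x)

/-- The carré du champ of `lin`. -/
noncomputable def gam (e f : ℝ × ℝ) (P Q : ℝ) (F G : ℝ × ℝ → ℝ) (x : ℝ × ℝ) : ℝ :=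
  dirD e F x * dirD e G x + dirD f F x * dirD f G x
    + (Q * dirD e F x - P * dirD f F x) * (Q * dirD e G x - P * dirD f G x)

section Operator

variable {Ω : Set (ℝ × ℝ)} {F G H : ℝ × ℝ → ℝ} {x : ℝ × ℝ} (e f : ℝ × ℝ) (P Q b₁ b₂ : ℝ)

lemma lin_add (hΩ : IsOpen Ω) (hF : ContDiffOn ℝ (⊤ : ℕ∞) F Ω)
    (hG : ContDiffOn ℝ (⊤ : ℕ∞) G Ω) (hx : x ∈ Ω) :
    lin e f P Q b₁ b₂ (F + G) x = lin e f P Q b₁ b₂ F x + lin e f P Q b₁ b₂ G x := by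
  simp only [lin, dirD_dirD_add hΩ hF hG hx,
    dirD_add (differentiableAt_of_smooth hΩ hF hx) (differentiableAt_of_smooth hΩ hG hx)]
  ring

lemma lin_mul (hΩ : IsOpen Ω) (hF : ContDiffOn ℝ (⊤ : ℕ∞) F Ω)
    (hG : ContDiffOn ℝ (⊤ : ℕ∞) G Ω) (hx : x ∈ Ω) :
    lin e f P Q b₁ b₂ (F * G) x = F x * lin e f P Q b₁ b₂ G x + G x * lin e f P Q b₁ b₂ F x
      + 2 * gam e f P Q F G x := by
  simp only [lin, gam, dirD_dirD_mul hΩ hF hG hx,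
    dirD_mul (differentiableAt_of_smooth hΩ hF hx) (differentiableAt_of_smooth hΩ hG hx)]
  ring

lemma lin_const (k : ℝ) : lin e f P Q b₁ b₂ (fun _ => k) x = 0 := by
  simp [lin, dirD_const]

lemma gam_const_left (k : ℝ) : gam e f P Q (fun _ => k) F x = 0 := by
  simp [gam, dirD_const]

lemma lin_comp {φ φ' φ'' : ℝ → ℝ} (hΩ : IsOpen Ω) (hF : ContDiffOn ℝ (⊤ : ℕ∞) F Ω)
    (hφ : ∀ y ∈ Ω, HasDerivAt φ (φ' (F y)) (F y))
    (hφ' : HasDerivAt φ' (φ'' (F x)) (F x)) (hx : x ∈ Ω) :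
    lin e f P Q b₁ b₂ (fun y => φ (F y)) x
      = φ' (F x) * lin e f P Q b₁ b₂ F x + φ'' (F x) * gam e f P Q F F x := by
  simp only [lin, gam, dirD_dirD_comp hΩ hF hφ hφ' hx,
    dirD_comp (differentiableAt_of_smooth hΩ hF hx) (hφ x hx)]
  ring

lemma gam_symm : gam e f P Q F G x = gam e f P Q G F x := by
  simp only [gam]; ring

lemma gam_add_left (hF : DifferentiableAt ℝ F x) (hG : DifferentiableAt ℝ G x) :
    gam e f P Q (F + G) H x = gam e f P Q F H x + gam e f P Q G H x := by
  simp only [gam, dirD_add hF hG]; ring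

lemma gam_mul_left (hF : DifferentiableAt ℝ F x) (hG : DifferentiableAt ℝ G x) :
    gam e f P Q (F * G) H x = F x * gam e f P Q G H x + G x * gam e f P Q F H x := by
  simp only [gam, dirD_mul hF hG]; ring

lemma gam_self_ge : dirD e F x ^ 2 + dirD f F x ^ 2 ≤ gam e f P Q F F x := by
  simp only [gam]; nlinarith [sq_nonneg (Q * dirD e F x - P * dirD f F x)]

lemma gam_self_nonneg : 0 ≤ gam e f P Q F F x := by
  simp only [gam]; nlinarith [sq_nonneg (Q * dirD e F x - P * dirD f F x),
    sq_nonneg (dirD e F x), sq_nonneg (dirD f F x)]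

lemma gam_self_le {P Q Λ : ℝ} (hP : |P| ≤ Λ) (hQ : |Q| ≤ Λ) :
    gam e f P Q F F x ≤ (1 + 2 * Λ ^ 2) * (dirD e F x ^ 2 + dirD f F x ^ 2) := by
  have h1 : P ^ 2 ≤ Λ ^ 2 := sq_le_sq' (by linarith [neg_abs_le P]) (by linarith [le_abs_self P])
  have h2 : Q ^ 2 ≤ Λ ^ 2 := sq_le_sq' (by linarith [neg_abs_le Q]) (by linarith [le_abs_self Q])
  simp only [gam]
  nlinarith [sq_nonneg (Q * dirD f F x + P * dirD e F x),
    mul_le_mul_of_nonneg_right (add_le_add h1 h2)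
      (add_nonneg (sq_nonneg (dirD e F x)) (sq_nonneg (dirD f F x)))]

lemma dirD_dirD_lin (hΩ : IsOpen Ω) (hF : ContDiffOn ℝ (⊤ : ℕ∞) F Ω) (hx : x ∈ Ω)
    (a b a' b' : ℝ) :
    dirD (a • e + b • f) (dirD (a' • e + b' • f) F) x
      = a * a' * dirD e (dirD e F) x + (a * b' + b * a') * dirD e (dirD f F) x
        + b * b' * dirD f (dirD f F) x := by
  have h : dirD (a' • e + b' • f) F = (fun _ => a') * dirD e F + (fun _ => b') * dirD f F := by
    funext y; simp [dirD_lin]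
  have de := differentiableAt_of_smooth hΩ (smooth_dirD hΩ hF e) hx
  have df := differentiableAt_of_smooth hΩ (smooth_dirD hΩ hF f) hx
  have dc : ∀ k : ℝ, DifferentiableAt ℝ (fun _ : ℝ × ℝ => k) x :=
    fun k => differentiableAt_const k
  rw [dirD_lin, h]
  simp only [dirD_add ((dc a').mul de) ((dc b').mul df), dirD_mul (dc _) de, dirD_mul (dc _) df,
    dirD_const, dirD_comm hΩ hF hx f e]
  ring

lemma lin_nonpos_of_isLocalMax (hΩ : IsOpen Ω) (hF : ContDiffOn ℝ (⊤ : ℕ∞) F Ω) (hx : x ∈ Ω)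
    (h : IsLocalMax F x) : lin e f P Q b₁ b₂ F x ≤ 0 := by
  have h1 := dirD_dirD_nonpos_of_isLocalMax hΩ hF hx h e
  have h2 := dirD_dirD_nonpos_of_isLocalMax hΩ hF hx h f
  have h3 := dirD_dirD_nonpos_of_isLocalMax hΩ hF hx h (Q • e + (-P) • f)
  rw [dirD_dirD_lin e f hΩ hF hx] at h3
  simp only [lin, dirD_eq_zero_of_isLocalMax h]
  linarith

/-- The squared Euclidean distance to `x₀`. -/
def sqDist (x₀ : ℝ × ℝ) (x : ℝ × ℝ) : ℝ := (x.1 - x₀.1) ^ 2 + (x.2 - x₀.2) ^ 2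

lemma smooth_sqDist (x₀ : ℝ × ℝ) (s : Set (ℝ × ℝ)) : ContDiffOn ℝ (⊤ : ℕ∞) (sqDist x₀) s := by
  unfold sqDist; fun_prop

lemma dirD_sqDist (x₀ e : ℝ × ℝ) :
    dirD e (sqDist x₀) = fun x => 2 * (x.1 - x₀.1) * e.1 + 2 * (x.2 - x₀.2) * e.2 := by
  funext x
  have h1 : HasFDerivAt (fun y : ℝ × ℝ => y.1 - x₀.1) (ContinuousLinearMap.fst ℝ ℝ ℝ) x :=
    hasFDerivAt_fst.sub_const _
  have h2 : HasFDerivAt (fun y : ℝ × ℝ => y.2 - x₀.2) (ContinuousLinearMap.snd ℝ ℝ ℝ) x :=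
    hasFDerivAt_snd.sub_const _
  have h := (h1.pow 2).add (h2.pow 2)
  have h' : fderiv ℝ (sqDist x₀) x = _ := h.fderiv
  simp only [dirD, h']
  simp

lemma dirD_dirD_sqDist (x₀ e f : ℝ × ℝ) :
    dirD e (dirD f (sqDist x₀)) = fun _ => 2 * e.1 * f.1 + 2 * e.2 * f.2 := by
  rw [dirD_sqDist]
  funext x
  have h1 : HasFDerivAt (fun y : ℝ × ℝ => y.1 - x₀.1) (ContinuousLinearMap.fst ℝ ℝ ℝ) x :=
    hasFDerivAt_fst.sub_const _
  have h2 : HasFDerivAt (fun y : ℝ × ℝ => y.2 - x₀.2) (ContinuousLinearMap.snd ℝ ℝ ℝ) x :=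
    hasFDerivAt_snd.sub_const _
  have h := ((h1.const_mul 2).mul_const f.1).add ((h2.const_mul 2).mul_const f.2)
  have h' : fderiv ℝ (fun x : ℝ × ℝ => 2 * (x.1 - x₀.1) * f.1 + 2 * (x.2 - x₀.2) * f.2) x = _ :=
    h.fderiv
  simp only [dirD, h']
  simp
  ring

lemma mem_closedBall_of_sqDist_le {x₀ x : ℝ × ℝ} {R : ℝ} (hR : 0 ≤ R)
    (h : sqDist x₀ x ≤ R ^ 2) : x ∈ Metric.closedBall x₀ R := by
  unfold sqDist at h
  rw [Metric.mem_closedBall, Prod.dist_eq, Real.dist_eq, Real.dist_eq]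
  exact max_le (abs_le_of_sq_le_sq (by nlinarith [sq_nonneg (x.2 - x₀.2)]) hR)
    (abs_le_of_sq_le_sq (by nlinarith [sq_nonneg (x.1 - x₀.1)]) hR)

lemma isCompact_sqDist_le (x₀ : ℝ × ℝ) {R : ℝ} (hR : 0 ≤ R) :
    IsCompact {x | sqDist x₀ x ≤ R ^ 2} := by
  refine (isCompact_closedBall x₀ R).of_isClosed_subset ?_
    fun x hx => mem_closedBall_of_sqDist_le hR hx
  have : Continuous (sqDist x₀) := by unfold sqDist; fun_prop
  exact isClosed_le this continuous_const

lemma lin_sqDist_le {P Q Λ c R : ℝ} (x₀ : ℝ × ℝ) (hR : 0 ≤ R) (hP : P ^ 2 ≤ Λ ^ 2)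
    (hQ : Q ^ 2 ≤ Λ ^ 2) (hx : sqDist x₀ x ≤ R ^ 2) :
    lin (1, 0) (0, 1) P Q 0 c (sqDist x₀) x
      ≤ 4 + 4 * Λ ^ 2 + (1 + 2 * Λ ^ 2) * (2 * |c| * R) := by
  have h2 : |x.2 - x₀.2| ≤ R := by
    unfold sqDist at hx
    exact abs_le_of_sq_le_sq (by nlinarith [sq_nonneg (x.1 - x₀.1)]) hR
  have h3 : c * (2 * (x.2 - x₀.2)) ≤ 2 * |c| * R := by
    calc c * (2 * (x.2 - x₀.2)) ≤ |c * (2 * (x.2 - x₀.2))| := le_abs_self _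
      _ = 2 * |c| * |x.2 - x₀.2| := by rw [abs_mul, abs_mul, abs_two]; ring
      _ ≤ _ := by gcongr
  have h4 : (1 + P ^ 2 + Q ^ 2) * (c * (2 * (x.2 - x₀.2)))
      ≤ (1 + 2 * Λ ^ 2) * (2 * |c| * R) := by
    calc _ ≤ (1 + P ^ 2 + Q ^ 2) * (2 * |c| * R) := by gcongr
      _ ≤ _ := by
        have : 0 ≤ 2 * |c| * R := by positivity
        nlinarith
  rw [lin, dirD_dirD_sqDist, dirD_dirD_sqDist, dirD_dirD_sqDist]
  simp only [dirD_sqDist]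
  nlinarith

end Operator

set_option maxHeartbeats 1000000 in
/-- An interior bound by the maximum principle: the cubic term in the differential inequality
makes `F` bounded at the centre of the ball, independently of its values on the boundary. -/
lemma exists_bound_of_cubic (c δ C Λ R : ℝ) (hδ : 0 < δ) (hC : 0 ≤ C) (hR : 0 < R) :
    ∃ B : ℝ, ∀ (Ω : Set (ℝ × ℝ)) (P Q F : ℝ × ℝ → ℝ) (x₀ : ℝ × ℝ), IsOpen Ω →
      Metric.closedBall x₀ R ⊆ Ω → ContDiffOn ℝ (⊤ : ℕ∞) F Ω →
      (∀ x ∈ Metric.closedBall x₀ R, |P x| ≤ Λ ∧ |Q x| ≤ Λ) →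
      (∀ x ∈ Metric.closedBall x₀ R, 1 ≤ F x →
        δ * F x ^ 3 ≤ F x * lin (1, 0) (0, 1) (P x) (Q x) 0 c F x
          + C * gam (1, 0) (0, 1) (P x) (Q x) F F x + C * F x ^ 2) →
      F x₀ ≤ B := by
  set B₀ : ℝ := (6 + 4 * C) * ((1 + 2 * Λ ^ 2) * (4 * R ^ 2))
    + 2 * R ^ 2 * (4 + 4 * Λ ^ 2 + (1 + 2 * Λ ^ 2) * (2 * |c| * R)) + C * R ^ 4 with hB₀
  refine ⟨max (B₀ / (δ * R ^ 4)) 1, ?_⟩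
  intro Ω P Q F x₀ hΩ hball hF hPQ hineq
  by_contra hlt
  push Not at hlt
  obtain ⟨hlt1, hlt2⟩ := max_lt_iff.1 hlt
  set D : Set (ℝ × ℝ) := {x | sqDist x₀ x ≤ R ^ 2} with hD
  have hDball : D ⊆ Metric.closedBall x₀ R := fun x hx => mem_closedBall_of_sqDist_le hR.le hx
  set η : ℝ × ℝ → ℝ := (fun _ => R ^ 2) + (fun _ => -1) * sqDist x₀ with hη
  have hηx : ∀ x, η x = R ^ 2 - sqDist x₀ x := fun x => by simp [hη]; ring
  have hηs : ContDiffOn ℝ (⊤ : ℕ∞) η Ω :=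
    contDiffOn_const.add (contDiffOn_const.mul (smooth_sqDist x₀ Ω))
  set G : ℝ × ℝ → ℝ := η * η * F with hG
  have hGs : ContDiffOn ℝ (⊤ : ℕ∞) G Ω := (hηs.mul hηs).mul hF
  have hx₀D : x₀ ∈ D := by simp [hD, sqDist]; positivity
  obtain ⟨y, hyD, hymax⟩ := (isCompact_sqDist_le x₀ hR.le).exists_isMaxOn ⟨x₀, hx₀D⟩
    (hGs.continuousOn.mono (hDball.trans hball))
  have hG0 : G x₀ = R ^ 4 * F x₀ := by
    simp only [hG, Pi.mul_apply, hηx, sqDist]; ring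
  have hGy : R ^ 4 * F x₀ ≤ G y := hG0 ▸ hymax hx₀D
  have hR4 : 0 < R ^ 4 := by positivity
  have hGypos : 0 < G y := by nlinarith
  have hGyeq : G y = η y ^ 2 * F y := by simp only [hG, Pi.mul_apply]; ring
  have hyD' : sqDist x₀ y ≤ R ^ 2 := hyD
  have hsq0 : 0 ≤ sqDist x₀ y := by unfold sqDist; positivity
  have hη0 : 0 ≤ η y := by rw [hηx]; linarith
  have hηpos : 0 < η y := by
    rcases hη0.lt_or_eq with h | h
    · exact h
    · rw [hGyeq, ← h] at hGypos; simp at hGypos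
  have hηle : η y ≤ R ^ 2 := by rw [hηx]; linarith
  have hFy : 1 ≤ F y := by
    by_contra hcon
    push Not at hcon
    have : η y ^ 2 ≤ R ^ 4 := by nlinarith
    have : η y ^ 2 * F y ≤ R ^ 4 := by nlinarith [sq_nonneg (η y)]
    nlinarith
  have hyΩ : y ∈ Ω := hball (hDball hyD)
  have hloc : IsLocalMax G y := by
    have hopen : IsOpen {x | sqDist x₀ x < R ^ 2} := by
      have : Continuous (sqDist x₀) := by unfold sqDist; fun_prop
      exact isOpen_lt this continuous_const
    have hymem : y ∈ {x | sqDist x₀ x < R ^ 2} := by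
      have := hηx y
      change sqDist x₀ y < R ^ 2
      linarith
    filter_upwards [hopen.mem_nhds hymem] with z hz
    exact hymax (le_of_lt hz)
  have dη := differentiableAt_of_smooth hΩ hηs hyΩ
  have dF := differentiableAt_of_smooth hΩ hF hyΩ
  have dS := differentiableAt_of_smooth hΩ (smooth_sqDist x₀ Ω) hyΩ
  have dηe : ∀ e, dirD e η y = - dirD e (sqDist x₀) y := fun e => by
    rw [hη, dirD_add (differentiableAt_const _) ((differentiableAt_const _).mul dS),
      dirD_mul (differentiableAt_const _) dS]
    simp [dirD_const]
  obtain ⟨hP, hQ⟩ := hPQ y (hDball hyD)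
  set p := P y
  set q := Q y
  have hlinη : lin (1, 0) (0, 1) p q 0 c η y = - lin (1, 0) (0, 1) p q 0 c (sqDist x₀) y := by
    rw [hη, lin_add _ _ _ _ _ _ hΩ contDiffOn_const
      (smooth_mul contDiffOn_const (smooth_sqDist x₀ Ω)) hyΩ,
      lin_mul _ _ _ _ _ _ hΩ contDiffOn_const (smooth_sqDist x₀ Ω) hyΩ]
    simp [lin_const, gam_const_left]
  have hcrit : ∀ e, η y * dirD e F y = - 2 * F y * dirD e η y := fun e => by
    have h := dirD_eq_zero_of_isLocalMax hloc e
    rw [hG, dirD_mul (dη.mul dη) dF, dirD_mul dη dη, Pi.mul_apply] at h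
    have : η y * (η y * dirD e F y + 2 * F y * dirD e η y) = 0 := by linarith
    rcases mul_eq_zero.1 this with h | h
    · exact absurd h hηpos.ne'
    · linarith
  have hmaxp := lin_nonpos_of_isLocalMax (1, 0) (0, 1) p q 0 c hΩ hGs hyΩ hloc
  rw [hG, lin_mul _ _ _ _ _ _ hΩ (smooth_mul hηs hηs) hF hyΩ, lin_mul _ _ _ _ _ _ hΩ hηs hηs hyΩ,
    gam_mul_left _ _ _ _ dη dη, Pi.mul_apply] at hmaxp
  have hg1 : η y * gam (1, 0) (0, 1) p q η F y = -2 * F y * gam (1, 0) (0, 1) p q η η y := by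
    have h1 := hcrit (1, 0)
    have h2 := hcrit (0, 1)
    simp only [gam]
    linear_combination (dirD (1, 0) η y + q * (q * dirD (1, 0) η y - p * dirD (0, 1) η y)) * h1
      + (dirD (0, 1) η y - p * (q * dirD (1, 0) η y - p * dirD (0, 1) η y)) * h2
  have hg2 : η y ^ 2 * gam (1, 0) (0, 1) p q F F y
      = 4 * F y ^ 2 * gam (1, 0) (0, 1) p q η η y := by
    have h1 : η y * gam (1, 0) (0, 1) p q F F y = -2 * F y * gam (1, 0) (0, 1) p q η F y := by
      have h1 := hcrit (1, 0)
      have h2 := hcrit (0, 1)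
      simp only [gam]
      linear_combination (dirD (1, 0) F y + q * (q * dirD (1, 0) F y - p * dirD (0, 1) F y)) * h1
        + (dirD (0, 1) F y - p * (q * dirD (1, 0) F y - p * dirD (0, 1) F y)) * h2
    linear_combination η y * h1 - 2 * F y * hg1
  have hin := hineq y (hDball hyD) hFy
  have hP2 : p ^ 2 ≤ Λ ^ 2 := sq_le_sq' (by linarith [neg_abs_le p]) (by linarith [le_abs_self p])
  have hQ2 : q ^ 2 ≤ Λ ^ 2 := sq_le_sq' (by linarith [neg_abs_le q]) (by linarith [le_abs_self q])
  have hlb := lin_sqDist_le (c := c) x₀ hR.le hP2 hQ2 hyD'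
  have hgb : gam (1, 0) (0, 1) p q η η y ≤ (1 + 2 * Λ ^ 2) * (4 * R ^ 2) := by
    refine (gam_self_le _ _ hP hQ).trans ?_
    gcongr
    simp only [dηe, dirD_sqDist]
    unfold sqDist at hyD'
    nlinarith
  set Γ := gam (1, 0) (0, 1) p q η η y
  set Lη := lin (1, 0) (0, 1) p q 0 c η y
  set LF := lin (1, 0) (0, 1) p q 0 c F y
  have hF2 : 0 < F y ^ 2 := by positivity
  have hstep : η y ^ 2 * F y * LF ≤ F y ^ 2 * (6 * Γ - 2 * η y * Lη) := by
    have h := mul_le_mul_of_nonneg_left hmaxp (show 0 ≤ F y by linarith)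
    have h1 : F y * (η y * gam (1, 0) (0, 1) p q η F y) = F y * (-2 * F y * Γ) := by rw [hg1]
    linarith
  have hfin : δ * (η y ^ 2 * F y) ≤ (6 + 4 * C) * Γ - 2 * η y * Lη + C * η y ^ 2 := by
    have h := mul_le_mul_of_nonneg_left hin (sq_nonneg (η y))
    have h1 : C * (η y ^ 2 * gam (1, 0) (0, 1) p q F F y) = C * (4 * F y ^ 2 * Γ) := by rw [hg2]
    have : F y ^ 2 * (δ * (η y ^ 2 * F y))
        ≤ F y ^ 2 * ((6 + 4 * C) * Γ - 2 * η y * Lη + C * η y ^ 2) := by linarith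
    exact le_of_mul_le_mul_left this hF2
  have hB : δ * (η y ^ 2 * F y) ≤ B₀ := by
    refine hfin.trans ?_
    set K := 4 + 4 * Λ ^ 2 + (1 + 2 * Λ ^ 2) * (2 * |c| * R)
    have hK : 0 ≤ K := by positivity
    have h1 : -Lη ≤ K := by rw [hlinη]; linarith
    have h2 : η y * (-Lη) ≤ R ^ 2 * K :=
      (mul_le_mul_of_nonneg_left h1 hη0).trans (mul_le_mul_of_nonneg_right hηle hK)
    have h3 : η y ^ 2 ≤ R ^ 4 := by nlinarith
    have h4 := mul_le_mul_of_nonneg_left hgb (show 0 ≤ 6 + 4 * C by linarith)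
    have h5 := mul_le_mul_of_nonneg_left h3 hC
    rw [hB₀]
    linarith
  rw [div_lt_iff₀ (by positivity)] at hlt1
  rw [hGyeq] at hGy
  have := mul_le_mul_of_nonneg_left hGy hδ.le
  linarith

/-- The zeroth order commutator of `lin` (with variable gradient components `P`, `Q`) and the
derivative in the direction `g`. -/
noncomputable def corr (e f : ℝ × ℝ) (P Q : ℝ × ℝ → ℝ) (b₁ b₂ : ℝ) (g : ℝ × ℝ)
    (w : ℝ × ℝ → ℝ) (x : ℝ × ℝ) : ℝ :=
  2 * Q x * dirD g Q x * dirD e (dirD e w) x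
    - 2 * (P x * dirD g Q x + Q x * dirD g P x) * dirD e (dirD f w) x
    + 2 * P x * dirD g P x * dirD f (dirD f w) x
    + 2 * (P x * dirD g P x + Q x * dirD g Q x) * (b₁ * dirD e w x + b₂ * dirD f w x)

section Commutator

variable {Ω : Set (ℝ × ℝ)} {P Q w : ℝ × ℝ → ℝ} {x : ℝ × ℝ} (e f : ℝ × ℝ) (b₁ b₂ : ℝ)

lemma lin_dirD (hΩ : IsOpen Ω) (hP : ContDiffOn ℝ (⊤ : ℕ∞) P Ω) (hQ : ContDiffOn ℝ (⊤ : ℕ∞) Q Ω)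
    (hw : ContDiffOn ℝ (⊤ : ℕ∞) w Ω) (hx : x ∈ Ω) (g : ℝ × ℝ) :
    lin e f (P x) (Q x) b₁ b₂ (dirD g w) x
      = dirD g (fun y => lin e f (P y) (Q y) b₁ b₂ w y) x - corr e f P Q b₁ b₂ g w x := by
  have hc : ∀ k : ℝ, ContDiffOn ℝ (⊤ : ℕ∞) (fun _ : ℝ × ℝ => k) Ω := fun k => contDiffOn_const
  have he := smooth_dirD hΩ hw e
  have hf := smooth_dirD hΩ hw f
  have hee := smooth_dirD hΩ he e
  have hef := smooth_dirD hΩ hf e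
  have hff := smooth_dirD hΩ hf f
  have hform : (fun y => lin e f (P y) (Q y) b₁ b₂ w y)
      = ((fun _ => 1) + Q * Q) * dirD e (dirD e w) + (fun _ => -2) * (P * Q) * dirD e (dirD f w)
        + ((fun _ => 1) + P * P) * dirD f (dirD f w)
        + ((fun _ => 1) + P * P + Q * Q)
          * ((fun _ => b₁) * dirD e w + (fun _ => b₂) * dirD f w) := by
    funext y; simp only [lin, Pi.add_apply, Pi.mul_apply]; ring
  have d := fun {F : ℝ × ℝ → ℝ} (hF : ContDiffOn ℝ (⊤ : ℕ∞) F Ω) =>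
    differentiableAt_of_smooth hΩ hF hx
  have c1 : ∀ v : ℝ × ℝ, EqOn (dirD v (dirD g w)) (dirD g (dirD v w)) Ω :=
    fun v y hy => dirD_comm hΩ hw hy v g
  have c2 : ∀ v v' : ℝ × ℝ, dirD v (dirD v' (dirD g w)) x = dirD g (dirD v (dirD v' w)) x := by
    intro v v'
    rw [dirD_congr hΩ (c1 v') v hx, dirD_comm hΩ (smooth_dirD hΩ hw v') hx]
  rw [hform]
  have sP2 := smooth_mul hP hP
  have sQ2 := smooth_mul hQ hQ
  have s1 := smooth_mul (smooth_add (hc 1) sQ2) hee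
  have s2 := smooth_mul (smooth_mul (hc (-2)) (smooth_mul hP hQ)) hef
  have s3 := smooth_mul (smooth_add (hc 1) sP2) hff
  have s4a := smooth_add (smooth_add (hc 1) sP2) sQ2
  have s4b := smooth_add (smooth_mul (hc b₁) he) (smooth_mul (hc b₂) hf)
  rw [dirD_add (d (smooth_add (smooth_add s1 s2) s3)) (d (smooth_mul s4a s4b)),
    dirD_add (d (smooth_add s1 s2)) (d s3), dirD_add (d s1) (d s2),
    dirD_mul (d (smooth_add (hc 1) sQ2)) (d hee),
    dirD_mul (d (smooth_mul (hc (-2)) (smooth_mul hP hQ))) (d hef),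
    dirD_mul (d (smooth_add (hc 1) sP2)) (d hff), dirD_mul (d s4a) (d s4b),
    dirD_add (d (smooth_add (hc 1) sP2)) (d sQ2), dirD_add (d (hc 1)) (d sQ2),
    dirD_add (d (hc 1)) (d sP2), dirD_mul (d (hc (-2))) (d (smooth_mul hP hQ)),
    dirD_mul (d hP) (d hQ), dirD_mul (d hP) (d hP), dirD_mul (d hQ) (d hQ),
    dirD_add (d (smooth_mul (hc b₁) he)) (d (smooth_mul (hc b₂) hf)),
    dirD_mul (d (hc b₁)) (d he), dirD_mul (d (hc b₂)) (d hf)]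
  simp only [dirD_const, Pi.add_apply, Pi.mul_apply, lin, corr, c2, c1 _ hx]
  ring

end Commutator

/-- The squared area element of the graph of `u`. -/
noncomputable def areaSq (e f : ℝ × ℝ) (u : ℝ × ℝ → ℝ) : ℝ × ℝ → ℝ :=
  (fun _ => 1) + dirD e u * dirD e u + dirD f u * dirD f u

/-- The Hessian determinant of `u`. -/
noncomputable def hessDet (e f : ℝ × ℝ) (u : ℝ × ℝ → ℝ) : ℝ × ℝ → ℝ :=
  dirD e (dirD e u) * dirD f (dirD f u)
    + (fun _ => -1) * (dirD e (dirD f u) * dirD e (dirD f u))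

/-- The derivative of `u` along the drift `b₁ e + b₂ f`. -/
noncomputable def drift (e f : ℝ × ℝ) (b₁ b₂ : ℝ) (u : ℝ × ℝ → ℝ) : ℝ × ℝ → ℝ :=
  (fun _ => b₁) * dirD e u + (fun _ => b₂) * dirD f u

/-- A multiple of the squared second fundamental form of a translating graph. -/
noncomputable def curv (e f : ℝ × ℝ) (b₁ b₂ : ℝ) (u : ℝ × ℝ → ℝ) : ℝ × ℝ → ℝ :=
  drift e f b₁ b₂ u * drift e f b₁ b₂ u * areaSq e f u + (fun _ => -2) * hessDet e f u

/-- `u` solves the translator equation on `Ω`, expressed in the frame `(e, f)`. -/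
def Solves (e f : ℝ × ℝ) (b₁ b₂ : ℝ) (Ω : Set (ℝ × ℝ)) (u : ℝ × ℝ → ℝ) : Prop :=
  ContDiffOn ℝ (⊤ : ℕ∞) u Ω ∧ ∀ x ∈ Ω, lin e f (dirD e u x) (dirD f u x) b₁ b₂ u x = 0

section Derivatives

variable {Ω : Set (ℝ × ℝ)} {u : ℝ × ℝ → ℝ} {x : ℝ × ℝ} (e f : ℝ × ℝ) (b₁ b₂ : ℝ)

lemma smooth_areaSq (hΩ : IsOpen Ω) (hu : ContDiffOn ℝ (⊤ : ℕ∞) u Ω) :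
    ContDiffOn ℝ (⊤ : ℕ∞) (areaSq e f u) Ω :=
  smooth_add (smooth_add contDiffOn_const (smooth_mul (smooth_dirD hΩ hu e) (smooth_dirD hΩ hu e)))
    (smooth_mul (smooth_dirD hΩ hu f) (smooth_dirD hΩ hu f))

lemma smooth_hessDet (hΩ : IsOpen Ω) (hu : ContDiffOn ℝ (⊤ : ℕ∞) u Ω) :
    ContDiffOn ℝ (⊤ : ℕ∞) (hessDet e f u) Ω :=
  have hs := smooth_dirD hΩ (smooth_dirD hΩ hu f) e
  smooth_add (smooth_mul (smooth_dirD hΩ (smooth_dirD hΩ hu e) e)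
    (smooth_dirD hΩ (smooth_dirD hΩ hu f) f)) (smooth_mul contDiffOn_const (smooth_mul hs hs))

lemma smooth_drift (hΩ : IsOpen Ω) (hu : ContDiffOn ℝ (⊤ : ℕ∞) u Ω) :
    ContDiffOn ℝ (⊤ : ℕ∞) (drift e f b₁ b₂ u) Ω :=
  smooth_add (smooth_mul contDiffOn_const (smooth_dirD hΩ hu e))
    (smooth_mul contDiffOn_const (smooth_dirD hΩ hu f))

lemma smooth_curv (hΩ : IsOpen Ω) (hu : ContDiffOn ℝ (⊤ : ℕ∞) u Ω) :
    ContDiffOn ℝ (⊤ : ℕ∞) (curv e f b₁ b₂ u) Ω :=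
  have hB := smooth_drift e f b₁ b₂ hΩ hu
  smooth_add (smooth_mul (smooth_mul hB hB) (smooth_areaSq e f hΩ hu))
    (smooth_mul contDiffOn_const (smooth_hessDet e f hΩ hu))

lemma areaSq_apply : areaSq e f u x = 1 + dirD e u x ^ 2 + dirD f u x ^ 2 := by
  simp only [areaSq, Pi.add_apply, Pi.mul_apply]; ring

lemma hessDet_apply : hessDet e f u x
    = dirD e (dirD e u) x * dirD f (dirD f u) x - dirD e (dirD f u) x ^ 2 := by
  simp only [hessDet, Pi.add_apply, Pi.mul_apply]; ring

lemma drift_apply : drift e f b₁ b₂ u x = b₁ * dirD e u x + b₂ * dirD f u x := by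
  simp only [drift, Pi.add_apply, Pi.mul_apply]

lemma curv_apply : curv e f b₁ b₂ u x
    = drift e f b₁ b₂ u x ^ 2 * areaSq e f u x - 2 * hessDet e f u x := by
  simp only [curv, Pi.add_apply, Pi.mul_apply]; ring

lemma dirD_areaSq (hΩ : IsOpen Ω) (hu : ContDiffOn ℝ (⊤ : ℕ∞) u Ω) (hx : x ∈ Ω) (g : ℝ × ℝ) :
    dirD g (areaSq e f u) x
      = 2 * (dirD e u x * dirD g (dirD e u) x + dirD f u x * dirD g (dirD f u) x) := by
  have de := differentiableAt_of_smooth hΩ (smooth_dirD hΩ hu e) hx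
  have df := differentiableAt_of_smooth hΩ (smooth_dirD hΩ hu f) hx
  rw [areaSq, dirD_add ((differentiableAt_const _).add (de.mul de)) (df.mul df),
    dirD_add (differentiableAt_const _) (de.mul de), dirD_mul de de, dirD_mul df df, dirD_const]
  ring

lemma dirD_dirD_areaSq (hΩ : IsOpen Ω) (hu : ContDiffOn ℝ (⊤ : ℕ∞) u Ω) (hx : x ∈ Ω)
    (g h : ℝ × ℝ) :
    dirD g (dirD h (areaSq e f u)) x
      = 2 * (dirD e u x * dirD g (dirD h (dirD e u)) x
        + dirD g (dirD e u) x * dirD h (dirD e u) x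
        + dirD f u x * dirD g (dirD h (dirD f u)) x
        + dirD g (dirD f u) x * dirD h (dirD f u) x) := by
  have se := smooth_dirD hΩ hu e
  have sf := smooth_dirD hΩ hu f
  rw [areaSq, dirD_dirD_add hΩ (smooth_add contDiffOn_const (smooth_mul se se))
    (smooth_mul sf sf) hx, dirD_dirD_add hΩ contDiffOn_const (smooth_mul se se) hx,
    dirD_dirD_mul hΩ se se hx, dirD_dirD_mul hΩ sf sf hx, dirD_dirD_const]
  ring

lemma dirD_hessDet (hΩ : IsOpen Ω) (hu : ContDiffOn ℝ (⊤ : ℕ∞) u Ω) (hx : x ∈ Ω) (g : ℝ × ℝ) :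
    dirD g (hessDet e f u) x
      = dirD e (dirD e u) x * dirD g (dirD f (dirD f u)) x
        + dirD f (dirD f u) x * dirD g (dirD e (dirD e u)) x
        - 2 * dirD e (dirD f u) x * dirD g (dirD e (dirD f u)) x := by
  have dr := differentiableAt_of_smooth hΩ (smooth_dirD hΩ (smooth_dirD hΩ hu e) e) hx
  have ds := differentiableAt_of_smooth hΩ (smooth_dirD hΩ (smooth_dirD hΩ hu f) e) hx
  have dt := differentiableAt_of_smooth hΩ (smooth_dirD hΩ (smooth_dirD hΩ hu f) f) hx
  rw [hessDet, dirD_add (dr.mul dt) ((differentiableAt_const _).mul (ds.mul ds)), dirD_mul dr dt,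
    dirD_mul (differentiableAt_const _) (ds.mul ds), dirD_mul ds ds, dirD_const]
  ring

lemma dirD_drift (hΩ : IsOpen Ω) (hu : ContDiffOn ℝ (⊤ : ℕ∞) u Ω) (hx : x ∈ Ω) (g : ℝ × ℝ) :
    dirD g (drift e f b₁ b₂ u) x = b₁ * dirD g (dirD e u) x + b₂ * dirD g (dirD f u) x := by
  have de := differentiableAt_of_smooth hΩ (smooth_dirD hΩ hu e) hx
  have df := differentiableAt_of_smooth hΩ (smooth_dirD hΩ hu f) hx
  rw [drift, dirD_add ((differentiableAt_const _).mul de) ((differentiableAt_const _).mul df),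
    dirD_mul (differentiableAt_const _) de, dirD_mul (differentiableAt_const _) df,
    dirD_const, dirD_const]
  ring

lemma dirD_curv (hΩ : IsOpen Ω) (hu : ContDiffOn ℝ (⊤ : ℕ∞) u Ω) (hx : x ∈ Ω) (g : ℝ × ℝ) :
    dirD g (curv e f b₁ b₂ u) x
      = 2 * areaSq e f u x * drift e f b₁ b₂ u x * dirD g (drift e f b₁ b₂ u) x
        + drift e f b₁ b₂ u x ^ 2 * dirD g (areaSq e f u) x - 2 * dirD g (hessDet e f u) x := by
  have dB := differentiableAt_of_smooth hΩ (smooth_drift e f b₁ b₂ hΩ hu) hx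
  have dS := differentiableAt_of_smooth hΩ (smooth_areaSq e f hΩ hu) hx
  have dD := differentiableAt_of_smooth hΩ (smooth_hessDet e f hΩ hu) hx
  rw [curv, dirD_add ((dB.mul dB).mul dS) ((differentiableAt_const _).mul dD),
    dirD_mul (dB.mul dB) dS, dirD_mul dB dB, dirD_mul (differentiableAt_const _) dD, dirD_const]
  simp only [Pi.mul_apply]
  ring

variable (P Q : ℝ)

lemma lin_areaSq (hΩ : IsOpen Ω) (hu : ContDiffOn ℝ (⊤ : ℕ∞) u Ω) (hx : x ∈ Ω) :
    lin e f P Q b₁ b₂ (areaSq e f u) x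
      = 2 * dirD e u x * lin e f P Q b₁ b₂ (dirD e u) x
        + 2 * dirD f u x * lin e f P Q b₁ b₂ (dirD f u) x
        + 2 * gam e f P Q (dirD e u) (dirD e u) x + 2 * gam e f P Q (dirD f u) (dirD f u) x := by
  have se := smooth_dirD hΩ hu e
  have sf := smooth_dirD hΩ hu f
  rw [areaSq, lin_add _ _ _ _ _ _ hΩ (smooth_add contDiffOn_const (smooth_mul se se))
    (smooth_mul sf sf) hx, lin_add _ _ _ _ _ _ hΩ contDiffOn_const (smooth_mul se se) hx,
    lin_const, lin_mul _ _ _ _ _ _ hΩ se se hx, lin_mul _ _ _ _ _ _ hΩ sf sf hx]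
  ring

lemma lin_hessDet (hΩ : IsOpen Ω) (hu : ContDiffOn ℝ (⊤ : ℕ∞) u Ω) (hx : x ∈ Ω) :
    lin e f P Q b₁ b₂ (hessDet e f u) x
      = dirD e (dirD e u) x * lin e f P Q b₁ b₂ (dirD f (dirD f u)) x
        + dirD f (dirD f u) x * lin e f P Q b₁ b₂ (dirD e (dirD e u)) x
        - 2 * dirD e (dirD f u) x * lin e f P Q b₁ b₂ (dirD e (dirD f u)) x
        + 2 * gam e f P Q (dirD e (dirD e u)) (dirD f (dirD f u)) x
        - 2 * gam e f P Q (dirD e (dirD f u)) (dirD e (dirD f u)) x := by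
  have sr := smooth_dirD hΩ (smooth_dirD hΩ hu e) e
  have ss := smooth_dirD hΩ (smooth_dirD hΩ hu f) e
  have st := smooth_dirD hΩ (smooth_dirD hΩ hu f) f
  rw [hessDet, lin_add _ _ _ _ _ _ hΩ (smooth_mul sr st)
    (smooth_mul contDiffOn_const (smooth_mul ss ss)) hx, lin_mul _ _ _ _ _ _ hΩ sr st hx,
    lin_mul _ _ _ _ _ _ hΩ contDiffOn_const (smooth_mul ss ss) hx, lin_const,
    lin_mul _ _ _ _ _ _ hΩ ss ss hx, gam_const_left]
  ring

lemma lin_drift (hΩ : IsOpen Ω) (hu : ContDiffOn ℝ (⊤ : ℕ∞) u Ω) (hx : x ∈ Ω) :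
    lin e f P Q b₁ b₂ (drift e f b₁ b₂ u) x
      = b₁ * lin e f P Q b₁ b₂ (dirD e u) x + b₂ * lin e f P Q b₁ b₂ (dirD f u) x := by
  have se := smooth_dirD hΩ hu e
  have sf := smooth_dirD hΩ hu f
  rw [drift, lin_add _ _ _ _ _ _ hΩ (smooth_mul contDiffOn_const se)
    (smooth_mul contDiffOn_const sf) hx, lin_mul _ _ _ _ _ _ hΩ contDiffOn_const se hx,
    lin_mul _ _ _ _ _ _ hΩ contDiffOn_const sf hx, lin_const, lin_const, gam_const_left,
    gam_const_left]
  ring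

lemma lin_curv (hΩ : IsOpen Ω) (hu : ContDiffOn ℝ (⊤ : ℕ∞) u Ω) (hx : x ∈ Ω) :
    lin e f P Q b₁ b₂ (curv e f b₁ b₂ u) x
      = drift e f b₁ b₂ u x ^ 2 * lin e f P Q b₁ b₂ (areaSq e f u) x
        + areaSq e f u x * (2 * drift e f b₁ b₂ u x * lin e f P Q b₁ b₂ (drift e f b₁ b₂ u) x
          + 2 * gam e f P Q (drift e f b₁ b₂ u) (drift e f b₁ b₂ u) x)
        + 4 * drift e f b₁ b₂ u x * gam e f P Q (drift e f b₁ b₂ u) (areaSq e f u) x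
        - 2 * lin e f P Q b₁ b₂ (hessDet e f u) x := by
  have sB := smooth_drift e f b₁ b₂ hΩ hu
  have sS := smooth_areaSq e f hΩ hu
  have sD := smooth_hessDet e f hΩ hu
  have dB := differentiableAt_of_smooth hΩ sB hx
  rw [curv, lin_add _ _ _ _ _ _ hΩ (smooth_mul (smooth_mul sB sB) sS)
    (smooth_mul contDiffOn_const sD) hx, lin_mul _ _ _ _ _ _ hΩ (smooth_mul sB sB) sS hx,
    lin_mul _ _ _ _ _ _ hΩ sB sB hx, gam_mul_left _ _ _ _ dB dB,
    lin_mul _ _ _ _ _ _ hΩ contDiffOn_const sD hx, lin_const, gam_const_left]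
  simp only [Pi.mul_apply]
  ring

end Derivatives

section Translator

variable {Ω : Set (ℝ × ℝ)} {u : ℝ × ℝ → ℝ} {x : ℝ × ℝ} {e f : ℝ × ℝ} {b₁ b₂ : ℝ}

lemma Solves.lin_dirD_left (hΩ : IsOpen Ω) (hu : Solves e f b₁ b₂ Ω u) (hx : x ∈ Ω) :
    lin e f (dirD e u x) (dirD f u x) b₁ b₂ (dirD e u) x
      = -(2 * dirD e u x * hessDet e f u x + drift e f b₁ b₂ u x * dirD e (areaSq e f u) x) := by
  obtain ⟨hs, hE⟩ := hu
  have h0 : EqOn (fun y => lin e f (dirD e u y) (dirD f u y) b₁ b₂ u y) (fun _ => 0) Ω := hE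
  rw [lin_dirD e f b₁ b₂ hΩ (smooth_dirD hΩ hs e) (smooth_dirD hΩ hs f) hs hx,
    dirD_congr hΩ h0 e hx, dirD_const, corr, dirD_areaSq e f hΩ hs hx, hessDet_apply,
    drift_apply]
  ring

lemma Solves.lin_dirD_right (hΩ : IsOpen Ω) (hu : Solves e f b₁ b₂ Ω u) (hx : x ∈ Ω) :
    lin e f (dirD e u x) (dirD f u x) b₁ b₂ (dirD f u) x
      = -(2 * dirD f u x * hessDet e f u x + drift e f b₁ b₂ u x * dirD f (areaSq e f u) x) := by
  obtain ⟨hs, hE⟩ := hu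
  have h0 : EqOn (fun y => lin e f (dirD e u y) (dirD f u y) b₁ b₂ u y) (fun _ => 0) Ω := hE
  rw [lin_dirD e f b₁ b₂ hΩ (smooth_dirD hΩ hs e) (smooth_dirD hΩ hs f) hs hx,
    dirD_congr hΩ h0 f hx, dirD_const, corr, dirD_areaSq e f hΩ hs hx, hessDet_apply,
    drift_apply, dirD_comm hΩ hs hx f e]
  ring

/-- The derivative of the right-hand side of the equation for the gradient components. -/
lemma dirD_gradient_source (hΩ : IsOpen Ω) (hs : ContDiffOn ℝ (⊤ : ℕ∞) u Ω) (hx : x ∈ Ω)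
    (g h : ℝ × ℝ) :
    dirD g (fun y => -(2 * dirD h u y * hessDet e f u y
        + drift e f b₁ b₂ u y * dirD h (areaSq e f u) y)) x
      = -(2 * dirD h u x * dirD g (hessDet e f u) x + 2 * hessDet e f u x * dirD g (dirD h u) x
        + drift e f b₁ b₂ u x * dirD g (dirD h (areaSq e f u)) x
        + dirD h (areaSq e f u) x * dirD g (drift e f b₁ b₂ u) x) := by
  have dp := differentiableAt_of_smooth hΩ (smooth_dirD hΩ hs h) hx
  have dD := differentiableAt_of_smooth hΩ (smooth_hessDet e f hΩ hs) hx
  have dB := differentiableAt_of_smooth hΩ (smooth_drift e f b₁ b₂ hΩ hs) hx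
  have dS := differentiableAt_of_smooth hΩ (smooth_dirD hΩ (smooth_areaSq e f hΩ hs) h) hx
  have hform : (fun y => -(2 * dirD h u y * hessDet e f u y
        + drift e f b₁ b₂ u y * dirD h (areaSq e f u) y))
      = (fun _ => -2) * (dirD h u * hessDet e f u)
        + (fun _ => -1) * (drift e f b₁ b₂ u * dirD h (areaSq e f u)) := by
    funext y; simp only [Pi.add_apply, Pi.mul_apply]; ring
  rw [hform, dirD_add ((differentiableAt_const _).mul (dp.mul dD))
    ((differentiableAt_const _).mul (dB.mul dS)), dirD_mul (differentiableAt_const _) (dp.mul dD),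
    dirD_mul dp dD, dirD_mul (differentiableAt_const _) (dB.mul dS), dirD_mul dB dS,
    dirD_const, dirD_const]
  ring

lemma Solves.lin_hess_left (hΩ : IsOpen Ω) (hu : Solves e f b₁ b₂ Ω u) (hx : x ∈ Ω) (g : ℝ × ℝ) :
    lin e f (dirD e u x) (dirD f u x) b₁ b₂ (dirD g (dirD e u)) x
      = -(2 * dirD e u x * dirD g (hessDet e f u) x + 2 * hessDet e f u x * dirD g (dirD e u) x
        + drift e f b₁ b₂ u x * dirD g (dirD e (areaSq e f u)) x
        + dirD e (areaSq e f u) x * dirD g (drift e f b₁ b₂ u) x)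
        - corr e f (dirD e u) (dirD f u) b₁ b₂ g (dirD e u) x := by
  have hs := hu.1
  have se := smooth_dirD hΩ hs e
  have sf := smooth_dirD hΩ hs f
  rw [lin_dirD e f b₁ b₂ hΩ se sf se hx,
    dirD_congr hΩ (fun y hy => hu.lin_dirD_left hΩ hy) g hx, dirD_gradient_source hΩ hs hx]

lemma Solves.lin_hess_right (hΩ : IsOpen Ω) (hu : Solves e f b₁ b₂ Ω u) (hx : x ∈ Ω) (g : ℝ × ℝ) :
    lin e f (dirD e u x) (dirD f u x) b₁ b₂ (dirD g (dirD f u)) x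
      = -(2 * dirD f u x * dirD g (hessDet e f u) x + 2 * hessDet e f u x * dirD g (dirD f u) x
        + drift e f b₁ b₂ u x * dirD g (dirD f (areaSq e f u)) x
        + dirD f (areaSq e f u) x * dirD g (drift e f b₁ b₂ u) x)
        - corr e f (dirD e u) (dirD f u) b₁ b₂ g (dirD f u) x := by
  have hs := hu.1
  have se := smooth_dirD hΩ hs e
  have sf := smooth_dirD hΩ hs f
  rw [lin_dirD e f b₁ b₂ hΩ se sf sf hx,
    dirD_congr hΩ (fun y hy => hu.lin_dirD_right hΩ hy) g hx, dirD_gradient_source hΩ hs hx]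

end Translator

section Adapted

lemma weighted_cauchy_schwarz {S r s t a b c : ℝ} (hS : 0 ≤ S) :
    (r * a + 2 * S * s * b + S ^ 2 * t * c) ^ 2
      ≤ (r ^ 2 + 2 * S * s ^ 2 + S ^ 2 * t ^ 2) * (a ^ 2 + 2 * S * b ^ 2 + S ^ 2 * c ^ 2) := by
  have h1 := mul_nonneg (mul_nonneg zero_le_two hS) (sq_nonneg (r * b - s * a))
  have h2 := mul_nonneg (sq_nonneg S) (sq_nonneg (r * c - t * a))
  have h3 := mul_nonneg (mul_nonneg zero_le_two (mul_nonneg hS (sq_nonneg S)))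
    (sq_nonneg (s * c - t * b))
  linarith

lemma curv_gradient_le_of_identities {A B S Y Z₁ Z₂ r s t T₁ T₂ T₃ T₄ : ℝ} (hS : 0 < S)
    (hY : S * Y = r ^ 2 + 2 * S * s ^ 2 + S ^ 2 * t ^ 2)
    (hA : A = Z₁ ^ 2 + S * Z₂ ^ 2)
    (hB : S * B = Y * (T₁ ^ 2 + 3 * S * T₂ ^ 2 + 3 * S ^ 2 * T₃ ^ 2 + S ^ 3 * T₄ ^ 2))
    (h1 : S * Z₁ = r * T₁ + 2 * S * s * T₂ + S ^ 2 * t * T₃)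
    (h2 : S * Z₂ = r * T₂ + 2 * S * s * T₃ + S ^ 2 * t * T₄) :
    A ≤ B := by
  have c1 := weighted_cauchy_schwarz (r := r) (s := s) (t := t) (a := T₁) (b := T₂) (c := T₃) hS.le
  have c2 := mul_le_mul_of_nonneg_left (weighted_cauchy_schwarz (r := r) (s := s) (t := t)
    (a := T₂) (b := T₃) (c := T₄) hS.le) hS.le
  rw [← h1, ← hY] at c1
  rw [← h2, ← hY] at c2
  have h : S ^ 2 * A ≤ S ^ 2 * B := by
    have : S * (S * B) = S * Y * (T₁ ^ 2 + 3 * S * T₂ ^ 2 + 3 * S ^ 2 * T₃ ^ 2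
        + S ^ 3 * T₄ ^ 2) := by rw [hB]; ring
    rw [hA]
    linarith
  exact le_of_mul_le_mul_left h (by positivity)

variable {Ω : Set (ℝ × ℝ)} {u : ℝ × ℝ → ℝ} {x : ℝ × ℝ} {e f : ℝ × ℝ} {b₁ b₂ : ℝ}

/-- The quantity controlled by the improved Kato inequality for the curvature. -/
noncomputable def kato (e f : ℝ × ℝ) (P Q b₁ b₂ : ℝ) (S Y : ℝ × ℝ → ℝ) (x : ℝ × ℝ) : ℝ :=
  2 * Y x * (S x ^ 2 * lin e f P Q b₁ b₂ Y x - 2 * S x * Y x * lin e f P Q b₁ b₂ S x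
    + 6 * Y x * gam e f P Q S S x - 4 * S x * gam e f P Q Y S x + 2 * S x * Y x ^ 2)
    - (S x ^ 2 * gam e f P Q Y Y x - 4 * S x * Y x * gam e f P Q Y S x
      + 4 * Y x ^ 2 * gam e f P Q S S x)

set_option maxHeartbeats 4000000 in
lemma Solves.identities_of_adapted (hΩ : IsOpen Ω) (hu : Solves e f b₁ b₂ Ω u) (hx : x ∈ Ω)
    (hq : dirD f u x = 0) :
    (areaSq e f u x * lin e f (dirD e u x) (dirD f u x) b₁ b₂ (areaSq e f u) x
      - 3 / 2 * gam e f (dirD e u x) (dirD f u x) (areaSq e f u) (areaSq e f u) x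
      = 2 * areaSq e f u x * curv e f b₁ b₂ u x) ∧
    (dirD e (dirD e u) x ^ 2 + 2 * dirD e (dirD f u) x ^ 2 + dirD f (dirD f u) x ^ 2
      ≤ areaSq e f u x * curv e f b₁ b₂ u x) ∧
    0 ≤ kato e f (dirD e u x) (dirD f u x) b₁ b₂ (areaSq e f u) (curv e f b₁ b₂ u) x := by
  have hs := hu.1
  have se := smooth_dirD hΩ hs e
  have sf := smooth_dirD hΩ hs f
  have c2 : EqOn (dirD f (dirD e u)) (dirD e (dirD f u)) Ω := fun y hy => dirD_comm hΩ hs hy f e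
  have k1 := c2 hx
  have k2 := dirD_congr hΩ c2 e hx
  have k3 := dirD_comm hΩ se hx f e
  rw [k2] at k3
  have k4 := dirD_comm hΩ sf hx f e
  have k5 := dirD_congr hΩ c2 f hx
  rw [k4] at k5
  have hE := hu.2 x hx
  have hα := hu.lin_dirD_left hΩ hx
  have hβ := hu.lin_dirD_right hΩ hx
  have hLS := lin_areaSq e f b₁ b₂ (dirD e u x) (dirD f u x) hΩ hs hx
  have hLD := lin_hessDet e f b₁ b₂ (dirD e u x) (dirD f u x) hΩ hs hx
  have hLB := lin_drift e f b₁ b₂ (dirD e u x) (dirD f u x) hΩ hs hx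
  have hLY := lin_curv e f b₁ b₂ (dirD e u x) (dirD f u x) hΩ hs hx
  have hLr := hu.lin_hess_left hΩ hx e
  have hLs := hu.lin_hess_right hΩ hx e
  have hLt := hu.lin_hess_right hΩ hx f
  rw [hα, hβ] at hLS hLB
  rw [hLr, hLs, hLt] at hLD
  rw [hLS, hLB, hLD] at hLY
  unfold kato
  rw [hLS, hLY]
  simp only [gam, dirD_curv e f b₁ b₂ hΩ hs hx]
  simp only [corr, dirD_hessDet e f hΩ hs hx, dirD_dirD_areaSq e f hΩ hs hx,
    dirD_areaSq e f hΩ hs hx, dirD_drift e f b₁ b₂ hΩ hs hx, curv_apply, areaSq_apply,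
    hessDet_apply, drift_apply, lin] at hE hα hβ ⊢
  simp only [k1, k2, k3, k4, k5, hq] at hE hα hβ ⊢
  generalize dirD e u x = p at *
  generalize dirD e (dirD e u) x = r at *
  generalize dirD e (dirD f u) x = s at *
  generalize dirD f (dirD f u) x = t at *
  generalize dirD e (dirD e (dirD e u)) x = α at *
  generalize dirD e (dirD e (dirD f u)) x = β at *
  generalize dirD e (dirD f (dirD f u)) x = γ at *
  generalize dirD f (dirD f (dirD f u)) x = δ at *
  clear hLY hLS hLD hLB hLr hLs hLt k1 k2 k3 k4 k5 hu hs se sf c2 hq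
  have hr : r = -(1 + p ^ 2) * (t + b₁ * p) := by linarith
  have hβ' : β = -((1 + p ^ 2) * δ + 2 * b₁ * p * (p * s)
    + (1 + p ^ 2) * (b₁ * s + b₂ * t)) := by linarith
  have hα' : α = -((1 + p ^ 2) * γ + 2 * p * (r * t - s ^ 2) + b₁ * p * (2 * (p * r))
    + (1 + p ^ 2) * (b₁ * r + b₂ * s)) := by linarith
  clear hE hα hβ
  have hS : 0 < 1 + p ^ 2 := by positivity
  have hYQ : (1 + p ^ 2) * ((b₁ * p) ^ 2 * (1 + p ^ 2) - 2 * (r * t - s ^ 2))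
      = r ^ 2 + 2 * (1 + p ^ 2) * s ^ 2 + (1 + p ^ 2) ^ 2 * t ^ 2 := by subst hr; ring
  refine ⟨?_, ?_, ?_⟩
  · subst hr; ring
  · have : (1 + p ^ 2 + 0 ^ 2) * ((b₁ * p + b₂ * 0) ^ 2 * (1 + p ^ 2 + 0 ^ 2)
      - 2 * (r * t - s ^ 2)) = r ^ 2 + 2 * (1 + p ^ 2) * s ^ 2 + (1 + p ^ 2) ^ 2 * t ^ 2 := by
      rw [← hYQ]; ring
    rw [this]
    nlinarith [mul_nonneg (sq_nonneg p) (sq_nonneg s), mul_nonneg (sq_nonneg p) (sq_nonneg t),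
      mul_nonneg (sq_nonneg (p * p)) (sq_nonneg t)]
  · rw [sub_nonneg]
    refine curv_gradient_le_of_identities (S := 1 + p ^ 2)
      (Y := (b₁ * p) ^ 2 * (1 + p ^ 2) - 2 * (r * t - s ^ 2)) (r := r) (s := s) (t := t)
      (T₁ := 2 * (1 + p ^ 2) * α - 6 * p * r ^ 2) (T₂ := 2 * (1 + p ^ 2) * β - 6 * p * r * s)
      (T₃ := 2 * (1 + p ^ 2) * γ - 2 * p * r * t - 4 * p * s ^ 2)
      (T₄ := 2 * (1 + p ^ 2) * δ - 6 * p * s * t)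
      (Z₁ := (1 + p ^ 2) * (2 * (1 + p ^ 2) * (b₁ * p) * (b₁ * r + b₂ * s)
        + (b₁ * p) ^ 2 * (2 * (p * r)) - 2 * (r * γ + t * α - 2 * s * β))
        - 2 * ((b₁ * p) ^ 2 * (1 + p ^ 2) - 2 * (r * t - s ^ 2)) * (2 * (p * r)))
      (Z₂ := (1 + p ^ 2) * (2 * (1 + p ^ 2) * (b₁ * p) * (b₁ * s + b₂ * t)
        + (b₁ * p) ^ 2 * (2 * (p * s)) - 2 * (r * δ + t * β - 2 * s * γ))
        - 2 * ((b₁ * p) ^ 2 * (1 + p ^ 2) - 2 * (r * t - s ^ 2)) * (2 * (p * s)))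
      hS hYQ ?_ ?_ ?_ ?_
    · ring
    · subst hα' hβ' hr; ring
    · subst hα' hβ' hr; ring
    · subst hα' hβ' hr; ring

end Adapted

section Rotation

variable {Ω : Set (ℝ × ℝ)} {u F G : ℝ × ℝ → ℝ} {x : ℝ × ℝ} {e f : ℝ × ℝ} {b₁ b₂ P Q a b : ℝ}

lemma lin_congr (hΩ : IsOpen Ω) (h : EqOn F G Ω) (hx : x ∈ Ω) :
    lin e f P Q b₁ b₂ F x = lin e f P Q b₁ b₂ G x := by
  simp only [lin, dirD_congr hΩ (dirD_congr hΩ h _) _ hx, dirD_congr hΩ h _ hx]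

lemma gam_congr {F' G' : ℝ × ℝ → ℝ} (hΩ : IsOpen Ω) (h : EqOn F G Ω) (h' : EqOn F' G' Ω)
    (hx : x ∈ Ω) : gam e f P Q F F' x = gam e f P Q G G' x := by
  simp only [gam, dirD_congr hΩ h _ hx, dirD_congr hΩ h' _ hx]

lemma lin_rotate (hab : a ^ 2 + b ^ 2 = 1) (hΩ : IsOpen Ω) (hF : ContDiffOn ℝ (⊤ : ℕ∞) F Ω)
    (hx : x ∈ Ω) :
    lin (a • e + b • f) ((-b) • e + a • f) (a * P + b * Q) (-b * P + a * Q)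
      (a * b₁ + b * b₂) (-b * b₁ + a * b₂) F x = lin e f P Q b₁ b₂ F x := by
  simp only [lin, dirD_dirD_lin e f hΩ hF hx, dirD_lin]
  generalize dirD e (dirD e F) x = r
  generalize dirD e (dirD f F) x = s
  generalize dirD f (dirD f F) x = t
  generalize dirD e F x = p
  generalize dirD f F x = q
  have hb : b ^ 2 = 1 - a ^ 2 := by linarith
  have h1 : (1 + (a * P + b * Q) ^ 2 + (-b * P + a * Q) ^ 2) = 1 + P ^ 2 + Q ^ 2 := by
    linear_combination (P ^ 2 + Q ^ 2) * hab
  have h2 : (a * b₁ + b * b₂) * (a * p + b * q) + (-b * b₁ + a * b₂) * (-b * p + a * q)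
      = b₁ * p + b₂ * q := by
    linear_combination (b₁ * p + b₂ * q) * hab
  rw [h1, h2]
  have h3 : (1 + (-b * P + a * Q) ^ 2) * (a * a * r + (a * b + b * a) * s + b * b * t)
      - 2 * (a * P + b * Q) * (-b * P + a * Q)
        * (a * (-b) * r + (a * a + b * (-b)) * s + b * a * t)
      + (1 + (a * P + b * Q) ^ 2) * (-b * (-b) * r + (-b * a + a * (-b)) * s + a * a * t)
      = (1 + Q ^ 2) * r - 2 * P * Q * s + (1 + P ^ 2) * t := by
    linear_combination ((a ^ 2 + b ^ 2 + 1) * (Q ^ 2 * r - 2 * P * Q * s + P ^ 2 * t)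
      + r + t) * hab
  rw [h3]

lemma gam_rotate (hab : a ^ 2 + b ^ 2 = 1) :
    gam (a • e + b • f) ((-b) • e + a • f) (a * P + b * Q) (-b * P + a * Q) F G x
      = gam e f P Q F G x := by
  simp only [gam, dirD_lin]
  have h1 : ∀ y z : ℝ, (-b * P + a * Q) * (a * y + b * z) - (a * P + b * Q) * (-b * y + a * z)
      = Q * y - P * z := fun y z => by linear_combination (Q * y - P * z) * hab
  rw [h1, h1]
  linear_combination (dirD e F x * dirD e G x + dirD f F x * dirD f G x) * hab

lemma areaSq_rotate (hab : a ^ 2 + b ^ 2 = 1) :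
    areaSq (a • e + b • f) ((-b) • e + a • f) u = areaSq e f u := by
  funext y
  simp only [areaSq_apply, dirD_lin]
  linear_combination (dirD e u y ^ 2 + dirD f u y ^ 2) * hab

lemma curv_rotate (hab : a ^ 2 + b ^ 2 = 1) (hΩ : IsOpen Ω) (hu : ContDiffOn ℝ (⊤ : ℕ∞) u Ω) :
    EqOn (curv (a • e + b • f) ((-b) • e + a • f) (a * b₁ + b * b₂) (-b * b₁ + a * b₂) u)
      (curv e f b₁ b₂ u) Ω := by
  intro y hy
  simp only [curv_apply, areaSq_rotate hab, hessDet_apply, drift_apply,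
    dirD_dirD_lin e f hΩ hu hy, dirD_lin]
  have h2 : (a * b₁ + b * b₂) * (a * dirD e u y + b * dirD f u y)
      + (-b * b₁ + a * b₂) * (-b * dirD e u y + a * dirD f u y)
      = b₁ * dirD e u y + b₂ * dirD f u y := by
    linear_combination (b₁ * dirD e u y + b₂ * dirD f u y) * hab
  rw [h2]
  linear_combination (-2 * (a ^ 2 + b ^ 2 + 1) *
    (dirD e (dirD e u) y * dirD f (dirD f u) y - dirD e (dirD f u) y ^ 2)) * hab

lemma hess_sq_rotate (hab : a ^ 2 + b ^ 2 = 1) (hΩ : IsOpen Ω)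
    (hu : ContDiffOn ℝ (⊤ : ℕ∞) u Ω) (hx : x ∈ Ω) :
    dirD (a • e + b • f) (dirD (a • e + b • f) u) x ^ 2
      + 2 * dirD (a • e + b • f) (dirD ((-b) • e + a • f) u) x ^ 2
      + dirD ((-b) • e + a • f) (dirD ((-b) • e + a • f) u) x ^ 2
      = dirD e (dirD e u) x ^ 2 + 2 * dirD e (dirD f u) x ^ 2 + dirD f (dirD f u) x ^ 2 := by
  simp only [dirD_dirD_lin e f hΩ hu hx]
  linear_combination (a ^ 2 + b ^ 2 + 1) * (dirD e (dirD e u) x ^ 2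
    + 2 * dirD e (dirD f u) x ^ 2 + dirD f (dirD f u) x ^ 2) * hab

lemma Solves.rotate (hab : a ^ 2 + b ^ 2 = 1) (hΩ : IsOpen Ω) (hu : Solves e f b₁ b₂ Ω u) :
    Solves (a • e + b • f) ((-b) • e + a • f) (a * b₁ + b * b₂) (-b * b₁ + a * b₂) Ω u := by
  refine ⟨hu.1, fun y hy => ?_⟩
  rw [dirD_lin, dirD_lin, lin_rotate hab hΩ hu.1 hy, hu.2 y hy]

lemma exists_rotation (p q : ℝ) : ∃ a b : ℝ, a ^ 2 + b ^ 2 = 1 ∧ -b * p + a * q = 0 := by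
  by_cases h : p ^ 2 + q ^ 2 = 0
  · have hp : p = 0 := by nlinarith [sq_nonneg p, sq_nonneg q]
    have hq : q = 0 := by nlinarith [sq_nonneg p, sq_nonneg q]
    exact ⟨1, 0, by norm_num, by rw [hp, hq]; ring⟩
  · have h0 : 0 < p ^ 2 + q ^ 2 := lt_of_le_of_ne (by positivity) (Ne.symm h)
    have hs : Real.sqrt (p ^ 2 + q ^ 2) ^ 2 = p ^ 2 + q ^ 2 := Real.sq_sqrt h0.le
    refine ⟨p / Real.sqrt (p ^ 2 + q ^ 2), q / Real.sqrt (p ^ 2 + q ^ 2), ?_, by ring⟩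
    rw [div_pow, div_pow, hs, ← add_div, div_self h]

lemma Solves.identities (hΩ : IsOpen Ω) (hu : Solves e f b₁ b₂ Ω u) (hx : x ∈ Ω) :
    (areaSq e f u x * lin e f (dirD e u x) (dirD f u x) b₁ b₂ (areaSq e f u) x
      - 3 / 2 * gam e f (dirD e u x) (dirD f u x) (areaSq e f u) (areaSq e f u) x
      = 2 * areaSq e f u x * curv e f b₁ b₂ u x) ∧
    (dirD e (dirD e u) x ^ 2 + 2 * dirD e (dirD f u) x ^ 2 + dirD f (dirD f u) x ^ 2
      ≤ areaSq e f u x * curv e f b₁ b₂ u x) ∧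
    0 ≤ kato e f (dirD e u x) (dirD f u x) b₁ b₂ (areaSq e f u) (curv e f b₁ b₂ u) x := by
  obtain ⟨a, b, hab, h0⟩ := exists_rotation (dirD e u x) (dirD f u x)
  have h := (hu.rotate hab hΩ).identities_of_adapted hΩ hx (by rw [dirD_lin, h0])
  have hY := curv_rotate (e := e) (f := f) (b₁ := b₁) (b₂ := b₂) hab hΩ hu.1
  rw [hess_sq_rotate hab hΩ hu.1 hx, areaSq_rotate hab, dirD_lin, dirD_lin] at h
  simp only [kato, hY hx, lin_congr hΩ hY hx, gam_congr hΩ hY hY hx,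
    gam_congr hΩ hY (fun y _ => rfl : EqOn (areaSq e f u) (areaSq e f u) Ω) hx, gam_rotate hab,
    lin_rotate hab hΩ (smooth_areaSq e f hΩ hu.1) hx,
    lin_rotate hab hΩ (smooth_curv e f b₁ b₂ hΩ hu.1) hx] at h
  exact h

end Rotation

section Gradient

variable {Ω : Set (ℝ × ℝ)} {u : ℝ × ℝ → ℝ} {x : ℝ × ℝ}

lemma areaSq_pos (e f : ℝ × ℝ) : 0 < areaSq e f u x := by rw [areaSq_apply]; positivity

lemma Solves.curv_nonneg {e f : ℝ × ℝ} {b₁ b₂ : ℝ} (hΩ : IsOpen Ω) (hu : Solves e f b₁ b₂ Ω u)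
    (hx : x ∈ Ω) : 0 ≤ curv e f b₁ b₂ u x := by
  have h := (hu.identities hΩ hx).2.1
  have h' : 0 ≤ areaSq e f u x * curv e f b₁ b₂ u x := le_trans (by positivity) h
  exact nonneg_of_mul_nonneg_right h' (areaSq_pos e f)

lemma lin_sqDist_le_area {P Q c R : ℝ} {x₀ : ℝ × ℝ} (hR : 0 ≤ R) (hx : sqDist x₀ x ≤ R ^ 2) :
    lin (1, 0) (0, 1) P Q 0 c (sqDist x₀) x ≤ (1 + P ^ 2 + Q ^ 2) * (4 + 2 * |c| * R) := by
  have h2 : |x.2 - x₀.2| ≤ R := by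
    unfold sqDist at hx
    exact abs_le_of_sq_le_sq (by nlinarith [sq_nonneg (x.1 - x₀.1)]) hR
  have h3 : c * (2 * (x.2 - x₀.2)) ≤ 2 * |c| * R := by
    calc c * (2 * (x.2 - x₀.2)) ≤ |c * (2 * (x.2 - x₀.2))| := le_abs_self _
      _ = 2 * |c| * |x.2 - x₀.2| := by rw [abs_mul, abs_mul, abs_two]; ring
      _ ≤ _ := by gcongr
  have h4 : (1 + P ^ 2 + Q ^ 2) * (c * (2 * (x.2 - x₀.2)))
      ≤ (1 + P ^ 2 + Q ^ 2) * (2 * |c| * R) := by gcongr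
  rw [lin, dirD_dirD_sqDist, dirD_dirD_sqDist, dirD_dirD_sqDist]
  simp only [dirD_sqDist]
  nlinarith

/-- The differential inequality at a maximum of `h² S`. -/
lemma Solves.lin_nonpos_of_max {c : ℝ} {h : ℝ × ℝ → ℝ} (hΩ : IsOpen Ω)
    (hu : Solves (1, 0) (0, 1) 0 c Ω u) (hx : x ∈ Ω) (hs : ContDiffOn ℝ (⊤ : ℕ∞) h Ω)
    (hpos : 0 < h x) (hmax : IsLocalMax (h * h * areaSq (1, 0) (0, 1) u) x) :
    lin (1, 0) (0, 1) (dirD (1, 0) u x) (dirD (0, 1) u x) 0 c h x ≤ 0 := by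
  have sS := smooth_areaSq (1, 0) (0, 1) hΩ hu.1
  obtain ⟨hid, -, -⟩ := hu.identities hΩ hx
  have hY := hu.curv_nonneg hΩ hx
  have hS := areaSq_pos (u := u) (x := x) (1, 0) (0, 1)
  have dh := differentiableAt_of_smooth hΩ hs hx
  have dS := differentiableAt_of_smooth hΩ sS hx
  set S := areaSq (1, 0) (0, 1) u
  set p := dirD (1, 0) u x
  set q := dirD (0, 1) u x
  have hcrit : ∀ e, h x * dirD e S x = -2 * S x * dirD e h x := fun e => by
    have h0 := dirD_eq_zero_of_isLocalMax hmax e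
    rw [dirD_mul (dh.mul dh) dS, dirD_mul dh dh, Pi.mul_apply] at h0
    have : h x * (h x * dirD e S x + 2 * S x * dirD e h x) = 0 := by linarith
    rcases mul_eq_zero.1 this with h1 | h1
    · exact absurd h1 hpos.ne'
    · linarith
  have hm := lin_nonpos_of_isLocalMax (1, 0) (0, 1) p q 0 c hΩ (smooth_mul (smooth_mul hs hs) sS)
    hx hmax
  rw [lin_mul _ _ _ _ _ _ hΩ (smooth_mul hs hs) sS hx, lin_mul _ _ _ _ _ _ hΩ hs hs hx,
    gam_mul_left _ _ _ _ dh dh, Pi.mul_apply] at hm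
  have hg1 : h x * gam (1, 0) (0, 1) p q h S x = -2 * S x * gam (1, 0) (0, 1) p q h h x := by
    have h1 := hcrit (1, 0)
    have h2 := hcrit (0, 1)
    simp only [gam]
    linear_combination (dirD (1, 0) h x + q * (q * dirD (1, 0) h x - p * dirD (0, 1) h x)) * h1
      + (dirD (0, 1) h x - p * (q * dirD (1, 0) h x - p * dirD (0, 1) h x)) * h2
  have hg2 : h x * gam (1, 0) (0, 1) p q S S x = -2 * S x * gam (1, 0) (0, 1) p q h S x := by
    have h1 := hcrit (1, 0)
    have h2 := hcrit (0, 1)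
    simp only [gam]
    linear_combination (dirD (1, 0) S x + q * (q * dirD (1, 0) S x - p * dirD (0, 1) S x)) * h1
      + (dirD (0, 1) S x - p * (q * dirD (1, 0) S x - p * dirD (0, 1) S x)) * h2
  by_contra hcon
  push Not at hcon
  have h1 : 0 < 2 * S x ^ 2 * h x * lin (1, 0) (0, 1) p q 0 c h x := by positivity
  have h2 : 0 ≤ h x ^ 2 * (2 * S x * curv (1, 0) (0, 1) 0 c u x) := by positivity
  have h3 := mul_nonpos_of_nonneg_of_nonpos hS.le hm
  rw [← hid] at h2
  have h4 : h x * (h x * gam (1, 0) (0, 1) p q S S x)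
      = -2 * S x * (-2 * S x * gam (1, 0) (0, 1) p q h h x) := by
    rw [hg2, ← hg1]; ring
  have h5 : S x * (h x * gam (1, 0) (0, 1) p q h S x)
      = S x * (-2 * S x * gam (1, 0) (0, 1) p q h h x) := by rw [hg1]
  linarith

set_option maxHeartbeats 1000000 in
/-- Interior gradient estimate for non-negative translators. -/
lemma exists_gradient_bound (c r m : ℝ) (hr : 0 < r) (hm : 0 < m) :
    ∃ B : ℝ, ∀ (Ω : Set (ℝ × ℝ)) (u : ℝ × ℝ → ℝ) (x₀ : ℝ × ℝ), IsOpen Ω →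
      Metric.closedBall x₀ r ⊆ Ω → Solves (1, 0) (0, 1) 0 c Ω u →
      (∀ x ∈ Metric.closedBall x₀ r, 0 ≤ u x) → u x₀ ≤ m →
      areaSq (1, 0) (0, 1) u x₀ ≤ B := by
  set A : ℝ := 4 + 2 * |c| * r with hA
  have hA0 : 0 < A := by positivity
  set K : ℝ := 64 * m ^ 2 * A / r ^ 2 with hK
  have hK0 : 0 < K := by positivity
  set S₀ : ℝ := 2 + 64 * m ^ 2 / r ^ 2 with hS₀
  refine ⟨Real.exp (2 * K) * S₀ / (K / 2) ^ 2, ?_⟩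
  intro Ω u x₀ hΩ hball hu hnonneg hum
  set S := areaSq (1, 0) (0, 1) u with hSdef
  have sS := smooth_areaSq (1, 0) (0, 1) hΩ hu.1
  set ζ : ℝ × ℝ → ℝ := (fun _ => 1) + (fun _ => -(1 / r ^ 2)) * sqDist x₀
    + (fun _ => -(1 / (2 * m))) * u with hζ
  have hζx : ∀ x, ζ x = 1 - sqDist x₀ x / r ^ 2 - u x / (2 * m) := fun x => by
    simp only [hζ, Pi.add_apply, Pi.mul_apply]; ring
  have s1 := smooth_mul (contDiffOn_const (c := -(1 / r ^ 2))) (smooth_sqDist x₀ Ω)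
  have s2 := smooth_mul (contDiffOn_const (c := -(1 / (2 * m)))) hu.1
  have sζ : ContDiffOn ℝ (⊤ : ℕ∞) ζ Ω := smooth_add (smooth_add contDiffOn_const s1) s2
  set φ : ℝ → ℝ := fun t => Real.exp (K * t) - 1 with hφ
  have dexp : ∀ t, HasDerivAt (fun t => Real.exp (K * t)) (K * Real.exp (K * t)) t := fun t => by
    have := ((hasDerivAt_id t).const_mul K).exp
    simpa [mul_comm] using this
  have dφ : ∀ t, HasDerivAt φ (K * Real.exp (K * t)) t := fun t => (dexp t).sub_const 1
  have dφ' : ∀ t, HasDerivAt (fun t => K * Real.exp (K * t)) (K * (K * Real.exp (K * t))) t :=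
    fun t => (dexp t).const_mul K
  set h : ℝ × ℝ → ℝ := fun y => φ (ζ y) with hh
  have sh : ContDiffOn ℝ (⊤ : ℕ∞) h Ω :=
    ((contDiffOn_const.mul sζ).exp).sub contDiffOn_const
  set D : Set (ℝ × ℝ) := {x | sqDist x₀ x ≤ r ^ 2} with hD
  have hDball : D ⊆ Metric.closedBall x₀ r := fun x hx => mem_closedBall_of_sqDist_le hr.le hx
  have hx₀D : x₀ ∈ D := by simp [hD, sqDist]; positivity
  have hcont : ContinuousOn (fun x => max (h x) 0 ^ 2 * S x) D :=
    (((sh.continuousOn.mono (hDball.trans hball)).sup continuousOn_const).pow 2).mul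
      (sS.continuousOn.mono (hDball.trans hball))
  obtain ⟨y, hyD, hymax⟩ := (isCompact_sqDist_le x₀ hr.le).exists_isMaxOn ⟨x₀, hx₀D⟩ hcont
  have hyΩ : y ∈ Ω := hball (hDball hyD)
  have hyD' : sqDist x₀ y ≤ r ^ 2 := hyD
  have hsq0 : 0 ≤ sqDist x₀ y := by unfold sqDist; positivity
  have hh0 : K / 2 ≤ h x₀ := by
    have h1 : 1 / 2 ≤ ζ x₀ := by
      rw [hζx]
      have : sqDist x₀ x₀ = 0 := by simp [sqDist]
      have h2 : u x₀ / (2 * m) ≤ 1 / 2 := by rw [div_le_iff₀ (by positivity)]; linarith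
      rw [this, zero_div]; linarith
    have h2 : K * ζ x₀ + 1 ≤ Real.exp (K * ζ x₀) := Real.add_one_le_exp _
    simp only [hh, hφ]
    nlinarith
  have hh0' : 0 < h x₀ := lt_of_lt_of_le (by positivity) hh0
  have hSpos : ∀ x, 0 < S x := fun x => areaSq_pos (1, 0) (0, 1)
  have hmaxy : max (h x₀) 0 ^ 2 * S x₀ ≤ max (h y) 0 ^ 2 * S y := hymax hx₀D
  rw [max_eq_left hh0'.le] at hmaxy
  have hhy : 0 < h y := by
    by_contra hcon
    push Not at hcon
    rw [max_eq_right hcon] at hmaxy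
    have := hSpos x₀
    have : 0 < h x₀ ^ 2 * S x₀ := by positivity
    linarith
  have hζy : 0 < ζ y := by
    by_contra hcon
    push Not at hcon
    have : Real.exp (K * ζ y) ≤ 1 := Real.exp_le_one_iff.2 (by nlinarith)
    simp only [hh, hφ] at hhy
    linarith
  have huy := hnonneg y (hDball hyD)
  have huy' : 0 ≤ u y / (2 * m) := by positivity
  rw [hζx] at hζy
  have hlt : sqDist x₀ y < r ^ 2 := by
    have : sqDist x₀ y / r ^ 2 < 1 := by linarith
    rwa [div_lt_one (by positivity)] at this
  have hloc : IsLocalMax (h * h * S) y := by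
    have hopen : IsOpen {x | sqDist x₀ x < r ^ 2} := by
      have : Continuous (sqDist x₀) := by unfold sqDist; fun_prop
      exact isOpen_lt this continuous_const
    have hpos : ∀ᶠ z in 𝓝 y, 0 < h z :=
      (sh.continuousOn.continuousAt (hΩ.mem_nhds hyΩ)).eventually (lt_mem_nhds hhy)
    filter_upwards [hopen.mem_nhds hlt, hpos] with z hz hz'
    have h1 : max (h z) 0 ^ 2 * S z ≤ max (h y) 0 ^ 2 * S y := hymax (le_of_lt hz)
    rw [max_eq_left hhy.le, max_eq_left hz'.le] at h1
    simp only [Pi.mul_apply]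
    linarith
  have hLh := hu.lin_nonpos_of_max hΩ hyΩ sh hhy hloc
  have hLh' := lin_comp (1, 0) (0, 1) (dirD (1, 0) u y) (dirD (0, 1) u y) 0 c
    (φ' := fun t => K * Real.exp (K * t)) (φ'' := fun t => K * (K * Real.exp (K * t)))
    hΩ sζ (fun z _ => dφ (ζ z)) (dφ' (ζ y)) hyΩ
  rw [hLh'] at hLh
  have hlinζ : lin (1, 0) (0, 1) (dirD (1, 0) u y) (dirD (0, 1) u y) 0 c ζ y
      = -(1 / r ^ 2) * lin (1, 0) (0, 1) (dirD (1, 0) u y) (dirD (0, 1) u y) 0 c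
        (sqDist x₀) y := by
    rw [hζ, lin_add _ _ _ _ _ _ hΩ (smooth_add contDiffOn_const s1) s2 hyΩ,
      lin_add _ _ _ _ _ _ hΩ contDiffOn_const s1 hyΩ,
      lin_mul _ _ _ _ _ _ hΩ contDiffOn_const (smooth_sqDist x₀ Ω) hyΩ,
      lin_mul _ _ _ _ _ _ hΩ contDiffOn_const hu.1 hyΩ, hu.2 y hyΩ]
    simp [lin_const, gam_const_left]
  have dS := differentiableAt_of_smooth hΩ (smooth_sqDist x₀ Ω) hyΩ
  have du := differentiableAt_of_smooth hΩ hu.1 hyΩ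
  have dζ : ∀ e, dirD e ζ y
      = -(1 / r ^ 2) * dirD e (sqDist x₀) y - dirD e u y / (2 * m) := fun e => by
    rw [hζ, dirD_add ((differentiableAt_const _).add ((differentiableAt_const _).mul dS))
      ((differentiableAt_const _).mul du), dirD_add (differentiableAt_const _)
      ((differentiableAt_const _).mul dS), dirD_mul (differentiableAt_const _) dS,
      dirD_mul (differentiableAt_const _) du]
    simp [dirD_const]; ring
  have hg := gam_self_ge (F := ζ) (x := y) (1, 0) (0, 1) (dirD (1, 0) u y) (dirD (0, 1) u y)
  have hle := lin_sqDist_le_area (P := dirD (1, 0) u y) (Q := dirD (0, 1) u y) (c := c) hr.le hyD'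
  have hSy : S y = 1 + dirD (1, 0) u y ^ 2 + dirD (0, 1) u y ^ 2 := areaSq_apply _ _
  rw [← hSy] at hle
  have hsum : (S y - 1) / (8 * m ^ 2) - 4 / r ^ 2 ≤ dirD (1, 0) ζ y ^ 2 + dirD (0, 1) ζ y ^ 2 := by
    rw [dζ, dζ, hSy]
    have hyoung : ∀ a b : ℝ, b ^ 2 / 2 - a ^ 2 ≤ (-a - b) ^ 2 := fun a b => by
      nlinarith [sq_nonneg (2 * a + b)]
    have y1 := hyoung (1 / r ^ 2 * dirD (1, 0) (sqDist x₀) y) (dirD (1, 0) u y / (2 * m))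
    have y2 := hyoung (1 / r ^ 2 * dirD (0, 1) (sqDist x₀) y) (dirD (0, 1) u y / (2 * m))
    have y3 : (1 / r ^ 2 * dirD (1, 0) (sqDist x₀) y) ^ 2
        + (1 / r ^ 2 * dirD (0, 1) (sqDist x₀) y) ^ 2 ≤ 4 / r ^ 2 := by
      have : (1 / r ^ 2 * dirD (1, 0) (sqDist x₀) y) ^ 2
        + (1 / r ^ 2 * dirD (0, 1) (sqDist x₀) y) ^ 2 = 4 / r ^ 2 * (sqDist x₀ y / r ^ 2) := by
        simp only [dirD_sqDist, sqDist]; field_simp; ring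
      rw [this]
      have h1 : sqDist x₀ y / r ^ 2 ≤ 1 := by rw [div_le_one (by positivity)]; exact hyD'
      exact mul_le_of_le_one_right (by positivity) h1
    have y4 : (dirD (1, 0) u y / (2 * m)) ^ 2 / 2 + (dirD (0, 1) u y / (2 * m)) ^ 2 / 2
        = (1 + dirD (1, 0) u y ^ 2 + dirD (0, 1) u y ^ 2 - 1) / (8 * m ^ 2) := by
      field_simp; ring
    simp only [neg_mul] at *
    linarith
  have hexp : 0 < K * Real.exp (K * ζ y) := by positivity
  have hmain : lin (1, 0) (0, 1) (dirD (1, 0) u y) (dirD (0, 1) u y) 0 c ζ y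
      + K * gam (1, 0) (0, 1) (dirD (1, 0) u y) (dirD (0, 1) u y) ζ ζ y ≤ 0 := by
    by_contra hcon
    push Not at hcon
    have := mul_pos hexp hcon
    linarith
  have hSle : S y ≤ S₀ := by
    by_contra hcon
    push Not at hcon
    have h1 : 64 * m ^ 2 / r ^ 2 ≤ S y - 2 := by linarith
    have h2 : 0 < m ^ 2 / r ^ 2 := by positivity
    have h3 : 4 / r ^ 2 ≤ (S y - 1) / (16 * m ^ 2) := by
      rw [le_div_iff₀ (by positivity)]
      have : 4 / r ^ 2 * (16 * m ^ 2) = 64 * m ^ 2 / r ^ 2 := by ring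
      linarith
    have h4 : S y / (32 * m ^ 2) ≤ (S y - 1) / (16 * m ^ 2) := by
      rw [div_le_div_iff₀ (by positivity) (by positivity)]
      have h5 : 2 ≤ S y := by
        have : 64 * m ^ 2 / r ^ 2 = 64 * (m ^ 2 / r ^ 2) := by ring
        linarith
      nlinarith [sq_nonneg m]
    have h5 : (S y - 1) / (8 * m ^ 2) = 2 * ((S y - 1) / (16 * m ^ 2)) := by
      field_simp; ring
    have h6 : S y / (32 * m ^ 2) ≤ gam (1, 0) (0, 1) (dirD (1, 0) u y) (dirD (0, 1) u y) ζ ζ y := by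
      linarith
    have h7 := mul_le_mul_of_nonneg_left h6 hK0.le
    have h8 : K * (S y / (32 * m ^ 2)) = 2 * (S y * A / r ^ 2) := by
      rw [hK]; field_simp; ring
    have h9 : 1 / r ^ 2 * lin (1, 0) (0, 1) (dirD (1, 0) u y) (dirD (0, 1) u y) 0 c
        (sqDist x₀) y ≤ S y * A / r ^ 2 := by
      have := mul_le_mul_of_nonneg_left hle (show 0 ≤ 1 / r ^ 2 by positivity)
      calc _ ≤ _ := this
        _ = _ := by ring
    have h10 : 0 < S y * A / r ^ 2 := by have := hSpos y; positivity
    rw [hlinζ] at hmain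
    linarith
  have hhy2 : h y ^ 2 ≤ Real.exp (2 * K) := by
    have h1 : ζ y ≤ 1 := by
      rw [hζx]
      have : 0 ≤ sqDist x₀ y / r ^ 2 := by positivity
      linarith
    have h2 : h y ≤ Real.exp K := by
      have : Real.exp (K * ζ y) ≤ Real.exp K := Real.exp_le_exp.2 (by nlinarith)
      simp only [hh, hφ]; linarith
    have h3 : Real.exp (2 * K) = Real.exp K ^ 2 := by rw [← Real.exp_nat_mul]; norm_num
    rw [h3]
    exact pow_le_pow_left₀ hhy.le h2 2
  rw [max_eq_left hhy.le] at hmaxy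
  rw [le_div_iff₀ (by positivity)]
  calc S x₀ * (K / 2) ^ 2 ≤ S x₀ * h x₀ ^ 2 := by
        have := hSpos x₀
        gcongr
    _ ≤ h y ^ 2 * S y := by linarith
    _ ≤ Real.exp (2 * K) * S₀ := by
        have := hSpos y
        gcongr

end Gradient

section Curvature

variable {Ω : Set (ℝ × ℝ)} {u : ℝ × ℝ → ℝ} {x : ℝ × ℝ}

lemma gam_quadratic_nonneg (e f : ℝ × ℝ) (P Q a b : ℝ) (F G : ℝ × ℝ → ℝ) :
    0 ≤ a ^ 2 * gam e f P Q F F x + 2 * a * b * gam e f P Q G F x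
      + b ^ 2 * gam e f P Q G G x := by
  have : a ^ 2 * gam e f P Q F F x + 2 * a * b * gam e f P Q G F x + b ^ 2 * gam e f P Q G G x
      = (a * dirD e F x + b * dirD e G x) ^ 2 + (a * dirD f F x + b * dirD f G x) ^ 2
        + (Q * (a * dirD e F x + b * dirD e G x) - P * (a * dirD f F x + b * dirD f G x)) ^ 2 := by
    simp only [gam]; ring
  rw [this]; positivity

lemma cubic_inequality_of_kato {S k f LS Lf G H J : ℝ} (hS : 1 ≤ S) (hk : 0 < k)
    (hm : 0 < 1 - k * S) (hf : 1 ≤ f) (hJ : 0 ≤ J)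
    (hLS : S * LS - 3 / 2 * G = 2 * S * (f * (S - k * S ^ 2)))
    (hquad : ∀ a b : ℝ, 0 ≤ a ^ 2 * G + 2 * a * b * H + b ^ 2 * J)
    (hkato : 0 ≤ 2 * (f * (S - k * S ^ 2)) * (S ^ 2 * (f * ((1 - 2 * k * S) * LS - 2 * k * G)
        + (S - k * S ^ 2) * Lf + 2 * ((1 - 2 * k * S) * H))
        - 2 * S * (f * (S - k * S ^ 2)) * LS + 6 * (f * (S - k * S ^ 2)) * G
        - 4 * S * (f * ((1 - 2 * k * S) * G) + (S - k * S ^ 2) * H)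
        + 2 * S * (f * (S - k * S ^ 2)) ^ 2)
      - (S ^ 2 * (f ^ 2 * ((1 - 2 * k * S) ^ 2 * G)
          + 2 * f * (S - k * S ^ 2) * ((1 - 2 * k * S) * H) + (S - k * S ^ 2) ^ 2 * J)
        - 4 * S * (f * (S - k * S ^ 2)) * (f * ((1 - 2 * k * S) * G) + (S - k * S ^ 2) * H)
        + 4 * (f * (S - k * S ^ 2)) ^ 2 * G)) :
    2 * k * f ^ 3 ≤ f * Lf + 1 / (2 * k) * J := by
  have hS0 : 0 < S := by linarith
  set m := 1 - k * S with hmdef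
  have h1 : 0 ≤ S ^ 2 * (2 * S ^ 2 * m ^ 2 * (f * Lf) - 4 * k * S ^ 3 * m ^ 2 * f ^ 3
      - 2 * f * S * m * H - f ^ 2 * (k * S) * G - S ^ 2 * m ^ 2 * J) := by
    refine hkato.trans (le_of_eq ?_)
    rw [hmdef]
    linear_combination (2 * f ^ 2 * S ^ 2 * (k * S - 1)) * hLS
  have h2 := nonneg_of_mul_nonneg_right h1 (by positivity)
  have h3 := hquad (k * S * f) (S * m)
  have h4 : 0 ≤ S ^ 2 * m ^ 2 * (2 * (k * S) * (f * Lf) - 4 * k * S * (k * S) * f ^ 3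
      + (1 - k * S) * J) := by
    have h5 := mul_nonneg (show 0 ≤ k * S by positivity) h2
    linarith
  have h5 := nonneg_of_mul_nonneg_right h4 (by positivity)
  have h6 : 0 ≤ k * S * (2 * (f * Lf) - 4 * k * S * f ^ 3 + J / (k * S)) := by
    have : k * S * (2 * (f * Lf) - 4 * k * S * f ^ 3 + J / (k * S))
        = 2 * (k * S) * (f * Lf) - 4 * k * S * (k * S) * f ^ 3 + J := by
      field_simp
    rw [this]
    have : 0 ≤ k * S * J := by positivity
    linarith
  have h7 := nonneg_of_mul_nonneg_right h6 (by positivity)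
  have h8 : J / (k * S) ≤ J / k := by
    apply div_le_div_of_nonneg_left hJ hk
    nlinarith
  have h9 : k * f ^ 3 * 1 ≤ k * f ^ 3 * S := by gcongr
  have h10 : 1 / (2 * k) * J = J / k / 2 := by field_simp
  rw [h10]
  linarith

set_option maxHeartbeats 1000000 in
/-- Interior curvature estimate for translators of bounded gradient. -/
lemma exists_hessian_bound (c Λ R : ℝ) (hR : 0 < R) :
    ∃ B : ℝ, ∀ (Ω : Set (ℝ × ℝ)) (u : ℝ × ℝ → ℝ) (x₀ : ℝ × ℝ), IsOpen Ω →
      Metric.closedBall x₀ R ⊆ Ω → Solves (1, 0) (0, 1) 0 c Ω u →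
      (∀ x ∈ Metric.closedBall x₀ R, |dirD (1, 0) u x| ≤ Λ ∧ |dirD (0, 1) u x| ≤ Λ) →
      dirD (1, 0) (dirD (1, 0) u) x₀ ^ 2 + 2 * dirD (1, 0) (dirD (0, 1) u) x₀ ^ 2
        + dirD (0, 1) (dirD (0, 1) u) x₀ ^ 2 ≤ B := by
  set Λ' : ℝ := 1 + 2 * Λ ^ 2 with hΛ'
  have hΛ1 : 1 ≤ Λ' := by nlinarith [sq_nonneg Λ]
  set k : ℝ := 1 / (2 * Λ') with hk
  have hk0 : 0 < k := by positivity
  obtain ⟨B, hB⟩ := exists_bound_of_cubic c (2 * k) (1 / (2 * k)) Λ R (by positivity)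
    (by positivity) hR
  refine ⟨Λ' * (Λ' * max B 0), ?_⟩
  intro Ω u x₀ hΩ hball hu hgrad
  set S := areaSq (1, 0) (0, 1) u with hSdef
  set Y := curv (1, 0) (0, 1) 0 c u with hYdef
  have hS1 : ∀ x, 1 ≤ S x := fun x => by
    rw [hSdef, areaSq_apply]
    nlinarith [sq_nonneg (dirD (1, 0) u x), sq_nonneg (dirD (0, 1) u x)]
  have hSΛ : ∀ x ∈ Metric.closedBall x₀ R, S x ≤ Λ' := fun x hx => by
    obtain ⟨h1, h2⟩ := hgrad x hx
    rw [hSdef, areaSq_apply, hΛ']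
    have := sq_le_sq' (neg_le_of_abs_le h1) (le_of_abs_le h1)
    have := sq_le_sq' (neg_le_of_abs_le h2) (le_of_abs_le h2)
    linarith
  have sSΩ := smooth_areaSq (1, 0) (0, 1) hΩ hu.1
  set Ω' : Set (ℝ × ℝ) := Ω ∩ S ⁻¹' (Iio (2 * Λ')) with hΩ'
  have hΩ'o : IsOpen Ω' := sSΩ.continuousOn.isOpen_inter_preimage hΩ isOpen_Iio
  have hsub : Ω' ⊆ Ω := inter_subset_left
  have hball' : Metric.closedBall x₀ R ⊆ Ω' := fun x hx =>
    ⟨hball hx, by have := hSΛ x hx; simp only [mem_preimage, mem_Iio]; linarith⟩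
  have hkS : ∀ x ∈ Ω', 0 < 1 - k * S x := fun x hx => by
    have h : S x < 2 * Λ' := hx.2
    have : k * S x < k * (2 * Λ') := by gcongr
    have h1 : k * (2 * Λ') = 1 := by rw [hk]; field_simp
    linarith
  have hu' : Solves (1, 0) (0, 1) 0 c Ω' u := ⟨hu.1.mono hsub, fun x hx => hu.2 x (hsub hx)⟩
  have sS : ContDiffOn ℝ (⊤ : ℕ∞) S Ω' := sSΩ.mono hsub
  have sY : ContDiffOn ℝ (⊤ : ℕ∞) Y Ω' := (smooth_curv (1, 0) (0, 1) 0 c hΩ hu.1).mono hsub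
  set v : ℝ × ℝ → ℝ := S + (fun _ => -k) * (S * S) with hv
  have sv2 := smooth_mul (contDiffOn_const (c := -k)) (smooth_mul sS sS)
  have sv : ContDiffOn ℝ (⊤ : ℕ∞) v Ω' := smooth_add sS sv2
  have hvx : ∀ x, v x = S x - k * S x ^ 2 := fun x => by
    simp only [hv, Pi.add_apply, Pi.mul_apply]; ring
  have hvpos : ∀ x ∈ Ω', 0 < v x := fun x hx => by
    have h1 := mul_pos (lt_of_lt_of_le one_pos (hS1 x)) (hkS x hx)
    rw [hvx]; linarith
  set F : ℝ × ℝ → ℝ := Y * fun x => (v x)⁻¹ with hF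
  have sF : ContDiffOn ℝ (⊤ : ℕ∞) F Ω' := sY.mul (sv.inv fun x hx => (hvpos x hx).ne')
  have hYF : EqOn Y (F * v) Ω' := fun x hx => by
    simp only [hF, Pi.mul_apply]
    rw [mul_assoc, inv_mul_cancel₀ (hvpos x hx).ne', mul_one]
  have hmain := hB Ω' (dirD (1, 0) u) (dirD (0, 1) u) F x₀ hΩ'o hball' sF hgrad ?_
  · have hx₀ : x₀ ∈ Metric.closedBall x₀ R := Metric.mem_closedBall_self hR.le
    have hid := (hu.identities hΩ (hball hx₀)).2.1
    refine hid.trans ?_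
    change S x₀ * Y x₀ ≤ _
    have h1 : Y x₀ ≤ Λ' * max B 0 := by
      rw [hYF (hball' hx₀), Pi.mul_apply]
      have hv1 : v x₀ ≤ Λ' := by
        rw [hvx]
        have := hSΛ x₀ hx₀
        have := mul_nonneg hk0.le (sq_nonneg (S x₀))
        linarith
      have hv0 := hvpos x₀ (hball' hx₀)
      calc F x₀ * v x₀ ≤ max B 0 * v x₀ := by
            apply mul_le_mul_of_nonneg_right (hmain.trans (le_max_left _ _)) hv0.le
        _ ≤ max B 0 * Λ' := mul_le_mul_of_nonneg_left hv1 (le_max_right _ _)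
        _ = _ := mul_comm _ _
    have h2 : 0 ≤ Y x₀ := hu.curv_nonneg hΩ (hball hx₀)
    have := hS1 x₀
    exact mul_le_mul (hSΛ x₀ hx₀) h1 h2 (by linarith)
  · intro x hx hFx
    have hx' := hball' hx
    obtain ⟨hid, -, hkato⟩ := hu'.identities hΩ'o hx'
    change S x * lin (1, 0) (0, 1) _ _ 0 c S x - 3 / 2 * gam (1, 0) (0, 1) _ _ S S x
      = 2 * S x * Y x at hid
    change 0 ≤ kato (1, 0) (0, 1) _ _ 0 c S Y x at hkato
    set p := dirD (1, 0) u x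
    set q := dirD (0, 1) u x
    have dS := differentiableAt_of_smooth hΩ'o sS hx'
    have dF := differentiableAt_of_smooth hΩ'o sF hx'
    have dv := differentiableAt_of_smooth hΩ'o sv hx'
    have gv : ∀ G, gam (1, 0) (0, 1) p q v G x
        = (1 - 2 * k * S x) * gam (1, 0) (0, 1) p q S G x := fun G => by
      rw [hv, gam_add_left _ _ _ _ dS ((differentiableAt_const _).mul (dS.mul dS)),
        gam_mul_left _ _ _ _ (differentiableAt_const _) (dS.mul dS), gam_mul_left _ _ _ _ dS dS,
        gam_const_left]
      ring
    have lv : lin (1, 0) (0, 1) p q 0 c v x = (1 - 2 * k * S x) * lin (1, 0) (0, 1) p q 0 c S x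
        - 2 * k * gam (1, 0) (0, 1) p q S S x := by
      rw [hv, lin_add _ _ _ _ _ _ hΩ'o sS sv2 hx',
        lin_mul _ _ _ _ _ _ hΩ'o contDiffOn_const (smooth_mul sS sS) hx',
        lin_mul _ _ _ _ _ _ hΩ'o sS sS hx', lin_const, gam_const_left]
      ring
    have hYx : Y x = F x * (S x - k * S x ^ 2) := by rw [hYF hx', Pi.mul_apply, hvx]
    have hLY : lin (1, 0) (0, 1) p q 0 c Y x
        = F x * ((1 - 2 * k * S x) * lin (1, 0) (0, 1) p q 0 c S x
          - 2 * k * gam (1, 0) (0, 1) p q S S x)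
          + (S x - k * S x ^ 2) * lin (1, 0) (0, 1) p q 0 c F x
          + 2 * ((1 - 2 * k * S x) * gam (1, 0) (0, 1) p q F S x) := by
      rw [lin_congr hΩ'o hYF hx', lin_mul _ _ _ _ _ _ hΩ'o sF sv hx', lv,
        gam_symm (F := F) (G := v), gv, hvx, gam_symm (F := S) (G := F)]
    have hYS : gam (1, 0) (0, 1) p q Y S x
        = F x * ((1 - 2 * k * S x) * gam (1, 0) (0, 1) p q S S x)
          + (S x - k * S x ^ 2) * gam (1, 0) (0, 1) p q F S x := by
      rw [gam_congr hΩ'o hYF (fun y _ => rfl : EqOn S S Ω') hx', gam_mul_left _ _ _ _ dF dv, gv,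
        hvx]
    have hYY : gam (1, 0) (0, 1) p q Y Y x
        = F x ^ 2 * ((1 - 2 * k * S x) ^ 2 * gam (1, 0) (0, 1) p q S S x)
          + 2 * F x * (S x - k * S x ^ 2) * ((1 - 2 * k * S x) * gam (1, 0) (0, 1) p q F S x)
          + (S x - k * S x ^ 2) ^ 2 * gam (1, 0) (0, 1) p q F F x := by
      rw [gam_congr hΩ'o hYF hYF hx', gam_mul_left _ _ _ _ dF dv, gv,
        gam_symm (F := S), gam_symm (F := F) (G := F * v), gam_mul_left _ _ _ _ dF dv,
        gam_mul_left _ _ _ _ dF dv, gv, gv, hvx, gam_symm (F := S) (G := F)]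
      ring
    rw [kato, hLY, hYS, hYY, hYx] at hkato
    rw [hYx] at hid
    have := cubic_inequality_of_kato (hS1 x) hk0 (hkS x hx') hFx
      (gam_self_nonneg (F := F) (x := x) (1, 0) (0, 1) p q) hid
      (fun a b => gam_quadratic_nonneg (1, 0) (0, 1) p q a b S F) hkato
    have h0 : 0 ≤ 1 / (2 * k) * F x ^ 2 := by positivity
    linarith

end Curvature

/-- The two coordinate directions. -/
def dir (b : Bool) : ℝ × ℝ := if b then (1, 0) else (0, 1)

section Bernstein

variable {ι : Type*} {Ω : Set (ℝ × ℝ)} {x : ℝ × ℝ} {w : ι → ℝ × ℝ → ℝ}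

/-- All the first partial derivatives of a family of functions. -/
noncomputable def gradFamily (w : ι → ℝ × ℝ → ℝ) : ι × Bool → ℝ × ℝ → ℝ :=
  fun p => dirD (dir p.2) (w p.1)

/-- The sum of the squares of a finite family of functions. -/
def normSqFamily [Fintype ι] (w : ι → ℝ × ℝ → ℝ) : ℝ × ℝ → ℝ := ∑ i, w i * w i

lemma smooth_gradFamily (hΩ : IsOpen Ω) (hw : ∀ i, ContDiffOn ℝ (⊤ : ℕ∞) (w i) Ω) (p : ι × Bool) :
    ContDiffOn ℝ (⊤ : ℕ∞) (gradFamily w p) Ω :=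
  smooth_dirD hΩ (hw p.1) _

lemma smooth_sum (s : Finset ι) (hw : ∀ i, ContDiffOn ℝ (⊤ : ℕ∞) (w i) Ω) :
    ContDiffOn ℝ (⊤ : ℕ∞) (∑ i ∈ s, w i) Ω := by
  classical
  induction s using Finset.induction_on with
  | empty => exact contDiffOn_const (c := (0 : ℝ))
  | insert i s hi ih => rw [Finset.sum_insert hi]; exact smooth_add (hw i) ih

lemma lin_sum (e f : ℝ × ℝ) (P Q b₁ b₂ : ℝ) (s : Finset ι) (hΩ : IsOpen Ω)
    (hw : ∀ i, ContDiffOn ℝ (⊤ : ℕ∞) (w i) Ω) (hx : x ∈ Ω) :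
    lin e f P Q b₁ b₂ (∑ i ∈ s, w i) x = ∑ i ∈ s, lin e f P Q b₁ b₂ (w i) x := by
  classical
  induction s using Finset.induction_on with
  | empty =>
    rw [Finset.sum_empty, Finset.sum_empty]
    exact lin_const e f P Q b₁ b₂ 0
  | insert i s hi ih =>
    rw [Finset.sum_insert hi, Finset.sum_insert hi,
      lin_add _ _ _ _ _ _ hΩ (hw i) (smooth_sum s hw) hx, ih]

lemma dirD_sum (e : ℝ × ℝ) (s : Finset ι) (hw : ∀ i, DifferentiableAt ℝ (w i) x) :
    dirD e (∑ i ∈ s, w i) x = ∑ i ∈ s, dirD e (w i) x := by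
  simp only [dirD]
  rw [fderiv_sum fun i _ => hw i]
  simp

variable [Fintype ι]

lemma normSqFamily_apply : normSqFamily w x = ∑ i, w i x ^ 2 := by
  simp [normSqFamily, sq]

lemma normSqFamily_nonneg : 0 ≤ normSqFamily w x := by
  rw [normSqFamily_apply]; positivity

lemma smooth_normSqFamily (hw : ∀ i, ContDiffOn ℝ (⊤ : ℕ∞) (w i) Ω) :
    ContDiffOn ℝ (⊤ : ℕ∞) (normSqFamily w) Ω :=
  smooth_sum (w := fun i => w i * w i) _ fun i => smooth_mul (hw i) (hw i)

lemma abs_le_sqrt_normSqFamily (i : ι) : |w i x| ≤ √(normSqFamily w x) := by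
  apply Real.abs_le_sqrt
  rw [normSqFamily_apply]
  exact Finset.single_le_sum (f := fun i => w i x ^ 2) (fun i _ => sq_nonneg _) (Finset.mem_univ i)

lemma normSqFamily_gradFamily_apply :
    normSqFamily (gradFamily w) x = ∑ i, (dirD (1, 0) (w i) x ^ 2 + dirD (0, 1) (w i) x ^ 2) := by
  rw [normSqFamily_apply, Fintype.sum_prod_type]
  simp [gradFamily, dir]

lemma lin_normSqFamily_ge (P Q b₁ b₂ A : ℝ) (hΩ : IsOpen Ω)
    (hw : ∀ i, ContDiffOn ℝ (⊤ : ℕ∞) (w i) Ω) (hx : x ∈ Ω)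
    (hA : ∀ i, |lin (1, 0) (0, 1) P Q b₁ b₂ (w i) x| ≤ A) :
    2 * normSqFamily (gradFamily w) x - 2 * Fintype.card ι * A * √(normSqFamily w x)
      ≤ lin (1, 0) (0, 1) P Q b₁ b₂ (normSqFamily w) x := by
  have hlin : lin (1, 0) (0, 1) P Q b₁ b₂ (normSqFamily w) x
      = ∑ i, lin (1, 0) (0, 1) P Q b₁ b₂ (w i * w i) x :=
    lin_sum (w := fun i => w i * w i) _ _ _ _ _ _ _ hΩ (fun i => smooth_mul (hw i) (hw i)) hx
  rw [hlin, normSqFamily_gradFamily_apply, Finset.mul_sum]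
  have h : 2 * Fintype.card ι * A * √(normSqFamily w x)
      = ∑ _i : ι, 2 * (A * √(normSqFamily w x)) := by
    rw [Finset.sum_const, Finset.card_univ, nsmul_eq_mul]; ring
  rw [h, ← Finset.sum_sub_distrib]
  apply Finset.sum_le_sum
  intro i _
  rw [lin_mul _ _ _ _ _ _ hΩ (hw i) (hw i) hx]
  have h1 := gam_self_ge (F := w i) (x := x) (1, 0) (0, 1) P Q
  have h2 : |w i x * lin (1, 0) (0, 1) P Q b₁ b₂ (w i) x| ≤ A * √(normSqFamily w x) := by
    rw [abs_mul, mul_comm]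
    exact mul_le_mul (hA i) (abs_le_sqrt_normSqFamily i) (abs_nonneg _)
      ((abs_nonneg _).trans (hA i))
  have h3 := (abs_le.1 h2).1
  linarith

lemma gam_normSqFamily_le {P Q Λ : ℝ} (hP : |P| ≤ Λ) (hQ : |Q| ≤ Λ)
    (hw : ∀ i, DifferentiableAt ℝ (w i) x) :
    gam (1, 0) (0, 1) P Q (normSqFamily w) (normSqFamily w) x
      ≤ (1 + 2 * Λ ^ 2) * (4 * normSqFamily w x * normSqFamily (gradFamily w) x) := by
  refine (gam_self_le (1, 0) (0, 1) hP hQ).trans ?_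
  apply mul_le_mul_of_nonneg_left _ (by positivity)
  have h : ∀ e, dirD e (normSqFamily w) x ^ 2
      ≤ 4 * normSqFamily w x * ∑ i, dirD e (w i) x ^ 2 := by
    intro e
    have h1 : dirD e (normSqFamily w) x = 2 * ∑ i, w i x * dirD e (w i) x := by
      rw [normSqFamily, dirD_sum (w := fun i => w i * w i) _ _ fun i => (hw i).mul (hw i),
        Finset.mul_sum]
      exact Finset.sum_congr rfl fun i _ => by rw [dirD_mul (hw i) (hw i)]; ring
    rw [h1, mul_pow, normSqFamily_apply]
    have := Finset.sum_mul_sq_le_sq_mul_sq Finset.univ (fun i => w i x) (fun i => dirD e (w i) x)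
    linarith
  rw [normSqFamily_gradFamily_apply, Finset.sum_add_distrib, mul_add]
  exact add_le_add (h _) (h _)

/-- The scalar inequality behind the Bernstein argument for `F = X * U`. -/
lemma bernstein_scalar {s t U T D E C₂ LX LV G H W GF : ℝ} (hs : 0 ≤ s) (hD : 0 ≤ D) (hE : 0 ≤ E)
    (hGF : 0 ≤ GF) (hU1 : 1 ≤ U) (hUC : 6 * C₂ ≤ U) (hUT : U ≤ T) (hF : 1 ≤ s ^ 2 * U)
    (hLX : 2 * t ^ 2 - 2 * E * (1 + s ^ 2 + t) * s ≤ LX)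
    (hLV : 2 * s ^ 2 - 2 * D * (1 + s) ≤ LV)
    (hH : H = U * G + s ^ 2 * W) (hW : W ≤ C₂ * s ^ 2)
    (hquad : 0 ≤ GF + 2 * s ^ 2 * H + (s ^ 2) ^ 2 * W) :
    1 / (4 * T ^ 3) * (s ^ 2 * U) ^ 3
      ≤ (s ^ 2 * U) * (U * LX + s ^ 2 * LV + 2 * G)
        + (1 + T * (2 * D + D ^ 2) + (4 * T ^ 4 * E ^ 2 + T ^ 2 * E ^ 2 + T ^ 2 * E * (1 + T))) * GF
        + (1 + T * (2 * D + D ^ 2) + (4 * T ^ 4 * E ^ 2 + T ^ 2 * E ^ 2 + T ^ 2 * E * (1 + T)))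
          * (s ^ 2 * U) ^ 2 := by
  set c₁ := T * (2 * D + D ^ 2) with hc₁
  set c₂ := 4 * T ^ 4 * E ^ 2 + T ^ 2 * E ^ 2 + T ^ 2 * E * (1 + T) with hc₂
  have hT : 1 ≤ T := hU1.trans hUT
  have hc₁0 : 0 ≤ c₁ := by positivity
  have hc₂0 : 0 ≤ c₂ := by positivity
  have hU0 : 0 ≤ U := by linarith
  have hUU : U ^ 2 ≤ T ^ 2 := pow_le_pow_left₀ hU0 hUT 2
  -- the term with `LX`
  have a1 : -(2 * E * s + 2 * E * s ^ 3 + E ^ 2 * s ^ 2) ≤ LX := by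
    nlinarith [sq_nonneg (2 * t - E * s), sq_nonneg (E * s)]
  have a2 : -(U ^ 2 * (s ^ 2 * (2 * E * s + 2 * E * s ^ 3 + E ^ 2 * s ^ 2)))
      ≤ s ^ 2 * U * (U * LX) := by
    have := mul_le_mul_of_nonneg_left a1 (by positivity : 0 ≤ s ^ 2 * U ^ 2)
    linarith
  have a3 : U ^ 2 * (s ^ 2 * (2 * E * s + 2 * E * s ^ 3 + E ^ 2 * s ^ 2))
      ≤ T ^ 2 * (s ^ 2 * (2 * E * s + 2 * E * s ^ 3 + E ^ 2 * s ^ 2)) :=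
    mul_le_mul_of_nonneg_right hUU (by positivity)
  have hsT : 1 ≤ s ^ 2 * T := hF.trans (mul_le_mul_of_nonneg_left hUT (by positivity))
  have a4 : s ^ 2 ≤ T * s ^ 4 := by
    have := mul_le_mul_of_nonneg_left hsT (sq_nonneg s)
    linarith
  have a5 : 2 * s ^ 3 ≤ (1 + T) * s ^ 4 := by
    have := mul_nonneg (sq_nonneg s) (sq_nonneg (s - 1))
    linarith
  have a6 : T ^ 2 * E * (2 * s ^ 3) ≤ T ^ 2 * E * ((1 + T) * s ^ 4) :=
    mul_le_mul_of_nonneg_left a5 (by positivity)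
  have a7 : 2 * T ^ 2 * E * s ^ 5 ≤ s ^ 6 / 4 + 4 * T ^ 4 * E ^ 2 * s ^ 4 := by
    have := sq_nonneg (s ^ 3 / 2 - 2 * T ^ 2 * E * s ^ 2)
    linarith
  have a8 : -(s ^ 6 / 4) - c₂ * s ^ 4 ≤ s ^ 2 * U * (U * LX) := by
    rw [hc₂]; linarith
  -- the term with `LV`
  have b1 : s ^ 2 - (2 * D + D ^ 2) ≤ LV := by linarith [sq_nonneg (s - D)]
  have b2 : U * s ^ 6 - c₁ * s ^ 4 ≤ s ^ 2 * U * (s ^ 2 * LV) := by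
    have h1 := mul_le_mul_of_nonneg_left b1 (by positivity : 0 ≤ U * s ^ 4)
    have h2 := mul_le_mul_of_nonneg_right hUT (by positivity : 0 ≤ s ^ 4 * (2 * D + D ^ 2))
    rw [hc₁]; linarith
  -- the cross term
  have d1 : -GF - 3 * s ^ 4 * W ≤ s ^ 2 * U * (2 * G) := by
    rw [hH] at hquad; linarith
  have d2 : s ^ 4 * W ≤ C₂ * s ^ 6 := by
    have := mul_le_mul_of_nonneg_left hW (by positivity : 0 ≤ s ^ 4)
    linarith
  have d3 : 6 * C₂ * s ^ 6 ≤ U * s ^ 6 := mul_le_mul_of_nonneg_right hUC (by positivity)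
  have e1 : 1 * s ^ 6 ≤ U * s ^ 6 := mul_le_mul_of_nonneg_right hU1 (by positivity)
  have main : s ^ 6 / 4 - (c₁ + c₂) * s ^ 4 - GF
      ≤ s ^ 2 * U * (U * LX + s ^ 2 * LV + 2 * G) := by linarith
  have e2 : (c₁ + c₂) * s ^ 4 ≤ (1 + c₁ + c₂) * (s ^ 2 * U) ^ 2 := by
    have h1 : s ^ 4 ≤ (s ^ 2 * U) ^ 2 := by
      have := pow_le_pow_left₀ zero_le_one hU1 2
      have := mul_le_mul_of_nonneg_left this (by positivity : 0 ≤ s ^ 4)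
      linarith
    exact mul_le_mul (by linarith) h1 (by positivity) (by positivity)
  have e3 : 1 / (4 * T ^ 3) * (s ^ 2 * U) ^ 3 ≤ s ^ 6 / 4 := by
    have h1 : U ^ 3 ≤ T ^ 3 := pow_le_pow_left₀ hU0 hUT 3
    rw [div_mul_eq_mul_div, div_le_div_iff₀ (by positivity) (by norm_num)]
    have := mul_le_mul_of_nonneg_left h1 (by positivity : 0 ≤ s ^ 6)
    linarith
  have e4 : 0 ≤ (c₁ + c₂) * GF := by positivity
  linarith
set_option maxHeartbeats 800000 in
/-- Interior bound for the gradient of a finite family of functions satisfying a system of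
quadratic growth. -/
lemma exists_bernstein_bound (ι : Type*) [Fintype ι] (c C Λ M R : ℝ) (hC : 0 ≤ C) (hM : 0 ≤ M)
    (hR : 0 < R) :
    ∃ B : ℝ, ∀ (Ω : Set (ℝ × ℝ)) (P Q : ℝ × ℝ → ℝ) (w : ι → ℝ × ℝ → ℝ) (x₀ : ℝ × ℝ),
      IsOpen Ω → Metric.closedBall x₀ R ⊆ Ω → (∀ i, ContDiffOn ℝ (⊤ : ℕ∞) (w i) Ω) →
      (∀ x ∈ Metric.closedBall x₀ R, |P x| ≤ Λ ∧ |Q x| ≤ Λ) →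
      (∀ x ∈ Metric.closedBall x₀ R, normSqFamily w x ≤ M) →
      (∀ x ∈ Metric.closedBall x₀ R, ∀ i, |lin (1, 0) (0, 1) (P x) (Q x) 0 c (w i) x|
        ≤ C * (1 + √(normSqFamily (gradFamily w) x))) →
      (∀ x ∈ Metric.closedBall x₀ R, ∀ p,
        |lin (1, 0) (0, 1) (P x) (Q x) 0 c (gradFamily w p) x|
          ≤ C * (1 + normSqFamily (gradFamily w) x
            + √(normSqFamily (gradFamily (gradFamily w)) x))) →
      normSqFamily (gradFamily w) x₀ ≤ B := by
  set C₂ : ℝ := (1 + 2 * Λ ^ 2) * (4 * M) with hC₂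
  have hC₂0 : 0 ≤ C₂ := by positivity
  set K : ℝ := 6 * C₂ + 1 with hK
  set T : ℝ := K + M with hT
  have hT1 : 1 ≤ T := by linarith
  set D : ℝ := Fintype.card ι * C * √M with hD
  set E : ℝ := Fintype.card (ι × Bool) * C with hE
  have hD0 : 0 ≤ D := by positivity
  have hE0 : 0 ≤ E := by positivity
  obtain ⟨B, hB⟩ := exists_bound_of_cubic c (1 / (4 * T ^ 3))
    (1 + T * (2 * D + D ^ 2) + (4 * T ^ 4 * E ^ 2 + T ^ 2 * E ^ 2 + T ^ 2 * E * (1 + T))) Λ R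
    (by positivity) (by positivity) hR
  refine ⟨B, ?_⟩
  intro Ω P Q w x₀ hΩ hball hw hPQ hV hLw hLg
  set X := normSqFamily (gradFamily w) with hX
  set V := normSqFamily w with hVdef
  set U : ℝ × ℝ → ℝ := (fun _ => K) + V with hU
  have sg := smooth_gradFamily hΩ hw
  have sX : ContDiffOn ℝ (⊤ : ℕ∞) X Ω := smooth_normSqFamily sg
  have sV : ContDiffOn ℝ (⊤ : ℕ∞) V Ω := smooth_normSqFamily hw
  have sU : ContDiffOn ℝ (⊤ : ℕ∞) U Ω := smooth_add contDiffOn_const sV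
  have hX0 : ∀ x, 0 ≤ X x := fun x => normSqFamily_nonneg
  have hV0 : ∀ x, 0 ≤ V x := fun x => normSqFamily_nonneg
  have hUx : ∀ x, U x = K + V x := fun x => rfl
  have hU1 : ∀ x, 1 ≤ U x := fun x => by rw [hUx]; linarith [hV0 x]
  have hmain := hB Ω P Q (X * U) x₀ hΩ hball (smooth_mul sX sU) hPQ ?_
  · have h := mul_le_mul_of_nonneg_left (hU1 x₀) (hX0 x₀)
    rw [mul_one] at h
    exact h.trans hmain
  · intro x hx hF
    have hxΩ := hball hx
    obtain ⟨hP, hQ⟩ := hPQ x hx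
    have dX := differentiableAt_of_smooth hΩ sX hxΩ
    have dV := differentiableAt_of_smooth hΩ sV hxΩ
    have dU := differentiableAt_of_smooth hΩ sU hxΩ
    have gU : ∀ G, gam (1, 0) (0, 1) (P x) (Q x) U G x
        = gam (1, 0) (0, 1) (P x) (Q x) V G x := fun G => by
      rw [hU, gam_add_left _ _ _ _ (differentiableAt_const _) dV, gam_const_left, zero_add]
    have lU : lin (1, 0) (0, 1) (P x) (Q x) 0 c U x = lin (1, 0) (0, 1) (P x) (Q x) 0 c V x := by
      rw [hU, lin_add _ _ _ _ _ _ hΩ contDiffOn_const sV hxΩ, lin_const, zero_add]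
    have hs2 : √(X x) ^ 2 = X x := Real.sq_sqrt (hX0 x)
    have hLX := lin_normSqFamily_ge (P x) (Q x) 0 c _ hΩ sg hxΩ (hLg x hx)
    have hLV := lin_normSqFamily_ge (P x) (Q x) 0 c _ hΩ hw hxΩ (hLw x hx)
    have hW := gam_normSqFamily_le hP hQ fun i => differentiableAt_of_smooth hΩ (hw i) hxΩ
    change 2 * normSqFamily (gradFamily (gradFamily w)) x - _ * √(X x)
      ≤ lin (1, 0) (0, 1) (P x) (Q x) 0 c X x at hLX
    change 2 * X x - _ * √(V x) ≤ lin (1, 0) (0, 1) (P x) (Q x) 0 c V x at hLV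
    change gam (1, 0) (0, 1) (P x) (Q x) V V x ≤ _ * (4 * V x * X x) at hW
    set t := √(normSqFamily (gradFamily (gradFamily w)) x) with ht
    have ht2 : t ^ 2 = normSqFamily (gradFamily (gradFamily w)) x :=
      Real.sq_sqrt normSqFamily_nonneg
    have hLX' : 2 * t ^ 2 - 2 * E * (1 + √(X x) ^ 2 + t) * √(X x)
        ≤ lin (1, 0) (0, 1) (P x) (Q x) 0 c X x := by
      rw [hs2, ht2, hE]
      linarith
    have hLV' : 2 * √(X x) ^ 2 - 2 * D * (1 + √(X x))
        ≤ lin (1, 0) (0, 1) (P x) (Q x) 0 c V x := by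
      have h1 : √(V x) ≤ √M := Real.sqrt_le_sqrt (hV x hx)
      have h2 := mul_le_mul_of_nonneg_left h1
        (by positivity : 0 ≤ Fintype.card ι * C * (1 + √(X x)))
      rw [hs2, hD]
      linarith
    have hW' : gam (1, 0) (0, 1) (P x) (Q x) V V x ≤ C₂ * √(X x) ^ 2 := by
      have h2 := mul_le_mul_of_nonneg_left (mul_le_mul_of_nonneg_right (hV x hx) (hX0 x))
        (by positivity : 0 ≤ (1 + 2 * Λ ^ 2) * 4)
      rw [hs2, hC₂]
      linarith
    have hGFV : ∀ G, gam (1, 0) (0, 1) (P x) (Q x) (X * U) G x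
        = X x * gam (1, 0) (0, 1) (P x) (Q x) V G x
          + U x * gam (1, 0) (0, 1) (P x) (Q x) X G x := fun G => by
      rw [gam_mul_left _ _ _ _ dX dU, gU]
    have hH : gam (1, 0) (0, 1) (P x) (Q x) (X * U) V x
        = U x * gam (1, 0) (0, 1) (P x) (Q x) X V x
          + √(X x) ^ 2 * gam (1, 0) (0, 1) (P x) (Q x) V V x := by
      rw [hGFV, hs2]; ring
    have hLF : lin (1, 0) (0, 1) (P x) (Q x) 0 c (X * U) x
        = U x * lin (1, 0) (0, 1) (P x) (Q x) 0 c X x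
          + √(X x) ^ 2 * lin (1, 0) (0, 1) (P x) (Q x) 0 c V x
          + 2 * gam (1, 0) (0, 1) (P x) (Q x) X V x := by
      rw [lin_mul _ _ _ _ _ _ hΩ sX sU hxΩ, lU, gam_symm (F := X) (G := U), gU,
        gam_symm (F := V) (G := X), hs2]
      ring
    have hFx : (X * U) x = √(X x) ^ 2 * U x := by rw [hs2]; rfl
    have hq := gam_quadratic_nonneg (x := x) (1, 0) (0, 1) (P x) (Q x) 1 (√(X x) ^ 2) (X * U) V
    rw [gam_symm (F := V) (G := X * U)] at hq
    rw [hLF, hFx]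
    rw [hFx] at hF
    refine bernstein_scalar (Real.sqrt_nonneg _) hD0 hE0 (gam_self_nonneg _ _ _ _) (hU1 x)
      (by rw [hUx]; linarith [hV0 x]) (by rw [hUx]; linarith [hV x hx]) hF hLX' hLV' hH hW' ?_
    linarith

end Bernstein

/-- Iterated coordinate derivatives, indexed by words in the two directions. -/
noncomputable def jet (u : ℝ × ℝ → ℝ) : List Bool → ℝ × ℝ → ℝ
  | [] => u
  | b :: α => dirD (dir b) (jet u α)

lemma smooth_jet {Ω : Set (ℝ × ℝ)} {u : ℝ × ℝ → ℝ} (hΩ : IsOpen Ω)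
    (hu : ContDiffOn ℝ (⊤ : ℕ∞) u Ω) (α : List Bool) : ContDiffOn ℝ (⊤ : ℕ∞) (jet u α) Ω := by
  induction α with
  | nil => exact hu
  | cons b α ih => exact smooth_dirD hΩ ih _

/-- `Tame wt K k d f`: the derivatives of order `j ≤ d` of the sequence `f` are bounded on `K` by
multiples of the weight of level `k + j`. -/
def Tame (wt : ℕ → ℕ → ℝ × ℝ → ℝ) (K : Set (ℝ × ℝ)) : ℕ → ℕ → (ℕ → ℝ × ℝ → ℝ) → Prop
  | k, 0, f => ∃ C : ℝ, ∀ n, ∀ x ∈ K, |f n x| ≤ C * wt k n x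
  | k, d + 1, f => (∃ C : ℝ, ∀ n, ∀ x ∈ K, |f n x| ≤ C * wt k n x) ∧
      ∀ b, Tame wt K (k + 1) d fun n => dirD (dir b) (f n)

/-- Weights compatible with the products occurring at order `m + 2`. -/
structure IsScale (m : ℕ) (wt : ℕ → ℕ → ℝ × ℝ → ℝ) : Prop where
  one_le : ∀ k n x, 1 ≤ wt k n x
  mono : ∀ {i k} n x, i ≤ k → wt i n x ≤ wt k n x
  mul_le : ∀ {i j k} n x, i ≤ k → j ≤ k → i + j ≤ k + m → k ≤ m + 2 →
    wt i n x * wt j n x ≤ wt k n x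

namespace Tame

variable {m : ℕ} {wt : ℕ → ℕ → ℝ × ℝ → ℝ} {K Ω : Set (ℝ × ℝ)} {f g : ℕ → ℝ × ℝ → ℝ} {i j k d : ℕ}

lemma bound (h : Tame wt K k d f) : ∃ C : ℝ, ∀ n, ∀ x ∈ K, |f n x| ≤ C * wt k n x := by
  cases d with
  | zero => exact h
  | succ d => exact h.1

lemma intro (h : ∃ C : ℝ, ∀ n, ∀ x ∈ K, |f n x| ≤ C * wt k n x)
    (h' : ∀ d', d = d' + 1 → ∀ b, Tame wt K (k + 1) d' fun n => dirD (dir b) (f n)) :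
    Tame wt K k d f := by
  cases d with
  | zero => exact h
  | succ d => exact ⟨h, h' d rfl⟩

lemma of_succ (h : Tame wt K k (d + 1) f) : Tame wt K k d f := by
  induction d generalizing k f with
  | zero => exact h.1
  | succ d ih => exact ⟨h.1, fun b => ih (h.2 b)⟩

lemma mono (hwt : IsScale m wt) (h : Tame wt K i d f) (hik : i ≤ k) : Tame wt K k d f := by
  have key : ∀ {i k} {f : ℕ → ℝ × ℝ → ℝ}, i ≤ k →
      (∃ C : ℝ, ∀ n, ∀ x ∈ K, |f n x| ≤ C * wt i n x) →
      ∃ C : ℝ, ∀ n, ∀ x ∈ K, |f n x| ≤ C * wt k n x := by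
    rintro i k f hik ⟨C, hC⟩
    refine ⟨|C|, fun n x hx => (hC n x hx).trans ?_⟩
    have h0 := hwt.one_le i n x
    exact mul_le_mul (le_abs_self C) (hwt.mono n x hik) (by linarith) (abs_nonneg C)
  induction d generalizing i k f with
  | zero => exact key hik h
  | succ d ih => exact ⟨key hik h.1, fun b => ih (h.2 b) (by omega)⟩

lemma congr (hΩ : IsOpen Ω) (hK : K ⊆ Ω) (hfg : ∀ n, EqOn (f n) (g n) Ω) (h : Tame wt K k d f) :
    Tame wt K k d g := by
  induction d generalizing k f g with
  | zero =>
    obtain ⟨C, hC⟩ := h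
    exact ⟨C, fun n x hx => by rw [← hfg n (hK hx)]; exact hC n x hx⟩
  | succ d ih =>
    obtain ⟨⟨C, hC⟩, h'⟩ := h
    exact ⟨⟨C, fun n x hx => by rw [← hfg n (hK hx)]; exact hC n x hx⟩,
      fun b => ih (fun n => dirD_congr hΩ (hfg n) _) (h' b)⟩

lemma zero : Tame wt K k d fun _ _ => 0 := by
  induction d generalizing k with
  | zero => exact ⟨0, fun n x _ => by simp⟩
  | succ d ih =>
    refine ⟨⟨0, fun n x _ => by simp⟩, fun b => ?_⟩
    simp only [dirD_const]
    exact ih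

lemma const (hwt : IsScale m wt) (κ : ℝ) : Tame wt K k d fun _ _ => κ := by
  refine intro ⟨|κ|, fun n x _ => le_mul_of_one_le_right (abs_nonneg _) (hwt.one_le k n x)⟩ ?_
  rintro d' - b
  simp only [dirD_const]
  exact zero

lemma add (hΩ : IsOpen Ω) (hK : K ⊆ Ω) (hf : ∀ n, ContDiffOn ℝ (⊤ : ℕ∞) (f n) Ω)
    (hg : ∀ n, ContDiffOn ℝ (⊤ : ℕ∞) (g n) Ω) (h : Tame wt K k d f) (h' : Tame wt K k d g) :
    Tame wt K k d fun n => f n + g n := by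
  induction d generalizing k f g with
  | zero =>
    obtain ⟨C, hC⟩ := h
    obtain ⟨C', hC'⟩ := h'
    refine ⟨C + C', fun n x hx => (abs_add_le _ _).trans ?_⟩
    rw [add_mul]
    exact add_le_add (hC n x hx) (hC' n x hx)
  | succ d ih =>
    refine ⟨?_, fun b => ?_⟩
    · obtain ⟨C, hC⟩ := h.1
      obtain ⟨C', hC'⟩ := h'.1
      refine ⟨C + C', fun n x hx => (abs_add_le _ _).trans ?_⟩
      rw [add_mul]
      exact add_le_add (hC n x hx) (hC' n x hx)
    · refine congr hΩ hK (fun n x hx => ?_) (ih (fun n => smooth_dirD hΩ (hf n) (dir b))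
        (fun n => smooth_dirD hΩ (hg n) (dir b)) (h.2 b) (h'.2 b))
      exact (dirD_add (differentiableAt_of_smooth hΩ (hf n) hx)
        (differentiableAt_of_smooth hΩ (hg n) hx) _).symm

lemma mul (hwt : IsScale m wt) (hΩ : IsOpen Ω) (hK : K ⊆ Ω)
    (hf : ∀ n, ContDiffOn ℝ (⊤ : ℕ∞) (f n) Ω) (hg : ∀ n, ContDiffOn ℝ (⊤ : ℕ∞) (g n) Ω)
    (h : Tame wt K i d f) (h' : Tame wt K j d g) (hik : i ≤ k) (hjk : j ≤ k) (hij : i + j ≤ k + m)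
    (hkd : k + d ≤ m + 2) : Tame wt K k d fun n => f n * g n := by
  induction d generalizing i j k f g with
  | zero =>
    obtain ⟨C, hC⟩ := h.bound
    obtain ⟨C', hC'⟩ := h'.bound
    refine ⟨|C| * |C'|, fun n x hx => ?_⟩
    have h1 := hwt.one_le i n x
    have h2 := hwt.one_le j n x
    change |f n x * g n x| ≤ _
    rw [abs_mul]
    calc |f n x| * |g n x| ≤ (|C| * wt i n x) * (|C'| * wt j n x) := by
          apply mul_le_mul _ _ (abs_nonneg _) (by positivity)
          · exact (hC n x hx).trans (by gcongr; exact le_abs_self C)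
          · exact (hC' n x hx).trans (by gcongr; exact le_abs_self C')
      _ = |C| * |C'| * (wt i n x * wt j n x) := by ring
      _ ≤ _ := mul_le_mul_of_nonneg_left (hwt.mul_le n x hik hjk hij (by omega)) (by positivity)
  | succ d ih =>
    refine ⟨(ih hf hg h.of_succ h'.of_succ hik hjk hij (by omega)).bound, fun b => ?_⟩
    have h1 : Tame wt K (k + 1) d fun n => f n * dirD (dir b) (g n) :=
      ih hf (fun n => smooth_dirD hΩ (hg n) _) h.of_succ (h'.2 b) (by omega) (by omega)
        (by omega) (by omega)
    have h2 : Tame wt K (k + 1) d fun n => g n * dirD (dir b) (f n) :=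
      ih hg (fun n => smooth_dirD hΩ (hf n) _) h'.of_succ (h.2 b) (by omega) (by omega)
        (by omega) (by omega)
    refine congr hΩ hK (fun n x hx => ?_) (add hΩ hK
      (fun n => smooth_mul (hf n) (smooth_dirD hΩ (hg n) _))
      (fun n => smooth_mul (hg n) (smooth_dirD hΩ (hf n) _)) h1 h2)
    exact (dirD_mul (differentiableAt_of_smooth hΩ (hf n) hx)
      (differentiableAt_of_smooth hΩ (hg n) hx) _).symm

lemma of_jet {u : ℕ → ℝ × ℝ → ℝ} {N : ℕ}
    (hu : ∀ α : List Bool, α.length ≤ N →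
      ∃ C : ℝ, ∀ n, ∀ x ∈ K, |jet (u n) α x| ≤ C * wt α.length n x)
    (α : List Bool) (h : α.length + d ≤ N) :
    Tame wt K α.length d fun n => jet (u n) α := by
  induction d generalizing α with
  | zero => exact hu α h
  | succ d ih =>
    refine ⟨hu α (by omega), fun b => ?_⟩
    exact ih (b :: α) (by simp only [List.length_cons]; omega)

end Tame

/-- The linearized translator operator applied to an iterated derivative. -/
noncomputable def jetOp (c : ℝ) (u : ℝ × ℝ → ℝ) (α : List Bool) (x : ℝ × ℝ) : ℝ :=
  lin (1, 0) (0, 1) (dirD (1, 0) u x) (dirD (0, 1) u x) 0 c (jet u α) x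

lemma smooth_lin {Ω : Set (ℝ × ℝ)} {P Q w : ℝ × ℝ → ℝ} (e f : ℝ × ℝ) (b₁ b₂ : ℝ) (hΩ : IsOpen Ω)
    (hP : ContDiffOn ℝ (⊤ : ℕ∞) P Ω) (hQ : ContDiffOn ℝ (⊤ : ℕ∞) Q Ω)
    (hw : ContDiffOn ℝ (⊤ : ℕ∞) w Ω) :
    ContDiffOn ℝ (⊤ : ℕ∞) (fun x => lin e f (P x) (Q x) b₁ b₂ w x) Ω := by
  have he := smooth_dirD hΩ hw e
  have hf := smooth_dirD hΩ hw f
  have hee := smooth_dirD hΩ he e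
  have hef := smooth_dirD hΩ hf e
  have hff := smooth_dirD hΩ hf f
  unfold lin
  exact (((((contDiffOn_const.add (hQ.pow 2)).mul hee).sub
    (((contDiffOn_const.mul hP).mul hQ).mul hef)).add
    ((contDiffOn_const.add (hP.pow 2)).mul hff)).add
    (((contDiffOn_const.add (hP.pow 2)).add (hQ.pow 2)).mul
      ((contDiffOn_const.mul he).add (contDiffOn_const.mul hf))))

namespace Tame

variable {m : ℕ} {wt : ℕ → ℕ → ℝ × ℝ → ℝ} {K Ω : Set (ℝ × ℝ)} {u : ℕ → ℝ × ℝ → ℝ}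

lemma monomial (hwt : IsScale m wt) (hm : 2 ≤ m) (hΩ : IsOpen Ω) (hK : K ⊆ Ω)
    (hs : ∀ n, ContDiffOn ℝ (⊤ : ℕ∞) (u n) Ω)
    (hu : ∀ α : List Bool, α.length ≤ m + 2 →
      ∃ C : ℝ, ∀ n, ∀ x ∈ K, |jet (u n) α x| ≤ C * wt α.length n x)
    (κ : ℝ) {α₁ α₂ β : List Bool} {k d : ℕ} (h₁ : α₁.length ≤ 2) (h₂ : α₂.length ≤ 2)
    (hβ : β.length ≤ k) (hk : 2 ≤ k) (hkd : k + d ≤ m + 2) :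
    Tame wt K k d fun n => (fun _ => κ) * ((jet (u n) α₁ * jet (u n) α₂) * jet (u n) β) := by
  have sj := fun α n => smooth_jet hΩ (hs n) α
  have t₁ : Tame wt K 2 d fun n => jet (u n) α₁ := (of_jet hu α₁ (by omega)).mono hwt h₁
  have t₂ : Tame wt K 2 d fun n => jet (u n) α₂ := (of_jet hu α₂ (by omega)).mono hwt h₂
  have t₃ : Tame wt K k d fun n => jet (u n) β := (of_jet hu β (by omega)).mono hwt hβ
  have t₁₂ : Tame wt K 2 d fun n => jet (u n) α₁ * jet (u n) α₂ :=
    mul hwt hΩ hK (sj α₁) (sj α₂) t₁ t₂ le_rfl le_rfl (by omega) (by omega)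
  have t : Tame wt K k d fun n => (jet (u n) α₁ * jet (u n) α₂) * jet (u n) β :=
    mul hwt hΩ hK (fun n => smooth_mul (sj α₁ n) (sj α₂ n)) (sj β) t₁₂ t₃ hk le_rfl
      (by omega) hkd
  exact mul (i := 0) (j := k) hwt hΩ hK (fun _ => contDiffOn_const)
    (fun n => smooth_mul (smooth_mul (sj α₁ n) (sj α₂ n)) (sj β n)) (const hwt κ) t
    (by omega) le_rfl (by omega) hkd

lemma jetOp (hwt : IsScale m wt) (hm : 2 ≤ m) (hΩ : IsOpen Ω) (hK : K ⊆ Ω) {c : ℝ}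
    (hs : ∀ n, Solves (1, 0) (0, 1) 0 c Ω (u n))
    (hu : ∀ α : List Bool, α.length ≤ m + 2 →
      ∃ C : ℝ, ∀ n, ∀ x ∈ K, |jet (u n) α x| ≤ C * wt α.length n x)
    (α : List Bool) {d : ℕ} (hd : α.length + 1 + d ≤ m + 2) :
    Tame wt K (α.length + 1) d fun n => _root_.jetOp c (u n) α := by
  induction α generalizing d with
  | nil => exact congr hΩ hK (fun n x hx => ((hs n).2 x hx).symm) zero
  | cons b α ih =>
    simp only [List.length_cons] at hd ⊢
    have sj := fun α n => smooth_jet hΩ (hs n).1 α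
    have t₀ := (ih (d := d + 1) (by omega)).2 b
    have mono := fun (κ : ℝ) (α₁ α₂ β : List Bool) h₁ h₂ hβ => monomial hwt hm hΩ hK
      (fun n => (hs n).1) hu κ (α₁ := α₁) (α₂ := α₂) (β := β) (k := α.length + 1 + 1) (d := d)
      h₁ h₂ hβ (by omega) (by omega)
    have sm := fun (κ : ℝ) (α₁ α₂ β : List Bool) n =>
      smooth_mul (contDiffOn_const (c := κ)) (smooth_mul (smooth_mul (sj α₁ n) (sj α₂ n)) (sj β n))
    have hP := fun n => smooth_dirD hΩ (hs n).1 (1, 0)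
    have hQ := fun n => smooth_dirD hΩ (hs n).1 (0, 1)
    have s₀ := fun n => smooth_dirD hΩ (smooth_lin (1, 0) (0, 1) 0 c hΩ (hP n) (hQ n) (sj α n))
      (dir b)
    have t₁ := mono (-2) [false] [b, false] (true :: true :: α) (by simp) (by simp) (by simp)
    have t₂ := mono 2 [true] [b, false] (true :: false :: α) (by simp) (by simp) (by simp)
    have t₃ := mono 2 [false] [b, true] (true :: false :: α) (by simp) (by simp) (by simp)
    have t₄ := mono (-2) [true] [b, true] (false :: false :: α) (by simp) (by simp) (by simp)
    have t₅ := mono (-2 * c) [true] [b, true] (false :: α) (by simp) (by simp) (by simp)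
    have t₆ := mono (-2 * c) [false] [b, false] (false :: α) (by simp) (by simp) (by simp)
    have s₁ := sm (-2) [false] [b, false] (true :: true :: α)
    have s₂ := sm 2 [true] [b, false] (true :: false :: α)
    have s₃ := sm 2 [false] [b, true] (true :: false :: α)
    have s₄ := sm (-2) [true] [b, true] (false :: false :: α)
    have s₅ := sm (-2 * c) [true] [b, true] (false :: α)
    have s₆ := sm (-2 * c) [false] [b, false] (false :: α)
    have t := add hΩ hK s₀ (fun n => smooth_add (s₁ n) (smooth_add (s₂ n) (smooth_add (s₃ n)
      (smooth_add (s₄ n) (smooth_add (s₅ n) (s₆ n)))))) t₀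
      (add hΩ hK s₁ (fun n => smooth_add (s₂ n) (smooth_add (s₃ n)
        (smooth_add (s₄ n) (smooth_add (s₅ n) (s₆ n))))) t₁
      (add hΩ hK s₂ (fun n => smooth_add (s₃ n) (smooth_add (s₄ n) (smooth_add (s₅ n) (s₆ n)))) t₂
      (add hΩ hK s₃ (fun n => smooth_add (s₄ n) (smooth_add (s₅ n) (s₆ n))) t₃
      (add hΩ hK s₄ (fun n => smooth_add (s₅ n) (s₆ n)) t₄ (add hΩ hK s₅ s₆ t₅ t₆)))))
    refine congr hΩ hK (fun n x hx => ?_) t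
    have h := lin_dirD (1, 0) (0, 1) 0 c hΩ (hP n) (hQ n) (sj α n) hx (dir b)
    change _ = lin (1, 0) (0, 1) (dirD (1, 0) (u n) x) (dirD (0, 1) (u n) x) 0 c
      (dirD (dir b) (jet (u n) α)) x
    rw [h]
    simp only [corr, Pi.add_apply, Pi.mul_apply, jet, dir, if_true, Bool.false_eq_true, if_false]
    ring

end Tame

/-- A sequence of functions bounded on every compact subset of `Ω`. -/
def LocBdd (Ω : Set (ℝ × ℝ)) (f : ℕ → ℝ × ℝ → ℝ) : Prop :=
  ∀ K ⊆ Ω, IsCompact K → ∃ C : ℝ, ∀ n, ∀ x ∈ K, |f n x| ≤ C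

/-- The weights measuring derivatives of order at most `m`, of order `m + 1`, and above. -/
noncomputable def weight (m : ℕ) (s t : ℕ → ℝ × ℝ → ℝ) (k n : ℕ) (x : ℝ × ℝ) : ℝ :=
  if k ≤ m then 1 else if k = m + 1 then 1 + s n x else 2 * (1 + s n x ^ 2 + t n x)

lemma isScale_weight (m : ℕ) {s t : ℕ → ℝ × ℝ → ℝ} (hs : ∀ n x, 0 ≤ s n x)
    (ht : ∀ n x, 0 ≤ t n x) : IsScale m (weight m s t) := by
  have h1 : ∀ k n x, 1 ≤ weight m s t k n x := fun k n x => by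
    have := hs n x
    have := ht n x
    have := sq_nonneg (s n x)
    unfold weight
    split_ifs <;> linarith
  have hm : ∀ {i k} n x, i ≤ k → weight m s t i n x ≤ weight m s t k n x := fun {i k} n x hik => by
    by_cases hi : i ≤ m
    · rw [weight, if_pos hi]; exact h1 k n x
    have := ht n x
    have := sq_nonneg (s n x - 1)
    have := sq_nonneg (s n x)
    unfold weight
    rw [if_neg hi, if_neg (by omega : ¬ k ≤ m)]
    split_ifs
    · exact le_rfl
    · linarith
    · omega
    · exact le_rfl
  refine ⟨h1, hm, fun {i j k} n x hi hj hij hk => ?_⟩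
  by_cases him : i ≤ m
  · rw [weight, if_pos him, one_mul]; exact hm n x hj
  by_cases hjm : j ≤ m
  · rw [mul_comm, weight, if_pos hjm, one_mul]; exact hm n x hi
  obtain rfl : i = m + 1 := by omega
  obtain rfl : j = m + 1 := by omega
  obtain rfl : k = m + 2 := by omega
  simp only [weight, him, if_false, if_true, show ¬ m + 2 ≤ m by omega,
    show m + 2 ≠ m + 1 by omega]
  have := ht n x
  have := sq_nonneg (s n x - 1)
  linarith

lemma exists_forall_of_finite {ι : Type*} [Finite ι] {p : ι → ℝ → Prop}
    (hp : ∀ i a b, a ≤ b → p i a → p i b) (h : ∀ i, ∃ C, p i C) : ∃ C, 0 ≤ C ∧ ∀ i, p i C := by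
  choose C hC using h
  obtain ⟨B, hB⟩ := (Set.finite_range C).bddAbove
  exact ⟨max B 0, le_max_right _ _, fun i => hp i _ _
    ((hB ⟨i, rfl⟩).trans (le_max_left _ _)) (hC i)⟩

lemma locBdd_jet_succ {c : ℝ} {Ω : Set (ℝ × ℝ)} {u : ℕ → ℝ × ℝ → ℝ} {m : ℕ} (hm : 2 ≤ m)
    (hΩ : IsOpen Ω) (hs : ∀ n, Solves (1, 0) (0, 1) 0 c Ω (u n))
    (hu : ∀ α : List Bool, α.length ≤ m → LocBdd Ω fun n => jet (u n) α) (α : List Bool)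
    (hα : α.length = m + 1) : LocBdd Ω fun n => jet (u n) α := by
  intro K' hK' hcK'
  obtain ⟨R, hR, hRK⟩ := hcK'.exists_cthickening_subset_open hΩ hK'
  set K := Metric.cthickening R K' with hK
  have hcK : IsCompact K := hcK'.cthickening
  have hball : ∀ x₀ ∈ K', Metric.closedBall x₀ R ⊆ K := fun x₀ hx₀ =>
    Metric.closedBall_subset_cthickening hx₀ R
  set w : ℕ → List.Vector Bool m → ℝ × ℝ → ℝ := fun n i => jet (u n) i.1 with hw
  set s : ℕ → ℝ × ℝ → ℝ := fun n x => √(normSqFamily (gradFamily (w n)) x) with hsdef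
  set t : ℕ → ℝ × ℝ → ℝ := fun n x => √(normSqFamily (gradFamily (gradFamily (w n))) x) with htdef
  set wt := weight m s t with hwt
  have hscale : IsScale m wt :=
    isScale_weight m (fun n x => Real.sqrt_nonneg _) (fun n x => Real.sqrt_nonneg _)
  have hbase : ∀ β : List Bool, β.length ≤ m → ∃ C : ℝ, ∀ n, ∀ x ∈ K, |jet (u n) β x| ≤ C :=
    fun β hβ => hu β hβ K hRK hcK
  have hone : ∀ (β : List Bool) (hβ : β.length = m + 1) n x, |jet (u n) β x| ≤ s n x := by
    intro β hβ n x
    obtain ⟨b, γ, rfl⟩ := List.exists_cons_of_length_eq_add_one hβ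
    exact abs_le_sqrt_normSqFamily (w := gradFamily (w n)) (x := x)
      (⟨γ, by simpa using hβ⟩, b)
  have htwo : ∀ (β : List Bool) (hβ : β.length = m + 2) n x, |jet (u n) β x| ≤ t n x := by
    intro β hβ n x
    obtain ⟨b, γ, rfl⟩ := List.exists_cons_of_length_eq_add_one hβ
    obtain ⟨b', δ, rfl⟩ :=
      List.exists_cons_of_length_eq_add_one (by simpa using hβ : γ.length = m + 1)
    exact abs_le_sqrt_normSqFamily (w := gradFamily (gradFamily (w n))) (x := x)
      ((⟨δ, by simpa using hβ⟩, b'), b)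
  have hjet : ∀ β : List Bool, β.length ≤ m + 2 →
      ∃ C : ℝ, ∀ n, ∀ x ∈ K, |jet (u n) β x| ≤ C * wt β.length n x := by
    intro β hβ
    by_cases h0 : β.length ≤ m
    · obtain ⟨C, hC⟩ := hbase β h0
      refine ⟨C, fun n x hx => ?_⟩
      rw [hwt, weight, if_pos h0, mul_one]
      exact hC n x hx
    · refine ⟨1, fun n x _ => ?_⟩
      have h1 : 0 ≤ s n x := Real.sqrt_nonneg _
      have h2 : 0 ≤ t n x := Real.sqrt_nonneg _
      have h3 := sq_nonneg (s n x)
      by_cases h : β.length = m + 1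
      · rw [hwt, weight, if_neg h0, if_pos h]
        linarith [hone β h n x]
      · rw [hwt, weight, if_neg h0, if_neg h]
        linarith [htwo β (by omega) n x]
  have hop : ∀ β : List Bool, β.length ≤ m + 1 →
      ∃ C : ℝ, ∀ n, ∀ x ∈ K, |jetOp c (u n) β x| ≤ C * wt (β.length + 1) n x := fun β hβ =>
    (Tame.jetOp (d := 0) hscale hm hΩ hRK hs hjet β (by omega)).bound
  have hwt1 : ∀ k n x, 0 ≤ wt k n x := fun k n x => zero_le_one.trans (hscale.one_le k n x)
  obtain ⟨C₁, hC₁, hop₁⟩ := exists_forall_of_finite (ι := List.Vector Bool m)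
    (p := fun i C => ∀ n, ∀ x ∈ K, |jetOp c (u n) i.1 x| ≤ C * wt (m + 1) n x)
    (fun i a b hab h n x hx => (h n x hx).trans (mul_le_mul_of_nonneg_right hab (hwt1 _ n x)))
    (fun i => by have := hop i.1 (by rw [i.2]; omega); rwa [i.2] at this)
  obtain ⟨C₂, hC₂, hop₂⟩ := exists_forall_of_finite (ι := List.Vector Bool m × Bool)
    (p := fun i C => ∀ n, ∀ x ∈ K, |jetOp c (u n) (i.2 :: i.1.1) x| ≤ C * wt (m + 2) n x)
    (fun i a b hab h n x hx => (h n x hx).trans (mul_le_mul_of_nonneg_right hab (hwt1 _ n x)))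
    (fun i => by
      have := hop (i.2 :: i.1.1) (by rw [List.length_cons, i.1.2])
      rwa [List.length_cons, i.1.2] at this)
  obtain ⟨C₀, hC₀, hb₀⟩ := exists_forall_of_finite (ι := List.Vector Bool m)
    (p := fun i C => ∀ n, ∀ x ∈ K, |jet (u n) i.1 x| ≤ C)
    (fun i a b hab h n x hx => (h n x hx).trans hab) (fun i => hbase i.1 (by rw [i.2]))
  obtain ⟨Λ, -, hΛ⟩ := exists_forall_of_finite (ι := Bool)
    (p := fun b C => ∀ n, ∀ x ∈ K, |jet (u n) [b] x| ≤ C)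
    (fun i a b hab h n x hx => (h n x hx).trans hab) (fun b => hbase [b] (by simp; omega))
  obtain ⟨B, hB⟩ := exists_bernstein_bound (List.Vector Bool m) c (C₁ + 2 * C₂) Λ
    (Fintype.card (List.Vector Bool m) * C₀ ^ 2) R (by positivity) (by positivity) hR
  refine ⟨√B, fun n x₀ hx₀ => (hone α hα n x₀).trans (Real.sqrt_le_sqrt ?_)⟩
  have hsub := hball x₀ hx₀
  refine hB Ω (dirD (1, 0) (u n)) (dirD (0, 1) (u n)) (w n) x₀ hΩ (hsub.trans hRK)
    (fun i => smooth_jet hΩ (hs n).1 _)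
    (fun x hx => ⟨hΛ true n x (hsub hx), hΛ false n x (hsub hx)⟩)
    (fun x hx => ?_) (fun x hx i => ?_) (fun x hx p => ?_)
  · rw [normSqFamily_apply, ← nsmul_eq_mul, ← Finset.card_univ]
    refine Finset.sum_le_card_nsmul _ _ _ fun i _ => ?_
    have := hb₀ i n x (hsub hx)
    exact sq_le_sq' (neg_le_of_abs_le this) (le_of_abs_le this)
  · have h := hop₁ i n x (hsub hx)
    rw [hwt, weight, if_neg (by omega), if_pos rfl] at h
    refine h.trans (mul_le_mul_of_nonneg_right (by linarith) ?_)
    have : 0 ≤ s n x := Real.sqrt_nonneg _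
    linarith
  · have h := hop₂ p n x (hsub hx)
    rw [hwt, weight, if_neg (by omega), if_neg (by omega)] at h
    have hs2 : s n x ^ 2 = normSqFamily (gradFamily (w n)) x := Real.sq_sqrt normSqFamily_nonneg
    have ht0 : 0 ≤ t n x := Real.sqrt_nonneg _
    rw [hs2] at h
    refine h.trans ?_
    rw [← mul_assoc, mul_comm C₂ 2]
    refine mul_le_mul_of_nonneg_right (by linarith) ?_
    have := normSqFamily_nonneg (w := gradFamily (w n)) (x := x)
    linarith

lemma locBdd_jet {c : ℝ} {Ω : Set (ℝ × ℝ)} {u : ℕ → ℝ × ℝ → ℝ} (hΩ : IsOpen Ω)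
    (hs : ∀ n, Solves (1, 0) (0, 1) 0 c Ω (u n))
    (hu : ∀ α : List Bool, α.length ≤ 2 → LocBdd Ω fun n => jet (u n) α) (α : List Bool) :
    LocBdd Ω fun n => jet (u n) α := by
  have h : ∀ k (α : List Bool), α.length ≤ k + 2 → LocBdd Ω fun n => jet (u n) α := by
    intro k
    induction k with
    | zero => simpa using hu
    | succ k ih =>
      intro α hα
      rcases Nat.lt_or_ge α.length (k + 2 + 1) with h | h
      · exact ih α (by omega)
      · exact locBdd_jet_succ (by omega) hΩ hs ih α (by omega)
  exact h α.length α (by omega)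

section LocalBounds

variable {Ω : Set (ℝ × ℝ)} {u : ℝ × ℝ → ℝ}

lemma dirD_add_const (k : ℝ) (e : ℝ × ℝ) (u : ℝ × ℝ → ℝ) :
    dirD e (fun x => u x + k) = dirD e u := by
  funext x; simp [dirD]

lemma Solves.add_const {e f : ℝ × ℝ} {b₁ b₂ : ℝ} (hu : Solves e f b₁ b₂ Ω u) (k : ℝ) :
    Solves e f b₁ b₂ Ω fun x => u x + k := by
  refine ⟨hu.1.add contDiffOn_const, fun x hx => ?_⟩
  have := hu.2 x hx
  simpa only [lin, dirD_add_const] using this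

lemma solves_iff_isSmoothTranslator {c : ℝ} :
    Solves (1, 0) (0, 1) 0 c Ω u ↔ IsSmoothTranslator c Ω u := by
  refine and_congr_right fun _ => forall₂_congr fun x _ => ?_
  simp only [lin]
  change _ ↔ (1 + dirD (0, 1) u x ^ 2) * dirD (1, 0) (dirD (1, 0) u) x
    - 2 * dirD (1, 0) u x * dirD (0, 1) u x * dirD (1, 0) (dirD (0, 1) u) x
    + (1 + dirD (1, 0) u x ^ 2) * dirD (0, 1) (dirD (0, 1) u) x
    + c * dirD (0, 1) u x * (1 + dirD (1, 0) u x ^ 2 + dirD (0, 1) u x ^ 2) = 0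
  refine Eq.congr_left ?_
  ring

/-- A solution bounded below on a ball and bounded above at its centre is bounded in `C¹` on a
smaller ball of controlled radius. -/
lemma exists_local_bound (c r b m : ℝ) (hr : 0 < r) :
    ∃ ρ : ℝ, 0 < ρ ∧ ρ ≤ r ∧ ∃ C : ℝ, ∀ (Ω : Set (ℝ × ℝ)) (u : ℝ × ℝ → ℝ) (p : ℝ × ℝ),
      IsOpen Ω → Metric.closedBall p (2 * r) ⊆ Ω → Solves (1, 0) (0, 1) 0 c Ω u →
      (∀ x ∈ Metric.closedBall p (2 * r), -b ≤ u x) → u p ≤ m →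
      ∀ x ∈ Metric.closedBall p ρ,
        |u x| ≤ C ∧ |dirD (1, 0) u x| ≤ C ∧ |dirD (0, 1) u x| ≤ C := by
  obtain ⟨B, hB⟩ := exists_gradient_bound c r (|m| + |b| + 2) hr (by positivity)
  set L : ℝ := √(max B 1) with hL
  have hL0 : 0 < L := Real.sqrt_pos.2 (lt_max_of_lt_right one_pos)
  have hL2 : L ^ 2 = max B 1 := Real.sq_sqrt (le_max_of_le_right zero_le_one)
  refine ⟨min r (1 / (4 * L)), lt_min hr (by positivity), min_le_left _ _, |m| + |b| + 1 + L, ?_⟩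
  intro Ω u p hΩ hball hu hlow hup
  have hgrad : ∀ x ∈ Metric.closedBall p r, u x ≤ m + 1 →
      |dirD (1, 0) u x| ≤ L ∧ |dirD (0, 1) u x| ≤ L := by
    intro x hx hux
    have hsub : Metric.closedBall x r ⊆ Metric.closedBall p (2 * r) :=
      Metric.closedBall_subset_closedBall' (by rw [Metric.mem_closedBall] at hx; linarith)
    have h := hB Ω (fun y => u y + b) x hΩ (hsub.trans hball) (hu.add_const b)
      (fun y hy => by have := hlow y (hsub hy); linarith)
      (by linarith [le_abs_self m, le_abs_self b])
    rw [areaSq_apply, dirD_add_const, dirD_add_const] at h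
    have h' := h.trans (le_max_left B 1)
    rw [← hL2] at h'
    constructor <;> refine abs_le_of_sq_le_sq ?_ hL0.le
    · linarith [sq_nonneg (dirD (0, 1) u x)]
    · linarith [sq_nonneg (dirD (1, 0) u x)]
  intro x hx
  set d := x - p with hd
  have hdn : ‖d‖ ≤ min r (1 / (4 * L)) := by rwa [hd, ← dist_eq_norm]
  have hseg : ∀ t ∈ Icc (0 : ℝ) 1, p + t • d ∈ Metric.closedBall p r := by
    intro t ht
    rw [Metric.mem_closedBall, dist_eq_norm, add_sub_cancel_left, norm_smul, Real.norm_eq_abs,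
      abs_of_nonneg ht.1]
    have := hdn.trans (min_le_left _ _)
    exact (mul_le_of_le_one_left (norm_nonneg d) ht.2).trans this
  have hder : ∀ t ∈ Icc (0 : ℝ) 1,
      HasDerivAt (fun t => u (p + t • d)) (dirD d u (p + t • d)) t := fun t ht =>
    hasDerivAt_line (differentiableAt_of_smooth hΩ hu.1
      (hball (Metric.closedBall_subset_closedBall (by linarith) (hseg t ht))))
  have hux : u x ≤ m + 1 := by
    have key := image_le_of_deriv_right_lt_deriv_boundary' (f := fun t => u (p + t • d))
      (f' := fun t => dirD d u (p + t • d)) (a := 0) (b := 1) (B := fun t => m + t)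
      (B' := fun _ => 1) (fun t ht => (hder t ht).continuousAt.continuousWithinAt)
      (fun t ht => (hder t (Ico_subset_Icc_self ht)).hasDerivWithinAt) (by simpa using hup)
      (by fun_prop) (fun t _ => ((hasDerivAt_id t).const_add m).hasDerivWithinAt) ?_
      (right_mem_Icc.2 zero_le_one)
    · simpa [hd] using key
    · intro t ht heq
      obtain ⟨h₁, h₂⟩ := hgrad _ (hseg t (Ico_subset_Icc_self ht)) (by
        rw [heq]; linarith [ht.2])
      set z := p + t • d
      have hdd : dirD d u z = d.1 * dirD (1, 0) u z + d.2 * dirD (0, 1) u z := by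
        rw [← dirD_lin]; congr 1; ext <;> simp
      have hd1 : |d.1| ≤ 1 / (4 * L) := (norm_fst_le d).trans (hdn.trans (min_le_right _ _))
      have hd2 : |d.2| ≤ 1 / (4 * L) := (norm_snd_le d).trans (hdn.trans (min_le_right _ _))
      have e₁ : d.1 * dirD (1, 0) u z ≤ 1 / (4 * L) * L :=
        (le_abs_self _).trans (by rw [abs_mul]; gcongr)
      have e₂ : d.2 * dirD (0, 1) u z ≤ 1 / (4 * L) * L :=
        (le_abs_self _).trans (by rw [abs_mul]; gcongr)
      have e₃ : 1 / (4 * L) * L = 1 / 4 := by field_simp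
      simp only [hdd]
      linarith
  have hxr : x ∈ Metric.closedBall p r := Metric.closedBall_subset_closedBall (min_le_left _ _) hx
  obtain ⟨h₁, h₂⟩ := hgrad x hxr hux
  have hb := hlow x (Metric.closedBall_subset_closedBall (by linarith) hxr)
  have hm0 := abs_nonneg m
  have hb0 := abs_nonneg b
  refine ⟨abs_le.2 ⟨?_, ?_⟩, ?_, ?_⟩
  · linarith [le_abs_self b]
  · linarith [le_abs_self m]
  · linarith
  · linarith

lemma locBdd_of_forall_exists {f : ℕ → ℝ × ℝ → ℝ}
    (h : ∀ p ∈ Ω, ∃ U ∈ 𝓝 p, ∃ C : ℝ, ∀ n, ∀ x ∈ U, |f n x| ≤ C) : LocBdd Ω f := by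
  intro K hK hKc
  refine hKc.induction_on (p := fun s => ∃ C : ℝ, ∀ n, ∀ x ∈ s, |f n x| ≤ C) ⟨0, by simp⟩
    (fun s t hst ⟨C, hC⟩ => ⟨C, fun n x hx => hC n x (hst hx)⟩) ?_ ?_
  · rintro s t ⟨C, hC⟩ ⟨D, hD⟩
    refine ⟨max C D, fun n x hx => ?_⟩
    rcases hx with hx | hx
    · exact (hC n x hx).trans (le_max_left _ _)
    · exact (hD n x hx).trans (le_max_right _ _)
  · intro x hx
    obtain ⟨U, hU, hC⟩ := h x (hK hx)
    exact ⟨U, mem_nhdsWithin_of_mem_nhds hU, hC⟩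

end LocalBounds

section ConvergenceSet

variable {c : ℝ} {Ω : Set (ℝ × ℝ)} {u : ℕ → ℝ × ℝ → ℝ} {p : ℝ × ℝ}

lemma monotone_of_forall_le_succ (hmono : ∀ n, ∀ p ∈ Ω, u n p ≤ u (n + 1) p) (hp : p ∈ Ω) :
    Monotone fun n => u n p :=
  monotone_nat_of_le_succ fun n => hmono n p hp

lemma exists_local_bound_of_mem_convSet (hΩ : IsOpen Ω)
    (hu : ∀ n, Solves (1, 0) (0, 1) 0 c Ω (u n))
    (hmono : ∀ n, ∀ p ∈ Ω, u n p ≤ u (n + 1) p) (hp : p ∈ convSet Ω u) :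
    ∃ ρ : ℝ, 0 < ρ ∧ Metric.closedBall p ρ ⊆ Ω ∧ ∃ C : ℝ, ∀ n, ∀ x ∈ Metric.closedBall p ρ,
      |u n x| ≤ C ∧ |dirD (1, 0) (u n) x| ≤ C ∧ |dirD (0, 1) (u n) x| ≤ C := by
  obtain ⟨hpΩ, m, hm⟩ := hp
  obtain ⟨R, hR, hball⟩ := Metric.nhds_basis_closedBall.mem_iff.1 (hΩ.mem_nhds hpΩ)
  obtain ⟨b, hb⟩ := (isCompact_closedBall p R).bddBelow_image ((hu 0).1.continuousOn.mono hball)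
  have h2 : 2 * (R / 2) = R := by ring
  obtain ⟨ρ, hρ, hρR, C, hC⟩ := exists_local_bound c (R / 2) (-b) m (by positivity)
  refine ⟨ρ, hρ, (Metric.closedBall_subset_closedBall (by linarith)).trans hball, C, fun n =>
    hC Ω (u n) p hΩ (by rwa [h2]) (hu n) (fun x hx => ?_) (hm n)⟩
  rw [h2] at hx
  rw [neg_neg]
  exact (hb (mem_image_of_mem _ hx)).trans (monotone_of_forall_le_succ hmono (hball hx) n.zero_le)

lemma isOpen_convSet (hΩ : IsOpen Ω) (hu : ∀ n, Solves (1, 0) (0, 1) 0 c Ω (u n))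
    (hmono : ∀ n, ∀ p ∈ Ω, u n p ≤ u (n + 1) p) : IsOpen (convSet Ω u) := by
  refine isOpen_iff_mem_nhds.2 fun p hp => ?_
  obtain ⟨ρ, hρ, hball, C, hC⟩ := exists_local_bound_of_mem_convSet hΩ hu hmono hp
  exact mem_of_superset (Metric.closedBall_mem_nhds p hρ) fun x hx =>
    ⟨hball hx, C, fun n => le_of_abs_le (hC n x hx).1⟩

lemma locBdd_jet_convSet (hΩ : IsOpen Ω) (hu : ∀ n, Solves (1, 0) (0, 1) 0 c Ω (u n))
    (hmono : ∀ n, ∀ p ∈ Ω, u n p ≤ u (n + 1) p) (α : List Bool) :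
    LocBdd (convSet Ω u) fun n => jet (u n) α := by
  have hsub : convSet Ω u ⊆ Ω := fun x hx => hx.1
  refine locBdd_jet (isOpen_convSet hΩ hu hmono)
    (fun n => ⟨(hu n).1.mono hsub, fun x hx => (hu n).2 x (hsub hx)⟩) (fun α hα => ?_) α
  refine locBdd_of_forall_exists fun p hp => ?_
  obtain ⟨ρ, hρ, hball, C, hC⟩ := exists_local_bound_of_mem_convSet hΩ hu hmono hp
  obtain ⟨B, hB⟩ := exists_hessian_bound c C (ρ / 2) (by positivity)
  refine ⟨_, Metric.closedBall_mem_nhds p (half_pos hρ), max C √B, fun n x hx => ?_⟩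
  have hsub' : Metric.closedBall x (ρ / 2) ⊆ Metric.closedBall p ρ :=
    Metric.closedBall_subset_closedBall' (by rw [Metric.mem_closedBall] at hx; linarith)
  have hxρ : x ∈ Metric.closedBall p ρ :=
    Metric.closedBall_subset_closedBall (by linarith) hx
  have hH := hB Ω (u n) x hΩ (hsub'.trans hball) (hu n) fun y hy => (hC n y (hsub' hy)).2
  have hcomm := dirD_comm hΩ (hu n).1 (hball hxρ) (1, 0) (0, 1)
  obtain ⟨h₀, h₁, h₂⟩ := hC n x hxρ
  set a := dirD (1, 0) (dirD (1, 0) (u n)) x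
  set b := dirD (1, 0) (dirD (0, 1) (u n)) x
  set d := dirD (0, 1) (dirD (0, 1) (u n)) x
  have hq : ∀ y, y ^ 2 ≤ B → |y| ≤ √B := fun y hy => Real.abs_le_sqrt hy
  match α, hα with
  | [], _ => exact h₀.trans (le_max_left _ _)
  | [true], _ => exact h₁.trans (le_max_left _ _)
  | [false], _ => exact h₂.trans (le_max_left _ _)
  | [true, true], _ =>
    exact (hq a (by linarith [sq_nonneg b, sq_nonneg d])).trans (le_max_right _ _)
  | [true, false], _ =>
    exact (hq b (by linarith [sq_nonneg a, sq_nonneg b, sq_nonneg d])).trans (le_max_right _ _)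
  | [false, true], _ =>
    have := (hq b (by linarith [sq_nonneg a, sq_nonneg b, sq_nonneg d])).trans
      (le_max_right C _)
    rw [hcomm] at this
    exact this
  | [false, false], _ =>
    exact (hq d (by linarith [sq_nonneg a, sq_nonneg b])).trans (le_max_right _ _)

/-- The sequence diverges locally uniformly off the convergence set. -/
lemma eventually_forall_le_of_subset_diff (hΩ : IsOpen Ω)
    (hu : ∀ n, ContinuousOn (u n) Ω) (hmono : ∀ n, ∀ p ∈ Ω, u n p ≤ u (n + 1) p)
    {K : Set (ℝ × ℝ)} (hK : K ⊆ Ω \ convSet Ω u) (hKc : IsCompact K) (M : ℝ) :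
    ∀ᶠ n in atTop, ∀ p ∈ K, M ≤ u n p := by
  refine hKc.induction_on (p := fun s => ∀ᶠ n in atTop, ∀ p ∈ s, M ≤ u n p) (by simp)
    (fun s t hst h => h.mono fun n hn p hp => hn p (hst hp)) (fun s t hs ht => ?_)
    (fun x hx => ?_)
  · filter_upwards [hs, ht] with n h₁ h₂ p hp
    exact hp.elim (h₁ p) (h₂ p)
  · obtain ⟨hxΩ, hxC⟩ := hK hx
    obtain ⟨N, hN⟩ : ∃ N, M < u N x := by
      by_contra! h
      exact hxC ⟨hxΩ, M, h⟩
    have h₁ : ∀ᶠ y in 𝓝 x, M < u N y :=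
      ((hu N).continuousAt (hΩ.mem_nhds hxΩ)).eventually (lt_mem_nhds hN)
    refine ⟨{y | M < u N y ∧ y ∈ Ω},
      mem_nhdsWithin_of_mem_nhds (h₁.and (hΩ.mem_nhds hxΩ)), ?_⟩
    filter_upwards [eventually_ge_atTop N] with n hn y hy
    exact hy.1.le.trans (monotone_of_forall_le_succ hmono hy.2 hn)

end ConvergenceSet

section Limit

variable {D : Set (ℝ × ℝ)} {f : ℕ → ℝ × ℝ → ℝ} {v : ℝ × ℝ → ℝ} {x : ℝ × ℝ}

lemma norm_le_of_abs_apply_le {φ : ℝ × ℝ →L[ℝ] ℝ} {C : ℝ} (h₁ : |φ (1, 0)| ≤ C)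
    (h₂ : |φ (0, 1)| ≤ C) : ‖φ‖ ≤ 2 * C := by
  have hC : 0 ≤ C := (abs_nonneg _).trans h₁
  refine φ.opNorm_le_bound (by positivity) fun y => ?_
  have hy : φ y = y.1 * φ (1, 0) + y.2 * φ (0, 1) := by
    rw [← smul_eq_mul, ← smul_eq_mul, ← map_smul, ← map_smul, ← map_add]; simp
  have e₁ : |y.1 * φ (1, 0)| ≤ ‖y‖ * C := by
    rw [abs_mul]; exact mul_le_mul (norm_fst_le y) h₁ (abs_nonneg _) (norm_nonneg y)
  have e₂ : |y.2 * φ (0, 1)| ≤ ‖y‖ * C := by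
    rw [abs_mul]; exact mul_le_mul (norm_snd_le y) h₂ (abs_nonneg _) (norm_nonneg y)
  rw [Real.norm_eq_abs, hy]
  linarith [abs_add_le (y.1 * φ (1, 0)) (y.2 * φ (0, 1))]

lemma abs_taylor_le (hD : IsOpen D) {f : ℝ × ℝ → ℝ} (hf : ContDiffOn ℝ (⊤ : ℕ∞) f D) {C r : ℝ}
    (hball : Metric.closedBall x r ⊆ D)
    (hC : ∀ b b' : Bool, ∀ y ∈ Metric.closedBall x r, |dirD (dir b) (dirD (dir b') f) y| ≤ C)
    {y : ℝ × ℝ} (hy : y ∈ Metric.closedBall x r) :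
    |f y - f x - fderiv ℝ f x (y - x)| ≤ 4 * C * ‖y - x‖ ^ 2 := by
  have hr : 0 ≤ r := dist_nonneg.trans hy
  have hxr : x ∈ Metric.closedBall x r := Metric.mem_closedBall_self hr
  have hlip : ∀ b, ∀ z ∈ Metric.closedBall x r,
      |dirD (dir b) f z - dirD (dir b) f x| ≤ 2 * C * ‖z - x‖ := by
    intro b z hz
    exact (convex_closedBall x r).norm_image_sub_le_of_norm_fderiv_le (𝕜 := ℝ)
      (fun w hw => differentiableAt_of_smooth hD (smooth_dirD hD hf _) (hball hw))
      (fun w hw => norm_le_of_abs_apply_le (hC true b w hw) (hC false b w hw)) hxr hz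
  have hyx : ‖y - x‖ ≤ r := by rwa [← dist_eq_norm]
  have hsub : Metric.closedBall x ‖y - x‖ ⊆ Metric.closedBall x r :=
    Metric.closedBall_subset_closedBall hyx
  have hC0 : 0 ≤ C := (abs_nonneg _).trans (hC true true x hxr)
  have := (convex_closedBall x ‖y - x‖).norm_image_sub_le_of_norm_hasFDerivWithin_le'
    (f := f) (f' := fderiv ℝ f) (φ := fderiv ℝ f x) (C := 4 * C * ‖y - x‖) (x := x) (y := y)
    (fun z hz =>
      (differentiableAt_of_smooth hD hf (hball (hsub hz))).hasFDerivAt.hasFDerivWithinAt)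
    (fun z hz => ?_) (Metric.mem_closedBall_self (norm_nonneg _))
    (by rw [Metric.mem_closedBall, dist_eq_norm])
  · rw [Real.norm_eq_abs] at this
    linarith [this]
  · have hzx : ‖z - x‖ ≤ ‖y - x‖ := by rwa [← dist_eq_norm]
    have h : ∀ b, |dirD (dir b) f z - dirD (dir b) f x| ≤ 2 * C * ‖y - x‖ := fun b =>
      (hlip b z (hsub hz)).trans (by gcongr)
    refine (norm_le_of_abs_apply_le (h true) (h false)).trans (by linarith)

lemma cauchySeq_of_forall_exists_dist_le {a : ℕ → ℝ}
    (h : ∀ ε > 0, ∃ b : ℕ → ℝ, CauchySeq b ∧ ∀ n, dist (a n) (b n) ≤ ε) : CauchySeq a := by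
  refine Metric.cauchySeq_iff.2 fun ε hε => ?_
  obtain ⟨b, hb, hab⟩ := h (ε / 4) (by positivity)
  obtain ⟨N, hN⟩ := Metric.cauchySeq_iff.1 hb (ε / 2) (by positivity)
  refine ⟨N, fun m hm n hn => ?_⟩
  have h₁ := hN m hm n hn
  have h₂ := dist_triangle4 (a m) (b m) (b n) (a n)
  have h₃ := hab m
  have h₄ := hab n
  rw [dist_comm] at h₄
  linarith

/-- Pointwise limits of sequences with locally bounded second derivatives are differentiable, and
the derivatives converge to that of the limit. -/
lemma differentiableAt_and_tendsto_dirD (hD : IsOpen D) (hf : ∀ n, ContDiffOn ℝ (⊤ : ℕ∞) (f n) D)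
    (hb : ∀ α, LocBdd D fun n => jet (f n) α)
    (hv : ∀ y ∈ D, Tendsto (fun n => f n y) atTop (𝓝 (v y))) (hx : x ∈ D) :
    DifferentiableAt ℝ v x ∧
      ∀ e, Tendsto (fun n => dirD e (f n) x) atTop (𝓝 (dirD e v x)) := by
  obtain ⟨r, hr, hball⟩ := Metric.nhds_basis_closedBall.mem_iff.1 (hD.mem_nhds hx)
  obtain ⟨C, hC⟩ : ∃ C : ℝ, ∀ n, ∀ b b' : Bool, ∀ y ∈ Metric.closedBall x r,
      |dirD (dir b) (dirD (dir b') (f n)) y| ≤ C := by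
    choose C hC using fun α => hb α _ hball (isCompact_closedBall x r)
    refine ⟨max (max (C [true, true]) (C [true, false])) (max (C [false, true]) (C [false, false])),
      fun n b b' y hy => (hC [b, b'] n y hy).trans ?_⟩
    cases b <;> cases b' <;> simp
  have hC0 : 0 ≤ C :=
    (abs_nonneg _).trans (hC 0 true true x (Metric.mem_closedBall_self hr.le))
  have htaylor : ∀ n, ∀ y ∈ Metric.closedBall x r,
      |f n y - f n x - dirD (y - x) (f n) x| ≤ 4 * C * ‖y - x‖ ^ 2 := fun n y hy =>
    abs_taylor_le hD (hf n) hball (hC n) hy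
  have hcauchy : ∀ b, CauchySeq fun n => dirD (dir b) (f n) x := by
    intro b
    refine cauchySeq_of_forall_exists_dist_le fun ε hε => ?_
    set h := min r (ε / (4 * C + 1)) with hh
    have hh0 : 0 < h := lt_min hr (by positivity)
    have hdir : ‖dir b‖ = 1 := by cases b <;> simp [dir, Prod.norm_def]
    have hnorm : ‖h • dir b‖ = h := by
      rw [norm_smul, hdir, mul_one, Real.norm_eq_abs, abs_of_pos hh0]
    have hmem : x + h • dir b ∈ Metric.closedBall x r := by
      rw [Metric.mem_closedBall, dist_eq_norm, add_sub_cancel_left, hnorm]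
      exact min_le_left _ _
    refine ⟨fun n => (f n (x + h • dir b) - f n x) / h,
      (((hv _ (hball hmem)).sub (hv x hx)).div_const h).cauchySeq, fun n => ?_⟩
    have ht := htaylor n _ hmem
    rw [add_sub_cancel_left, hnorm] at ht
    have hlin : dirD (h • dir b) (f n) x = h * dirD (dir b) (f n) x := by simp [dirD]
    rw [hlin] at ht
    have hCh : 4 * C * h ≤ ε := by
      have h₁ : h * (4 * C + 1) ≤ ε :=
        (le_div_iff₀ (by positivity)).1 (min_le_right r (ε / (4 * C + 1)))
      linarith
    rw [Real.dist_eq, abs_sub_comm]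
    have heq : (f n (x + h • dir b) - f n x) / h - dirD (dir b) (f n) x
        = (f n (x + h • dir b) - f n x - h * dirD (dir b) (f n) x) / h := by
      field_simp
    rw [heq, abs_div, abs_of_pos hh0, div_le_iff₀ hh0]
    refine ht.trans ?_
    rw [pow_two, ← mul_assoc]
    exact mul_le_mul_of_nonneg_right hCh hh0.le
  obtain ⟨a₁, ha₁⟩ := cauchySeq_tendsto_of_complete (hcauchy true)
  obtain ⟨a₂, ha₂⟩ := cauchySeq_tendsto_of_complete (hcauchy false)
  set ψ : ℝ × ℝ →L[ℝ] ℝ :=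
    a₁ • ContinuousLinearMap.fst ℝ ℝ ℝ + a₂ • ContinuousLinearMap.snd ℝ ℝ ℝ with hψ
  have htend : ∀ e, Tendsto (fun n => dirD e (f n) x) atTop (𝓝 (ψ e)) := by
    intro e
    have h₁ : ∀ n, dirD e (f n) x = e.1 * dirD (1, 0) (f n) x + e.2 * dirD (0, 1) (f n) x := by
      intro n; rw [← dirD_lin]; congr 1; ext <;> simp
    have h₂ : ψ e = e.1 * a₁ + e.2 * a₂ := by simp [hψ, mul_comm]
    simp only [h₁, h₂]
    exact (ha₁.const_mul e.1).add (ha₂.const_mul e.2)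
  have hder : HasFDerivAt v ψ x := by
    have hO : (fun y => v y - v x - ψ (y - x)) =O[𝓝 x] fun y => ‖y - x‖ ^ 2 := by
      refine Asymptotics.IsBigO.of_bound (4 * C) ?_
      filter_upwards [Metric.closedBall_mem_nhds x hr] with y hy
      rw [Real.norm_eq_abs, norm_pow, norm_norm]
      exact le_of_tendsto (((hv y (hball hy)).sub (hv x hx)).sub (htend (y - x))).abs
        (Eventually.of_forall fun n => htaylor n y hy)
    have h₁ : HasFDerivAt (fun y => v y - v x - ψ (y - x)) (0 : ℝ × ℝ →L[ℝ] ℝ) x :=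
      hO.hasFDerivAt one_lt_two
    have h₂ : HasFDerivAt (fun y => ψ (y - x) + v x) ψ x := by
      simp only [map_sub]
      exact (ψ.hasFDerivAt.sub_const _).add_const _
    have h₃ := h₁.add h₂
    rw [zero_add] at h₃
    exact h₃.congr_of_eventuallyEq (Eventually.of_forall fun y => by simp only [Pi.add_apply]; ring)
  refine ⟨hder.differentiableAt, fun e => ?_⟩
  have : dirD e v x = ψ e := by rw [dirD, hder.fderiv]
  rw [this]
  exact htend e

lemma jet_dirD (f : ℝ × ℝ → ℝ) (b : Bool) (α : List Bool) :
    jet (dirD (dir b) f) α = jet f (α ++ [b]) := by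
  induction α with
  | nil => rfl
  | cons a α ih => simp only [List.cons_append, jet, ih]

lemma locBdd_jet_dirD (hb : ∀ α, LocBdd D fun n => jet (f n) α) (b : Bool) (α : List Bool) :
    LocBdd D fun n => jet (dirD (dir b) (f n)) α := by
  simpa only [jet_dirD] using hb (α ++ [b])

lemma contDiffOn_of_tendsto (hD : IsOpen D) (hf : ∀ n, ContDiffOn ℝ (⊤ : ℕ∞) (f n) D)
    (hb : ∀ α, LocBdd D fun n => jet (f n) α)
    (hv : ∀ y ∈ D, Tendsto (fun n => f n y) atTop (𝓝 (v y))) :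
    ContDiffOn ℝ (⊤ : ℕ∞) v D := by
  refine contDiffOn_infty.2 fun k => ?_
  induction k generalizing f v with
  | zero =>
    exact contDiffOn_zero.2 fun x hx => (differentiableAt_and_tendsto_dirD hD hf hb hv
      hx).1.continuousAt.continuousWithinAt
  | succ k ih =>
    refine (contDiffOn_succ_iff_fderiv_of_isOpen hD).2 ⟨fun x hx =>
      (differentiableAt_and_tendsto_dirD hD hf hb hv hx).1.differentiableWithinAt,
      fun h => (WithTop.coe_ne_top (a := (k : ℕ∞)) h).elim, ?_⟩
    have h : ∀ b, ContDiffOn ℝ k (dirD (dir b) v) D := fun b =>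
      ih (fun n => smooth_dirD hD (hf n) (dir b)) (locBdd_jet_dirD hb b)
        fun y hy => (differentiableAt_and_tendsto_dirD hD hf hb hv hy).2 (dir b)
    have heq : fderiv ℝ v = fun x => dirD (dir true) v x • ContinuousLinearMap.fst ℝ ℝ ℝ
        + dirD (dir false) v x • ContinuousLinearMap.snd ℝ ℝ ℝ := by
      funext x; ext <;> simp [dirD, dir]
    rw [heq]
    exact ((h true).smul contDiffOn_const).add ((h false).smul contDiffOn_const)

lemma solves_of_tendsto {c : ℝ} (hD : IsOpen D) (hs : ∀ n, Solves (1, 0) (0, 1) 0 c D (f n))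
    (hb : ∀ α, LocBdd D fun n => jet (f n) α)
    (hv : ∀ y ∈ D, Tendsto (fun n => f n y) atTop (𝓝 (v y))) :
    Solves (1, 0) (0, 1) 0 c D v := by
  have hf := fun n => (hs n).1
  refine ⟨contDiffOn_of_tendsto hD hf hb hv, fun x hx => ?_⟩
  have h₁ : ∀ b, ∀ y ∈ D, Tendsto (fun n => dirD (dir b) (f n) y) atTop (𝓝 (dirD (dir b) v y)) :=
    fun b y hy => (differentiableAt_and_tendsto_dirD hD hf hb hv hy).2 _
  have h₂ : ∀ b b', Tendsto (fun n => dirD (dir b) (dirD (dir b') (f n)) x) atTop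
      (𝓝 (dirD (dir b) (dirD (dir b') v) x)) := fun b b' =>
    (differentiableAt_and_tendsto_dirD hD (fun n => smooth_dirD hD (hf n) (dir b'))
      (locBdd_jet_dirD hb b') (h₁ b') hx).2 _
  have hP := h₁ true x hx
  have hQ := h₁ false x hx
  have hlim := ((((hQ.pow 2).const_add 1).mul (h₂ true true)).sub
    (((hP.const_mul 2).mul hQ).mul (h₂ true false))).add
    (((hP.pow 2).const_add 1).mul (h₂ false false)) |>.add
    ((((hP.pow 2).const_add 1).add (hQ.pow 2)).mul ((hP.const_mul 0).add (hQ.const_mul c)))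
  refine tendsto_nhds_unique hlim (tendsto_const_nhds.congr fun n => ?_)
  exact ((hs n).2 x hx).symm

end Limit

/-- Convergence–divergence dichotomy for a monotone increasing sequence of smooth
c-translator solutions: the convergence set `𝒞` is open, the sequence converges
uniformly on compact subsets of `𝒞` to a smooth c-translator solution, diverges
uniformly to `+∞` on compact subsets of `Ω \ 𝒞`, and `𝒞` is non-empty as soon as the
sequence is bounded at one point. -/
theorem translator_dichotomy (c : ℝ) (Ω : Set (ℝ × ℝ)) (hΩ : IsOpen Ω)
    (u : ℕ → ℝ × ℝ → ℝ) (hu : ∀ n, IsSmoothTranslator c Ω (u n))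
    (hmono : ∀ n, ∀ p ∈ Ω, u n p ≤ u (n + 1) p) :
    IsOpen (convSet Ω u) ∧
    (∃ v : ℝ × ℝ → ℝ, IsSmoothTranslator c (convSet Ω u) v ∧
      ∀ K : Set (ℝ × ℝ), K ⊆ convSet Ω u → IsCompact K →
        TendstoUniformlyOn u v atTop K) ∧
    (∀ K : Set (ℝ × ℝ), K ⊆ Ω \ convSet Ω u → IsCompact K →
      ∀ M : ℝ, ∀ᶠ n in atTop, ∀ p ∈ K, M ≤ u n p) ∧
    (∀ p ∈ Ω, (∃ M : ℝ, ∀ n, u n p ≤ M) → (convSet Ω u).Nonempty) := by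
  have hs : ∀ n, Solves (1, 0) (0, 1) 0 c Ω (u n) := fun n =>
    solves_iff_isSmoothTranslator.2 (hu n)
  have hopen := isOpen_convSet hΩ hs hmono
  have hsub : convSet Ω u ⊆ Ω := fun p hp => hp.1
  have hlim : ∀ p ∈ convSet Ω u, Tendsto (fun n => u n p) atTop (𝓝 (⨆ n, u n p)) := fun p hp =>
    tendsto_atTop_ciSup (monotone_of_forall_le_succ hmono hp.1)
      (hp.2.imp fun M hM => forall_mem_range.2 hM)
  have hsol : Solves (1, 0) (0, 1) 0 c (convSet Ω u) fun p => ⨆ n, u n p :=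
    solves_of_tendsto hopen
      (fun n => ⟨(hs n).1.mono hsub, fun p hp => (hs n).2 p (hsub hp)⟩)
      (locBdd_jet_convSet hΩ hs hmono) hlim
  refine ⟨hopen, ⟨_, solves_iff_isSmoothTranslator.1 hsol, fun K hK hKc => ?_⟩,
    fun K hK hKc M => ?_, fun p hp hM => ⟨p, hp, hM⟩⟩
  · exact Monotone.tendstoUniformlyOn_of_forall_tendsto hKc
      (fun n => (hs n).1.continuousOn.mono (hK.trans hsub))
      (fun p hp => monotone_of_forall_le_succ hmono (hK hp).1) (hsol.1.continuousOn.mono hK)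
      fun p hp => hlim p (hK hp)
  · exact eventually_forall_le_of_subset_diff hΩ (fun n => (hs n).1.continuousOn) hmono hK hKc M
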